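/- arXiv:1909.04661 — 7 statements merged into one kernel-verified Lean document; each statement's English description precedes it below -/
import Mathlib

section
/- Let (Δ_k)_{k≥1} be a sequence of real random variables. Assume there exist real sequences a_n > 0 and b_n, both tending to zero as n → ∞, such that Z_n := a_n · Σ_{k=1}^n Δ_k + b_n converges in distribution to a random variable Z whose cumulative distribution function is continuous at 0 and such that p := P(Z > 0) ∈ (0,1). Let c₀ ∈ ℝ and define R_n := exp(c₀ + Σ_{k=1}^n Δ_k) and the weight w_n := R_n/(1 + R_n) ∈ (0,1). Then for every ε ∈ (0, 1/2), P(w_n ≥ 1 − ε) → p, P(w_n ≤ ε) → 1 − p, and consequently P(ε < w_n < 1 − ε) → 0 as n → ∞. -/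
open MeasureTheory ProbabilityTheory Filter

section Helpers

variable {Ω : Type*} [MeasurableSpace Ω] {μ : Measure Ω} [IsProbabilityMeasure μ]

theorem measure_setOf_eq_zero_of_continuousAt_cdf {Z : Ω → ℝ} (hZ : Measurable Z) {x : ℝ}
    (hcont : ContinuousAt (fun y => (μ {ω | Z ω ≤ y}).toReal) x) :
    μ {ω | Z ω = x} = 0 := by
  have hbound : ∀ y < x, (μ {ω | Z ω = x}).toReal ≤
      (μ {ω | Z ω ≤ x}).toReal - (μ {ω | Z ω ≤ y}).toReal := by
    intro y hy
    have hdisj : Disjoint {ω | Z ω = x} {ω | Z ω ≤ y} :=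
      Set.disjoint_left.2 fun ω (h : Z ω = x) (h' : Z ω ≤ y) => by linarith
    have hunion : μ.real ({ω | Z ω = x} ∪ {ω | Z ω ≤ y}) =
        μ.real {ω | Z ω = x} + μ.real {ω | Z ω ≤ y} :=
      measureReal_union hdisj (measurableSet_le hZ measurable_const)
    have hle : μ.real ({ω | Z ω = x} ∪ {ω | Z ω ≤ y}) ≤ μ.real {ω | Z ω ≤ x} :=
      measureReal_mono (Set.union_subset (fun ω (h : Z ω = x) => h.le)
        fun ω (h : Z ω ≤ y) => h.trans hy.le)
    simp only [Measure.real] at hunion hle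
    linarith
  have hlim : Tendsto (fun y => (μ {ω | Z ω ≤ x}).toReal - (μ {ω | Z ω ≤ y}).toReal)
      (nhdsWithin x (Set.Iio x)) (nhds 0) := by
    simpa using (hcont.tendsto.mono_left nhdsWithin_le_nhds).const_sub (μ {ω | Z ω ≤ x}).toReal
  have hle := ge_of_tendsto hlim (eventually_nhdsWithin_of_forall hbound)
  exact (ENNReal.toReal_eq_zero_iff _).1 (hle.antisymm ENNReal.toReal_nonneg)
    |>.resolve_right (measure_ne_top _ _)

theorem tendstoInDistribution_of_forall_integral_tendsto {X : ℕ → Ω → ℝ} {Z : Ω → ℝ}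
    (hX : ∀ n, Measurable (X n)) (hZ : Measurable Z)
    (hconv : ∀ f : ℝ → ℝ, Continuous f → (∃ C, ∀ x, |f x| ≤ C) →
      Tendsto (fun n => ∫ ω, f (X n ω) ∂μ) atTop (nhds (∫ ω, f (Z ω) ∂μ))) :
    TendstoInDistribution X atTop Z (fun _ => μ) μ where
  forall_aemeasurable n := (hX n).aemeasurable
  aemeasurable_limit := hZ.aemeasurable
  tendsto := by
    refine ProbabilityMeasure.tendsto_iff_forall_integral_tendsto.2 ?_
    intro f
    have hmap : ∀ Y : Ω → ℝ, Measurable Y → ∫ x, f x ∂(μ.map Y) = ∫ ω, f (Y ω) ∂μ :=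
      fun Y hY => integral_map hY.aemeasurable f.continuous.aestronglyMeasurable
    simp only [ProbabilityMeasure.coe_mk, hmap _ (hX _), hmap _ hZ]
    exact hconv f f.continuous ⟨‖f‖, fun x => f.norm_coe_le_norm x⟩

theorem MeasureTheory.TendstoInDistribution.tendsto_measure_add_const_mem {X : ℕ → Ω → ℝ} {Z : Ω → ℝ}
    (h : TendstoInDistribution X atTop Z (fun _ => μ) μ) (hX : ∀ n, Measurable (X n))
    (hZ : Measurable Z) {t : ℕ → ℝ} (ht : Tendsto t atTop (nhds 0)) {E : Set ℝ}
    (hE : MeasurableSet E) (hfrontier : μ (Z ⁻¹' frontier E) = 0) :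
    Tendsto (fun n => (μ {ω | X n ω + t n ∈ E}).toReal) atTop
      (nhds (μ {ω | Z ω ∈ E}).toReal) := by
  have hconst : TendstoInMeasure μ (fun n (_ : Ω) => t n) atTop (fun _ => (0 : ℝ)) :=
    tendstoInMeasure_of_tendsto_ae (fun _ => aestronglyMeasurable_const)
      (ae_of_all _ fun _ => ht)
  have hsum := h.add_of_tendstoInMeasure_const hconst fun _ => aemeasurable_const
  simp only [add_zero] at hsum
  have hnull : μ.map Z (frontier E) = 0 := by
    rwa [Measure.map_apply hZ isClosed_frontier.measurableSet]
  have hmeas := ProbabilityMeasure.tendsto_measure_of_null_frontier_of_tendsto' hsum.tendsto hnull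
  have hmap : ∀ Y : Ω → ℝ, Measurable Y → μ.map Y E = μ {ω | Y ω ∈ E} :=
    fun Y hY => Measure.map_apply hY hE
  have hXt : ∀ n, Measurable (X n + fun _ => t n) := fun n => (hX n).add measurable_const
  simp only [ProbabilityMeasure.coe_mk, hmap _ (hXt _), hmap _ hZ] at hmeas
  exact (ENNReal.tendsto_toReal (measure_ne_top _ _)).comp hmeas

end Helpers

theorem le_exp_div_one_add_exp_iff {c x : ℝ} (hc0 : 0 < c) (hc1 : c < 1) :
    c ≤ Real.exp x / (1 + Real.exp x) ↔ Real.log (c / (1 - c)) ≤ x := by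
  have hc : 0 < 1 - c := sub_pos.2 hc1
  rw [Real.log_le_iff_le_exp (div_pos hc0 hc), le_div_iff₀ (by positivity), div_le_iff₀ hc]
  constructor <;> intro h <;> linarith

theorem exp_div_one_add_exp_le_iff {c x : ℝ} (hc0 : 0 < c) (hc1 : c < 1) :
    Real.exp x / (1 + Real.exp x) ≤ c ↔ x ≤ Real.log (c / (1 - c)) := by
  have hc : 0 < 1 - c := sub_pos.2 hc1
  rw [Real.le_log_iff_exp_le (div_pos hc0 hc), div_le_iff₀ (by positivity), le_div_iff₀ hc]
  constructor <;> intro h <;> linarith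

/-- Consequence of Lemma 1 of the paper for portfolio weights: with
`wₙ = Rₙ/(1+Rₙ)`, `Rₙ = exp(c₀ + ∑_{k=1}^n Δₖ)`, under the hypotheses of Lemma 1,
for every `ε ∈ (0,1/2)` one has `P(wₙ ≥ 1-ε) → p`, `P(wₙ ≤ ε) → 1-p`, and
`P(ε < wₙ < 1-ε) → 0`. -/
theorem stmt1 {Ω : Type*} [MeasureSpace Ω] [IsProbabilityMeasure (ℙ : Measure Ω)]
    (Δ : ℕ → Ω → ℝ) (hΔ : ∀ k, Measurable (Δ k))
    (a b : ℕ → ℝ) (ha_pos : ∀ n, 0 < a n)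
    (ha : Tendsto a atTop (nhds 0)) (hb : Tendsto b atTop (nhds 0))
    (Z : Ω → ℝ) (hZ : Measurable Z)
    (hconv : ∀ f : ℝ → ℝ, Continuous f → (∃ C, ∀ x, |f x| ≤ C) →
      Tendsto (fun n => ∫ ω, f (a n * (∑ k ∈ Finset.Icc 1 n, Δ k ω) + b n) ∂ℙ)
        atTop (nhds (∫ ω, f (Z ω) ∂ℙ)))
    (hcont : ContinuousAt (fun x => (ℙ {ω | Z ω ≤ x}).toReal) 0)
    (p : ℝ) (hp : p = (ℙ {ω | 0 < Z ω}).toReal)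
    (hp0 : 0 < p) (hp1 : p < 1) (c₀ : ℝ)
    (w : ℕ → Ω → ℝ)
    (hw : ∀ n ω, w n ω = Real.exp (c₀ + ∑ k ∈ Finset.Icc 1 n, Δ k ω) /
      (1 + Real.exp (c₀ + ∑ k ∈ Finset.Icc 1 n, Δ k ω)))
    (ε : ℝ) (hε0 : 0 < ε) (hε1 : ε < 1/2) :
    Tendsto (fun n => (ℙ {ω | 1 - ε ≤ w n ω}).toReal) atTop (nhds p) ∧
    Tendsto (fun n => (ℙ {ω | w n ω ≤ ε}).toReal) atTop (nhds (1 - p)) ∧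
    Tendsto (fun n => (ℙ {ω | ε < w n ω ∧ w n ω < 1 - ε}).toReal) atTop (nhds 0) := by
  have hS : ∀ n, Measurable fun ω => ∑ k ∈ Finset.Icc 1 n, Δ k ω :=
    fun n => Finset.measurable_fun_sum _ fun k _ => hΔ k
  have hX : ∀ n, Measurable fun ω => a n * (∑ k ∈ Finset.Icc 1 n, Δ k ω) + b n :=
    fun n => ((hS n).const_mul _).add_const _
  have hZ0 : ℙ {ω | Z ω = 0} = 0 := measure_setOf_eq_zero_of_continuousAt_cdf hZ hcont
  have hdist := tendstoInDistribution_of_forall_integral_tendsto hX hZ hconv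
  have hshift : ∀ L : ℝ, Tendsto (fun n => -(a n * L + b n)) atTop (nhds 0) := fun L => by
    simpa using ((ha.mul_const L).add hb).neg
  have hwm : ∀ n, Measurable (w n) := fun n => by
    rw [funext (hw n)]
    have := Real.measurable_exp.comp ((hS n).const_add c₀)
    exact this.div (this.const_add 1)
  have hnonneg : (ℙ {ω | Z ω ∈ Set.Ici 0}).toReal = p := by
    rw [hp]
    congr 1
    refine measure_congr ?_
    filter_upwards [measure_eq_zero_iff_ae_notMem.1 hZ0] with ω hω
    exact propext ⟨fun h => lt_of_le_of_ne h (Ne.symm hω), fun h => le_of_lt h⟩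
  have hnonpos : (ℙ {ω | Z ω ∈ Set.Iic 0}).toReal = 1 - p := by
    have hcompl := probReal_compl_eq_one_sub (μ := (ℙ : Measure Ω))
      (measurableSet_lt measurable_const hZ : MeasurableSet {ω | 0 < Z ω})
    rw [hp, ← Measure.real, ← Measure.real, ← hcompl]
    congr 1
    ext ω
    simp
  have hupper : Tendsto (fun n => (ℙ {ω | 1 - ε ≤ w n ω}).toReal) atTop (nhds p) := by
    have := hdist.tendsto_measure_add_const_mem hX hZ
      (hshift (Real.log ((1 - ε) / (1 - (1 - ε))) - c₀)) measurableSet_Ici (E := Set.Ici 0)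
      (by rw [frontier_Ici]; exact hZ0)
    rw [hnonneg] at this
    refine this.congr fun n => ?_
    congr 2
    ext ω
    rw [Set.mem_ofPred_eq, Set.mem_ofPred_eq, hw,
      le_exp_div_one_add_exp_iff (by linarith) (by linarith),
      ← mul_le_mul_iff_right₀ (ha_pos n), Set.mem_Ici]
    constructor <;> intro h <;> linarith
  have hlower : Tendsto (fun n => (ℙ {ω | w n ω ≤ ε}).toReal) atTop (nhds (1 - p)) := by
    have := hdist.tendsto_measure_add_const_mem hX hZ
      (hshift (Real.log (ε / (1 - ε)) - c₀)) measurableSet_Iic (E := Set.Iic 0)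
      (by rw [frontier_Iic]; exact hZ0)
    rw [hnonpos] at this
    refine this.congr fun n => ?_
    congr 2
    ext ω
    rw [Set.mem_ofPred_eq, Set.mem_ofPred_eq, hw,
      exp_div_one_add_exp_le_iff hε0 (by linarith),
      ← mul_le_mul_iff_right₀ (ha_pos n), Set.mem_Iic]
    constructor <;> intro h <;> linarith
  refine ⟨hupper, hlower, ?_⟩
  have hmiddle : Tendsto (fun n => 1 - ((ℙ {ω | 1 - ε ≤ w n ω}).toReal +
      (ℙ {ω | w n ω ≤ ε}).toReal)) atTop (nhds 0) := by
    simpa using (hupper.add hlower).const_sub 1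
  refine hmiddle.congr fun n => ?_
  have hmu : MeasurableSet {ω | 1 - ε ≤ w n ω} := measurableSet_le measurable_const (hwm n)
  have hml : MeasurableSet {ω | w n ω ≤ ε} := measurableSet_le (hwm n) measurable_const
  have hdisj : Disjoint {ω | 1 - ε ≤ w n ω} {ω | w n ω ≤ ε} :=
    Set.disjoint_left.2 fun ω (h : 1 - ε ≤ w n ω) (h' : w n ω ≤ ε) => by linarith
  simp only [← Measure.real_def]
  rw [← measureReal_union hdisj hml, ← probReal_compl_eq_one_sub (hmu.union hml)]
  congr 1
  ext ω
  simp only [Set.mem_compl_iff, Set.mem_union, Set.mem_ofPred_eq, not_or, not_le, and_comm]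
end

section
/- Consider the bivariate ARCH(1) model y_{1t} = σ_{1t} η_{1t}, y_{2t} = σ_{2t} η_{2t} with σ_{1t}² = ω₁ + α₁₁ y_{1,t−1}² + α₁₂ y_{2,t−1}² and σ_{2t}² = ω₂ + α₂₁ y_{1,t−1}², where ω₁, ω₂ > 0, α₁₁, α₁₂, α₂₁ ≥ 0, the vectors η_t = (η_{1t}, η_{2t})' are i.i.d. with zero mean and identity covariance matrix, η_{1t} and η_{2t} are independent of each other, and (y_{1t}, y_{2t})_{t∈ℤ} is a strictly stationary nonanticipative solution (i.e. (y_{1t}, y_{2t}) is measurable with respect to σ(η_s, s ≤ t)). Let F_{1,t} denote the σ-field generated by {y_{1u}, u ≤ t}, and set σ_t² := ω₁ + α₁₁ y_{1,t−1}² + α₁₂ σ_{2,t−1}². Then almost surely E(y_{1t} | F_{1,t−1}) = 0 and E(y_{1t}² | F_{1,t−1}) = σ_t²; consequently the process u_t := y_{1t}/σ_t satisfies E(u_t | F_{1,t−1}) = 0 and E(u_t² | F_{1,t−1}) = 1, i.e. (u_t, F_{1,t}) is a martingale difference with unit conditional variance. -/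
open MeasureTheory ProbabilityTheory Filter

/-- If `m₁` is independent of `m₂ ⊔ m₃` and `m₂` is independent of `m₃`, then `m₁ ⊔ m₂` is
independent of `m₃`. -/
theorem ProbabilityTheory.Indep.sup_left_of_sup_right {Ω : Type*} {m₁ m₂ m₃ m : MeasurableSpace Ω}
    {μ : Measure Ω} [IsProbabilityMeasure μ] (h₁ : m₁ ≤ m) (h₂ : m₂ ≤ m) (h₃ : m₃ ≤ m)
    (h : Indep m₁ (m₂ ⊔ m₃) μ) (h' : Indep m₂ m₃ μ) : Indep (m₁ ⊔ m₂) m₃ μ := by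
  refine IndepSets.indep (sup_le h₁ h₂) h₃
    (p1 := {s | ∃ a b, MeasurableSet[m₁] a ∧ MeasurableSet[m₂] b ∧ s = a ∩ b})
    (p2 := {s | MeasurableSet[m₃] s}) ?_ (@MeasurableSpace.isPiSystem_measurableSet _ m₃)
    (le_antisymm ?_ ?_) (@MeasurableSpace.generateFrom_measurableSet _ m₃).symm ?_
  · rintro _ ⟨a, b, ha, hb, rfl⟩ _ ⟨a', b', ha', hb', rfl⟩ -
    exact ⟨a ∩ a', b ∩ b', ha.inter ha', hb.inter hb', Set.inter_inter_inter_comm a b a' b'⟩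
  · refine sup_le (fun a ha => ?_) (fun b hb => ?_)
    · exact MeasurableSpace.measurableSet_generateFrom ⟨a, Set.univ, ha, .univ, by simp⟩
    · exact MeasurableSpace.measurableSet_generateFrom ⟨Set.univ, b, .univ, hb, by simp⟩
  · refine MeasurableSpace.generateFrom_le ?_
    rintro _ ⟨a, b, ha, hb, rfl⟩
    exact MeasurableSet.inter (le_sup_left (a := m₁) (b := m₂) _ ha)
      (le_sup_right (a := m₁) (b := m₂) _ hb)
  · rw [IndepSets_iff]
    rintro _ c ⟨a, b, ha, hb, rfl⟩ (hc : MeasurableSet[m₃] c)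
    rw [Indep_iff] at h h'
    have hb₂ : MeasurableSet[m₂ ⊔ m₃] b := le_sup_left (a := m₂) (b := m₃) _ hb
    have hc₂ : MeasurableSet[m₂ ⊔ m₃] c := le_sup_right (a := m₂) (b := m₃) _ hc
    rw [Set.inter_assoc, h a _ ha (hb₂.inter hc₂), h' b c hb hc, h a b ha hb₂, mul_assoc]

/-- Conditional expectation of a product of an `m`-measurable factor and a factor independent
of `m`. -/
theorem MeasureTheory.condExp_mul_of_indep {Ω : Type*} {m m₀ : MeasurableSpace Ω} {μ : Measure Ω}
    [IsProbabilityMeasure μ] (hm : m ≤ m₀) {f g : Ω → ℝ} (hf : Measurable[m] f)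
    (hg : Measurable g) (hgi : Integrable g μ) (hfg : Integrable (fun ω => f ω * g ω) μ)
    (hind : Indep (MeasurableSpace.comap g inferInstance) m μ) :
    μ[(fun ω => f ω * g ω) | m] =ᵐ[μ] fun ω => f ω * ∫ x, g x ∂μ := by
  have h₁ : μ[f * g | m] =ᵐ[μ] f * μ[g | m] :=
    condExp_mul_of_stronglyMeasurable_left hf.stronglyMeasurable hfg hgi
  have h₂ : μ[g | m] =ᵐ[μ] fun _ => μ[g] :=
    condExp_indep_eq hg.comap_le hm (comap_measurable g).stronglyMeasurable hind
  filter_upwards [h₁, h₂] with ω e₁ e₂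
  rw [← e₂]
  exact e₁

/-- Example 1 of the paper: in the bivariate ARCH(1) model, the first component satisfies,
relative to its own filtration `F_{1,t} = σ(y_{1u}, u ≤ t)`, the martingale-difference /
conditional-variance properties `E(y_{1t}|F_{1,t-1}) = 0`,
`E(y_{1t}²|F_{1,t-1}) = σ_t² := ω₁ + α₁₁ y_{1,t-1}² + α₁₂ σ_{2,t-1}²`, and hence
`u_t := y_{1t}/σ_t` satisfies `E(u_t|F_{1,t-1}) = 0` and `E(u_t²|F_{1,t-1}) = 1`. -/
theorem stmt2 {Ω : Type*} [m0 : MeasureSpace Ω] [IsProbabilityMeasure (ℙ : Measure Ω)]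
    (η₁ η₂ y₁ y₂ σ₁ σ₂ : ℤ → Ω → ℝ)
    (hη₁ : ∀ t, Measurable (η₁ t)) (hη₂ : ∀ t, Measurable (η₂ t))
    (hy₁m : ∀ t, Measurable (y₁ t)) (hy₂m : ∀ t, Measurable (y₂ t))
    (ω₁ ω₂ α₁₁ α₁₂ α₂₁ : ℝ) (hω₁ : 0 < ω₁) (hω₂ : 0 < ω₂)
    (hα₁₁ : 0 ≤ α₁₁) (hα₁₂ : 0 ≤ α₁₂) (hα₂₁ : 0 ≤ α₂₁)
    -- (η_{1t}, η_{2t})' is iid with zero mean and identity covariance,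
    -- with independent components:
    (hid : ∀ t : ℤ, IdentDistrib (fun ω => (η₁ t ω, η₂ t ω)) (fun ω => (η₁ 0 ω, η₂ 0 ω)) ℙ ℙ)
    (hindep_past : ∀ t : ℤ, Indep
      (MeasurableSpace.comap (fun ω => (η₁ t ω, η₂ t ω)) inferInstance)
      (⨆ (s : ℤ) (_ : s < t),
        MeasurableSpace.comap (fun ω => (η₁ s ω, η₂ s ω)) inferInstance) ℙ)
    (hindep_comp : ∀ t : ℤ, IndepFun (η₁ t) (η₂ t) ℙ)
    (hmean₁ : ∀ t, ∫ ω, η₁ t ω ∂ℙ = 0) (hmean₂ : ∀ t, ∫ ω, η₂ t ω ∂ℙ = 0)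
    (hvar₁ : ∀ t, ∫ ω, (η₁ t ω) ^ 2 ∂ℙ = 1) (hvar₂ : ∀ t, ∫ ω, (η₂ t ω) ^ 2 ∂ℙ = 1)
    -- volatilities:
    (hσ₁ : ∀ t ω, σ₁ t ω = Real.sqrt (ω₁ + α₁₁ * (y₁ (t-1) ω) ^ 2 + α₁₂ * (y₂ (t-1) ω) ^ 2))
    (hσ₂ : ∀ t ω, σ₂ t ω = Real.sqrt (ω₂ + α₂₁ * (y₁ (t-1) ω) ^ 2))
    -- the ARCH equations:
    (hy₁ : ∀ t, y₁ t =ᵐ[ℙ] fun ω => σ₁ t ω * η₁ t ω)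
    (hy₂ : ∀ t, y₂ t =ᵐ[ℙ] fun ω => σ₂ t ω * η₂ t ω)
    -- nonanticipative solution: (y₁ t, y₂ t) is measurable w.r.t. σ(η_s, s ≤ t):
    (hnonant : ∀ t : ℤ, Measurable[⨆ (s : ℤ) (_ : s ≤ t),
        MeasurableSpace.comap (fun ω => (η₁ s ω, η₂ s ω)) inferInstance]
        (fun ω => (y₁ t ω, y₂ t ω)))
    -- strict stationarity of the solution:
    (hstat : ∀ (n : ℕ) (t : ℤ), IdentDistrib
        (fun ω => fun i : Fin n => (y₁ (t + i) ω, y₂ (t + i) ω))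
        (fun ω => fun i : Fin n => (y₁ (i : ℤ) ω, y₂ (i : ℤ) ω)) ℙ ℙ)
    -- square integrability of the solution:
    (hL2 : ∀ t, Integrable (fun ω => (y₁ t ω) ^ 2) ℙ ∧ Integrable (fun ω => (y₂ t ω) ^ 2) ℙ)
    (t : ℤ) :
    (ℙ[y₁ t | ⨆ (v : ℤ) (_ : v ≤ t - 1), MeasurableSpace.comap (y₁ v) inferInstance]
        =ᵐ[ℙ] 0) ∧
    (ℙ[(fun ω => (y₁ t ω) ^ 2) |
        ⨆ (v : ℤ) (_ : v ≤ t - 1), MeasurableSpace.comap (y₁ v) inferInstance]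
        =ᵐ[ℙ] fun ω => ω₁ + α₁₁ * (y₁ (t-1) ω) ^ 2 + α₁₂ * (σ₂ (t-1) ω) ^ 2) ∧
    (ℙ[(fun ω => y₁ t ω /
          Real.sqrt (ω₁ + α₁₁ * (y₁ (t-1) ω) ^ 2 + α₁₂ * (σ₂ (t-1) ω) ^ 2)) |
        ⨆ (v : ℤ) (_ : v ≤ t - 1), MeasurableSpace.comap (y₁ v) inferInstance]
        =ᵐ[ℙ] 0) ∧
    (ℙ[(fun ω => (y₁ t ω /
          Real.sqrt (ω₁ + α₁₁ * (y₁ (t-1) ω) ^ 2 + α₁₂ * (σ₂ (t-1) ω) ^ 2)) ^ 2) |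
        ⨆ (v : ℤ) (_ : v ≤ t - 1), MeasurableSpace.comap (y₁ v) inferInstance]
        =ᵐ[ℙ] 1) := by
  let F : ℤ → MeasurableSpace Ω := fun t => ⨆ (v : ℤ) (_ : v ≤ t),
    MeasurableSpace.comap (y₁ v) inferInstance
  let P : ℤ → MeasurableSpace Ω := fun t => ⨆ (s : ℤ) (_ : s < t),
    MeasurableSpace.comap (fun ω => (η₁ s ω, η₂ s ω)) inferInstance
  have hηm : ∀ s, Measurable (fun ω => (η₁ s ω, η₂ s ω)) := fun s => (hη₁ s).prodMk (hη₂ s)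
  have hP : ∀ t, P t ≤ m0.toMeasurableSpace := fun t => iSup₂_le fun s _ => (hηm s).comap_le
  have hF0 : F (t - 1) ≤ m0.toMeasurableSpace := iSup₂_le fun v _ => (hy₁m v).comap_le
  have hy_past : ∀ s t, s < t → Measurable[P t] (fun ω => (y₁ s ω, y₂ s ω)) := by
    intro s t hst
    exact (hnonant s).mono
      (iSup₂_le fun r hr => le_iSup₂_of_le r (lt_of_le_of_lt hr hst) le_rfl) le_rfl
  have hy₁_past : ∀ s t, s < t → Measurable[P t] (y₁ s) := fun s t h =>
    measurable_fst.comp (hy_past s t h)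
  have hy₂_past : ∀ s t, s < t → Measurable[P t] (y₂ s) := fun s t h =>
    measurable_snd.comp (hy_past s t h)
  have hFP : F (t - 1) ≤ P t := iSup₂_le fun v hv => (hy₁_past v t (by omega)).comap_le
  have hy₁F : ∀ v, v ≤ t - 1 → Measurable[F (t - 1)] (y₁ v) := fun v hv =>
    Measurable.of_comap_le (le_iSup₂_of_le (f := fun (v : ℤ) (_ : v ≤ t - 1) =>
      MeasurableSpace.comap (y₁ v) inferInstance) v hv le_rfl)
  have hσ₁_past : ∀ t, Measurable[P t] (σ₁ t) := by
    intro t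
    have h₁ := hy₁_past (t - 1) t (by omega)
    have h₂ := hy₂_past (t - 1) t (by omega)
    rw [show σ₁ t = _ from funext (hσ₁ t)]
    exact ((((h₁.pow_const 2).const_mul α₁₁).const_add ω₁).add
      ((h₂.pow_const 2).const_mul α₁₂)).sqrt
  have hσ₂F : Measurable[F (t - 1)] (σ₂ (t - 1)) := by
    rw [show σ₂ (t - 1) = _ from funext (hσ₂ (t - 1))]
    exact ((((hy₁F (t - 1 - 1) (by omega)).pow_const 2).const_mul α₂₁).const_add ω₂).sqrt
  have hηi_sq : ∀ {g : Ω → ℝ}, ∫ ω, g ω ^ 2 = 1 → Integrable (fun ω => g ω ^ 2) := fun h =>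
    Integrable.of_integral_ne_zero (by rw [h]; exact one_ne_zero)
  have hηi : Integrable (η₁ t) :=
    ((memLp_two_iff_integrable_sq (hη₁ t).aestronglyMeasurable).2
      (hηi_sq (hvar₁ t))).integrable one_le_two
  have hyi : ∀ t, Integrable (y₁ t) := fun t =>
    ((memLp_two_iff_integrable_sq (hy₁m t).aestronglyMeasurable).2
      (hL2 t).1).integrable one_le_two
  have hpair₁ : ∀ s, MeasurableSpace.comap (η₁ s) inferInstance ≤
      MeasurableSpace.comap (fun ω => (η₁ s ω, η₂ s ω)) inferInstance := fun s =>
    (measurable_fst.comp (comap_measurable (fun ω => (η₁ s ω, η₂ s ω)))).comap_le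
  have hpair₂ : ∀ s, MeasurableSpace.comap (η₂ s) inferInstance ≤
      MeasurableSpace.comap (fun ω => (η₁ s ω, η₂ s ω)) inferInstance := fun s =>
    (measurable_snd.comp (comap_measurable (fun ω => (η₁ s ω, η₂ s ω)))).comap_le
  have hsq_comap : ∀ g : Ω → ℝ, MeasurableSpace.comap (fun ω => g ω ^ 2) inferInstance ≤
      MeasurableSpace.comap g inferInstance := fun g =>
    ((comap_measurable g).pow_const 2).comap_le
  have hind₁ : Indep (MeasurableSpace.comap (η₁ t) inferInstance) (P t) ℙ :=
    indep_of_indep_of_le_left (hindep_past t) (hpair₁ t)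
  have hind₂ : Indep (MeasurableSpace.comap (η₂ (t - 1)) inferInstance) (F (t - 1)) ℙ := by
    have hG : Indep (P (t - 1) ⊔ MeasurableSpace.comap (η₁ (t - 1)) inferInstance)
        (MeasurableSpace.comap (η₂ (t - 1)) inferInstance) ℙ :=
      Indep.sup_left_of_sup_right (hP _) (hη₁ _).comap_le (hη₂ _).comap_le
        (indep_of_indep_of_le_right (hindep_past (t - 1)).symm (sup_le (hpair₁ _) (hpair₂ _)))
        (hindep_comp (t - 1))
    -- The path of `y₁` up to time `t - 1`, with its last coordinate replaced by `σ₁ * η₁`.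
    let Y' : Ω → Set.Iic (t - 1) → ℝ := fun ω v =>
      if (v : ℤ) = t - 1 then σ₁ (t - 1) ω * η₁ (t - 1) ω else y₁ v ω
    have hY' : Measurable[P (t - 1) ⊔ MeasurableSpace.comap (η₁ (t - 1)) inferInstance] Y' := by
      refine (@measurable_pi_iff _ _ _ (_) _ _).2 fun v => ?_
      by_cases hv : (v : ℤ) = t - 1
      · simp only [Y', hv, if_true]
        exact ((hσ₁_past (t - 1)).mono le_sup_left le_rfl).mul
          ((comap_measurable (η₁ (t - 1))).mono le_sup_right le_rfl)
      · simp only [Y', hv, if_false]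
        exact (hy₁_past v (t - 1) (lt_of_le_of_ne v.2 hv)).mono le_sup_left le_rfl
    have hYY' : Y' =ᵐ[ℙ] fun ω (v : Set.Iic (t - 1)) => y₁ v ω := by
      filter_upwards [hy₁ (t - 1)] with ω h
      funext v
      by_cases hv : (v : ℤ) = t - 1
      · simp only [Y', hv, if_true, h]
      · simp only [Y', hv, if_false]
    have hind : IndepFun Y' (η₂ (t - 1)) ℙ := indep_of_indep_of_le_left hG hY'.comap_le
    refine indep_of_indep_of_le_right (hind.congr hYY' (ae_eq_refl _)).symm ?_
    refine iSup₂_le fun v hv => Measurable.comap_le ?_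
    exact (measurable_pi_apply (⟨v, hv⟩ : Set.Iic (t - 1))).comp
      (comap_measurable (fun ω (v : Set.Iic (t - 1)) => y₁ v ω))
  have hmain₁ : ℙ[y₁ t | F (t - 1)] =ᵐ[ℙ] 0 := by
    have h₁ : ℙ[y₁ t | P t] =ᵐ[ℙ] 0 := by
      refine (condExp_congr_ae (hy₁ t)).trans ((condExp_mul_of_indep (hP t) (hσ₁_past t) (hη₁ t)
        hηi ((hyi t).congr (hy₁ t)) hind₁).trans ?_)
      exact ae_of_all _ fun ω => by simp [hmean₁ t]
    refine (condExp_condExp_of_le hFP (hP t)).symm.trans ((condExp_congr_ae h₁).trans ?_)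
    rw [condExp_zero]
  have hy₂sq : ℙ[(fun ω => y₂ (t - 1) ω ^ 2) | F (t - 1)] =ᵐ[ℙ] fun ω => σ₂ (t - 1) ω ^ 2 := by
    have e : (fun ω => y₂ (t - 1) ω ^ 2) =ᵐ[ℙ]
        fun ω => σ₂ (t - 1) ω ^ 2 * η₂ (t - 1) ω ^ 2 := by
      filter_upwards [hy₂ (t - 1)] with ω h
      rw [h, mul_pow]
    refine (condExp_congr_ae e).trans ((condExp_mul_of_indep hF0 (hσ₂F.pow_const 2)
      ((hη₂ _).pow_const 2) (hηi_sq (hvar₂ _)) ((hL2 _).2.congr e)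
      (indep_of_indep_of_le_left hind₂ (hsq_comap _))).trans ?_)
    exact ae_of_all _ fun ω => by simp [hvar₂ (t - 1)]
  have hmain₂ : ℙ[(fun ω => y₁ t ω ^ 2) | F (t - 1)] =ᵐ[ℙ]
      fun ω => ω₁ + α₁₁ * y₁ (t - 1) ω ^ 2 + α₁₂ * σ₂ (t - 1) ω ^ 2 := by
    have e : (fun ω => y₁ t ω ^ 2) =ᵐ[ℙ] fun ω => σ₁ t ω ^ 2 * η₁ t ω ^ 2 := by
      filter_upwards [hy₁ t] with ω h
      rw [h, mul_pow]
    have h₁ : ℙ[(fun ω => y₁ t ω ^ 2) | P t] =ᵐ[ℙ]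
        (fun ω => ω₁ + α₁₁ * y₁ (t - 1) ω ^ 2) + α₁₂ • (fun ω => y₂ (t - 1) ω ^ 2) := by
      refine (condExp_congr_ae e).trans ((condExp_mul_of_indep (hP t) ((hσ₁_past t).pow_const 2)
        ((hη₁ t).pow_const 2) (hηi_sq (hvar₁ t)) ((hL2 t).1.congr e)
        (indep_of_indep_of_le_left hind₁ (hsq_comap _))).trans ?_)
      refine ae_of_all _ fun ω => ?_
      simp only [hvar₁ t, mul_one, hσ₁ t, Pi.add_apply, Pi.smul_apply, smul_eq_mul]
      exact Real.sq_sqrt (by positivity)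
    have hi : Integrable (fun ω => ω₁ + α₁₁ * y₁ (t - 1) ω ^ 2) :=
      (integrable_const ω₁).add ((hL2 (t - 1)).1.const_mul α₁₁)
    have hmeas : Measurable[F (t - 1)] (fun ω => ω₁ + α₁₁ * y₁ (t - 1) ω ^ 2) :=
      (((hy₁F (t - 1) le_rfl).pow_const 2).const_mul α₁₁).const_add ω₁
    refine (condExp_condExp_of_le hFP (hP t)).symm.trans ((condExp_congr_ae h₁).trans
      ((condExp_add hi ((hL2 (t - 1)).2.smul α₁₂) (F (t - 1))).trans ?_))
    rw [condExp_of_stronglyMeasurable hF0 hmeas.stronglyMeasurable hi]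
    filter_upwards [condExp_smul (μ := ℙ) α₁₂ (fun ω => y₂ (t - 1) ω ^ 2) (F (t - 1)), hy₂sq] with ω e₁ e₂
    rw [Pi.add_apply, e₁, Pi.smul_apply, e₂, smul_eq_mul]
  set V : Ω → ℝ := fun ω => ω₁ + α₁₁ * y₁ (t - 1) ω ^ 2 + α₁₂ * σ₂ (t - 1) ω ^ 2 with hV
  have hVF : Measurable[F (t - 1)] V :=
    ((((hy₁F (t - 1) le_rfl).pow_const 2).const_mul α₁₁).const_add ω₁).add
      ((hσ₂F.pow_const 2).const_mul α₁₂)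
  have hVge : ∀ ω, ω₁ ≤ V ω := fun ω => by
    have h₁ : 0 ≤ α₁₁ * y₁ (t - 1) ω ^ 2 := by positivity
    have h₂ : 0 ≤ α₁₂ * σ₂ (t - 1) ω ^ 2 := by positivity
    simp only [hV]
    linarith
  have hVpos : ∀ ω, 0 < V ω := fun ω => hω₁.trans_le (hVge ω)
  refine ⟨hmain₁, hmain₂, ?_, ?_⟩
  · have hmul : ℙ[(fun ω => (√(V ω))⁻¹) * y₁ t | F (t - 1)] =ᵐ[ℙ]
        (fun ω => (√(V ω))⁻¹) * ℙ[y₁ t | F (t - 1)] := by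
      refine condExp_stronglyMeasurable_mul_of_bound hF0 hVF.sqrt.inv.stronglyMeasurable
        (hyi t) (√ω₁)⁻¹ (ae_of_all _ fun ω => ?_)
      rw [Real.norm_of_nonneg (by positivity)]
      exact inv_anti₀ (Real.sqrt_pos.2 hω₁) (Real.sqrt_le_sqrt (hVge ω))
    have e : (fun ω => y₁ t ω / √(V ω)) = (fun ω => (√(V ω))⁻¹) * y₁ t :=
      funext fun ω => div_eq_inv_mul _ _
    change ℙ[fun ω => y₁ t ω / √(V ω) | F (t - 1)] =ᵐ[ℙ] 0
    rw [e]
    filter_upwards [hmul, hmain₁] with ω h₁ h₂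
    rw [h₁, Pi.mul_apply, h₂, Pi.zero_apply, mul_zero]
  · have hmul : ℙ[(fun ω => (V ω)⁻¹) * (fun ω => y₁ t ω ^ 2) | F (t - 1)] =ᵐ[ℙ]
        (fun ω => (V ω)⁻¹) * ℙ[(fun ω => y₁ t ω ^ 2) | F (t - 1)] := by
      refine condExp_stronglyMeasurable_mul_of_bound hF0 hVF.inv.stronglyMeasurable
        (hL2 t).1 ω₁⁻¹ (ae_of_all _ fun ω => ?_)
      rw [Real.norm_of_nonneg (inv_nonneg.2 (hVpos ω).le)]
      exact inv_anti₀ hω₁ (hVge ω)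
    have e : (fun ω => (y₁ t ω / √(V ω)) ^ 2) = (fun ω => (V ω)⁻¹) * (fun ω => y₁ t ω ^ 2) := by
      funext ω
      rw [div_pow, Real.sq_sqrt (hVpos ω).le, div_eq_inv_mul, Pi.mul_apply]
    change ℙ[fun ω => (y₁ t ω / √(V ω)) ^ 2 | F (t - 1)] =ᵐ[ℙ] 1
    rw [e]
    filter_upwards [hmul, hmain₂] with ω h₁ h₂
    rw [h₁, Pi.mul_apply, h₂, Pi.one_apply]
    exact inv_mul_cancel₀ (hVpos ω).ne'
end

section
/- Let (u_t)_{t∈ℤ} be a strictly stationary and ergodic sequence of real random variables, and let ω₀ > 0, α₀ > 0, β₀ > 0 satisfy E[log(α₀ u₀² + β₀)] < 0 (with the expectation well defined, possibly equal to −∞). Then for every t ∈ ℤ the series h_t := ω₀ · {1 + Σ_{k=1}^∞ ∏_{i=1}^k (α₀ u_{t−i}² + β₀)} converges almost surely to a finite limit; the process ε_t := √h_t · u_t is strictly stationary and ergodic; and setting σ_t² := h_t, the GARCH(1,1) equations ε_t = σ_t u_t and σ_t² = ω₀ + α₀ ε_{t−1}² + β₀ σ_{t−1}² hold almost surely for all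 t. -/
open MeasureTheory ProbabilityTheory Filter

/-- The running maximum `max_{0 ≤ k ≤ n} ∑_{i=1}^k Y_{t-i}` of the backward partial sums,
defined through the Lindley recursion. -/
def lindley {Ω : Type*} (Y : ℤ → Ω → ℝ) : ℕ → ℤ → Ω → ℝ
  | 0, _, _ => 0
  | n + 1, t, ω => max 0 (Y (t - 1) ω + lindley Y n (t - 1) ω)

section Lindley

variable {Ω : Type*} {Y : ℤ → Ω → ℝ}

theorem lindley_succ (n : ℕ) (t : ℤ) (ω : Ω) :
    lindley Y (n + 1) (t + 1) ω = max 0 (Y t ω + lindley Y n t ω) := by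
  simp [lindley]

theorem lindley_nonneg (n : ℕ) (t : ℤ) (ω : Ω) : 0 ≤ lindley Y n t ω := by
  cases n <;> simp [lindley]

theorem lindley_le_succ (n : ℕ) (t : ℤ) (ω : Ω) : lindley Y n t ω ≤ lindley Y (n + 1) t ω := by
  induction n generalizing t with
  | zero => exact lindley_nonneg _ _ _
  | succ n ih =>
    change max 0 (_ + _) ≤ max 0 (_ + _)
    gcongr
    exact ih _

theorem lindley_monotone (t : ℤ) (ω : Ω) : Monotone fun n => lindley Y n t ω :=
  monotone_nat_of_le_succ fun n => lindley_le_succ n t ω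

theorem sum_le_lindley (n : ℕ) (t : ℤ) (ω : Ω) :
    ∑ i ∈ Finset.range n, Y (t - (i + 1 : ℕ)) ω ≤ lindley Y n t ω := by
  induction n generalizing t with
  | zero => simp [lindley]
  | succ n ih =>
    rw [Finset.sum_range_succ']
    refine le_trans ?_ (le_max_right _ _)
    have h := ih (t - 1)
    have e : ∀ i : ℕ, t - 1 - ((i + 1 : ℕ) : ℤ) = t - ((i + 1 + 1 : ℕ) : ℤ) := by
      intro i; push_cast; ring
    simp only [e] at h
    simp only [zero_add, Nat.cast_one]
    linarith

theorem bddAbove_lindley_add_one_iff (t : ℤ) (ω : Ω) :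
    BddAbove (Set.range fun n => lindley Y n (t + 1) ω) ↔
      BddAbove (Set.range fun n => lindley Y n t ω) := by
  constructor
  · rintro ⟨C, hC⟩
    refine ⟨C - Y t ω, ?_⟩
    rintro _ ⟨n, rfl⟩
    have h := hC ⟨n + 1, rfl⟩
    simp only [lindley_succ] at h
    have := (le_max_right _ _).trans h
    simp only
    linarith
  · rintro ⟨C, hC⟩
    refine ⟨max 0 (Y t ω + C), ?_⟩
    rintro _ ⟨n, rfl⟩
    refine (lindley_le_succ n (t + 1) ω).trans ?_
    rw [lindley_succ]
    gcongr
    exact hC ⟨n, rfl⟩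

theorem lindley_comp {T : Ω → Ω} (hY : ∀ t ω, Y (t + 1) ω = Y t (T ω)) (n : ℕ) (t : ℤ) (ω : Ω) :
    lindley Y n (t + 1) ω = lindley Y n t (T ω) := by
  induction n generalizing t with
  | zero => rfl
  | succ n ih =>
    have h1 := hY (t - 1) ω
    have h2 := ih (t - 1)
    rw [sub_add_cancel] at h1 h2
    rw [lindley_succ, h1, h2]
    rfl

variable [MeasurableSpace Ω] {μ : Measure Ω}

theorem measurable_lindley (hm : ∀ t, Measurable (Y t)) (n : ℕ) (t : ℤ) :
    Measurable (lindley Y n t) := by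
  induction n generalizing t with
  | zero => exact measurable_const
  | succ n ih => exact measurable_const.max ((hm _).add (ih _))

theorem integrable_lindley [IsFiniteMeasure μ] (hint : ∀ t, Integrable (Y t) μ) (n : ℕ) (t : ℤ) :
    Integrable (lindley Y n t) μ := by
  induction n generalizing t with
  | zero => exact integrable_zero _ _ _
  | succ n ih => exact (integrable_const (0 : ℝ)).sup ((hint _).add (ih _))

/-- Shift-covariant processes are integrable at all times as soon as they are at time `0`. -/
theorem MeasureTheory.MeasurePreserving.integrable_of_shift {T : Ω → Ω}
    (hT : MeasurePreserving T μ μ) (hm : ∀ t, Measurable (Y t))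
    (hY : ∀ t ω, Y (t + 1) ω = Y t (T ω)) (h0 : Integrable (Y 0) μ) (t : ℤ) :
    Integrable (Y t) μ := by
  have step : ∀ t, Integrable (Y (t + 1)) μ ↔ Integrable (Y t) μ := fun t => by
    rw [show Y (t + 1) = Y t ∘ T from funext (hY t)]
    exact hT.integrable_comp (hm t).aestronglyMeasurable
  induction t using Int.induction_on with
  | zero => exact h0
  | succ i ih => exact (step _).2 ih
  | pred i ih => exact (step _).1 (by rwa [sub_add_cancel])

theorem MeasureTheory.MeasurePreserving.integral_add_one_of_shift {T : Ω → Ω}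
    (hT : MeasurePreserving T μ μ) (hm : ∀ t, Measurable (Y t))
    (hY : ∀ t ω, Y (t + 1) ω = Y t (T ω)) (t : ℤ) :
    ∫ ω, Y (t + 1) ω ∂μ = ∫ ω, Y t ω ∂μ := by
  simp only [hY]
  nth_rewrite 2 [← hT.map_eq]
  exact (integral_map hT.aemeasurable (hm t).aestronglyMeasurable).symm

/-- If the running maxima at time `0` diverge almost surely, then the mean is nonnegative. -/
theorem integral_nonneg_of_ae_not_bddAbove_lindley [IsFiniteMeasure μ] {T : Ω → Ω}
    (hT : MeasurePreserving T μ μ) (hm : ∀ t, Measurable (Y t))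
    (hY : ∀ t ω, Y (t + 1) ω = Y t (T ω)) (h0 : Integrable (Y 0) μ)
    (hdiv : ∀ᵐ ω ∂μ, ¬ BddAbove (Set.range fun n => lindley Y n 0 ω)) :
    0 ≤ ∫ ω, Y 0 ω ∂μ := by
  have hint := integrable_lindley (hT.integrable_of_shift hm hY h0)
  have key : ∀ n, 0 ≤ ∫ ω, max (-lindley Y n 0 ω) (Y 0 ω) ∂μ := by
    intro n
    have e : ∀ ω, max (-lindley Y n 0 ω) (Y 0 ω)
        = lindley Y (n + 1) (0 + 1) ω - lindley Y n 0 ω := by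
      intro ω
      rw [lindley_succ, ← max_sub_sub_right]
      simp
    simp only [e]
    rw [integral_sub (hint _ _) (hint _ _),
      hT.integral_add_one_of_shift (Y := lindley Y (n + 1)) (measurable_lindley hm _)
        (lindley_comp hY _), sub_nonneg]
    exact integral_mono (hint _ _) (hint _ _) fun ω => lindley_le_succ n 0 ω
  refine ge_of_tendsto' (tendsto_integral_of_dominated_convergence (fun ω => |Y 0 ω|)
    (fun n => ((measurable_lindley hm n 0).neg.max (hm 0)).aestronglyMeasurable)
    h0.abs (fun n => ae_of_all _ fun ω => ?_) ?_) key
  · have := lindley_nonneg (Y := Y) n 0 ω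
    rw [Real.norm_eq_abs, abs_le]
    exact ⟨(neg_abs_le _).trans (le_max_right _ _),
      max_le ((neg_nonpos.2 this).trans (abs_nonneg _)) (le_abs_self _)⟩
  · filter_upwards [hdiv] with ω hω
    refine tendsto_const_nhds.congr' ?_
    have ht := tendsto_atTop_atTop_of_monotone' (lindley_monotone 0 ω) hω
    filter_upwards [ht.eventually_ge_atTop (-Y 0 ω)] with n hn
    exact (max_eq_right (neg_le.1 hn)).symm

/-- For an ergodic shift-covariant process with negative mean, the backward partial sums are
almost surely bounded above. -/
theorem ae_bddAbove_lindley [IsFiniteMeasure μ] {T : Ω → Ω}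
    (hT : Ergodic T μ) (hm : ∀ t, Measurable (Y t))
    (hY : ∀ t ω, Y (t + 1) ω = Y t (T ω)) (h0 : Integrable (Y 0) μ)
    (hneg : ∫ ω, Y 0 ω ∂μ < 0) (t : ℤ) :
    ∀ᵐ ω ∂μ, BddAbove (Set.range fun n => lindley Y n t ω) := by
  have hzero : ∀ ω, BddAbove (Set.range fun n => lindley Y n t ω) ↔
      BddAbove (Set.range fun n => lindley Y n 0 ω) := by
    intro ω
    induction t using Int.induction_on with
    | zero => rfl
    | succ i ih => rw [bddAbove_lindley_add_one_iff, ih]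
    | pred i ih => rw [← bddAbove_lindley_add_one_iff, sub_add_cancel, ih]
  simp only [hzero]
  have hA : MeasurableSet {ω | BddAbove (Set.range fun n => lindley Y n 0 ω)} :=
    measurableSet_bddAbove_range fun n => measurable_lindley hm n 0
  have hinv : T ⁻¹' {ω | BddAbove (Set.range fun n => lindley Y n 0 ω)} =
      {ω | BddAbove (Set.range fun n => lindley Y n 0 ω)} := by
    ext ω
    simp only [Set.mem_preimage, Set.mem_ofPred_eq, ← lindley_comp hY,
      bddAbove_lindley_add_one_iff]
  rcases hT.toPreErgodic.ae_mem_or_ae_notMem hA hinv with h | h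
  · exact h
  · exact absurd hneg (not_lt.2
      (integral_nonneg_of_ae_not_bddAbove_lindley hT.toMeasurePreserving hm hY h0 h))

end Lindley

theorem prod_Icc_one_eq_prod_range {M : Type*} [CommMonoid M] (f : ℕ → M) (n : ℕ) :
    ∏ i ∈ Finset.Icc 1 n, f i = ∏ i ∈ Finset.range n, f (i + 1) := by
  induction n with
  | zero => simp
  | succ n ih => rw [Finset.prod_Icc_succ_top (by omega), Finset.prod_range_succ, ih]

/-- Backward products of a positive ergodic process with negative mean logarithm are almost
surely summable. -/
theorem ae_summable_prod_of_integral_log_neg {Ω : Type*} [MeasurableSpace Ω] {μ : Measure Ω}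
    [IsProbabilityMeasure μ] {T : Ω → Ω} (hT : Ergodic T μ) {a : ℤ → Ω → ℝ}
    (hm : ∀ t, Measurable (a t)) (ha : ∀ t ω, a (t + 1) ω = a t (T ω)) (hpos : ∀ t ω, 0 < a t ω)
    (hint : Integrable (fun ω => Real.log (a 0 ω)) μ) (hneg : ∫ ω, Real.log (a 0 ω) ∂μ < 0)
    (t : ℤ) :
    ∀ᵐ ω ∂μ, Summable fun k : ℕ => ∏ i ∈ Finset.Icc 1 (k + 1), a (t - (i : ℤ)) ω := by
  obtain ⟨δ, hδ, hδ'⟩ : ∃ δ > 0, ∫ ω, Real.log (a 0 ω) ∂μ + δ < 0 :=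
    ⟨-(∫ ω, Real.log (a 0 ω) ∂μ) / 2, by linarith, by linarith⟩
  have hbdd := ae_bddAbove_lindley (Y := fun t ω => Real.log (a t ω) + δ) hT
    (fun t => (hm t).log.add_const δ) (fun t ω => by simp only [ha])
    (hint.add (integrable_const δ))
    (by rw [integral_add hint (integrable_const δ)]; simpa using hδ') t
  filter_upwards [hbdd] with ω ⟨C, hC⟩
  have hgeom : Summable fun k : ℕ => Real.exp C * Real.exp (-δ) ^ (k + 1) :=
    ((summable_nat_add_iff 1).2 (summable_geometric_of_lt_one (Real.exp_nonneg _)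
      (Real.exp_lt_one_iff.2 (by linarith)))).mul_left _
  refine hgeom.of_nonneg_of_le (fun k => Finset.prod_nonneg fun i _ => (hpos _ _).le) fun k => ?_
  have h := (sum_le_lindley (k + 1) t ω).trans (hC ⟨k + 1, rfl⟩)
  rw [Finset.sum_add_distrib, Finset.sum_const, Finset.card_range, nsmul_eq_mul] at h
  rw [prod_Icc_one_eq_prod_range, ← Real.exp_nat_mul, ← Real.exp_add]
  calc ∏ i ∈ Finset.range (k + 1), a (t - ((i + 1 : ℕ) : ℤ)) ω
      = Real.exp (∑ i ∈ Finset.range (k + 1), Real.log (a (t - ((i + 1 : ℕ) : ℤ)) ω)) := by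
        rw [Real.exp_sum]
        exact Finset.prod_congr rfl fun i _ => (Real.exp_log (hpos _ _)).symm
    _ ≤ _ := Real.exp_le_exp.2 (by linarith)

/-- A measurable function bounded below whose positive part has finite integral is integrable. -/
theorem integrable_of_lintegral_ofReal_lt_top_of_le {Ω : Type*} [MeasurableSpace Ω] {μ : Measure Ω}
    [IsFiniteMeasure μ] {f : Ω → ℝ} (hf : Measurable f)
    (hpos : ∫⁻ ω, ENNReal.ofReal (f ω) ∂μ < ⊤) {c : ℝ} (hc : ∀ ω, c ≤ f ω) :
    Integrable f μ := by
  have hmax : Integrable (fun ω => max (f ω) 0) μ := by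
    refine ⟨(hf.max measurable_const).aestronglyMeasurable, ?_⟩
    have h0 : 0 ≤ᵐ[μ] fun ω => max (f ω) 0 := ae_of_all _ fun ω => le_max_right _ _
    rw [hasFiniteIntegral_iff_ofReal h0]
    simpa using hpos
  refine (hmax.add (integrable_const |c|)).mono' hf.aestronglyMeasurable (ae_of_all _ fun ω => ?_)
  simp only [Pi.add_apply]
  rw [Real.norm_eq_abs, abs_le]
  have h1 := le_max_left (f ω) 0
  have h2 := le_max_right (f ω) 0
  have h3 := neg_abs_le c
  have h4 := abs_nonneg c
  exact ⟨by linarith [hc ω], by linarith⟩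

theorem one_add_tsum_prod_Icc {b : ℤ → ℝ} {t : ℤ}
    (hs : Summable fun k : ℕ => ∏ i ∈ Finset.Icc 1 (k + 1), b (t - (i : ℤ))) :
    1 + ∑' k : ℕ, ∏ i ∈ Finset.Icc 1 (k + 1), b (t - (i : ℤ)) =
      1 + b (t - 1) * (1 + ∑' k : ℕ, ∏ i ∈ Finset.Icc 1 (k + 1), b (t - 1 - (i : ℤ))) := by
  have e : ∀ k : ℕ, ∏ i ∈ Finset.Icc 1 (k + 1 + 1), b (t - (i : ℤ)) =
      b (t - 1) * ∏ i ∈ Finset.Icc 1 (k + 1), b (t - 1 - (i : ℤ)) := by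
    intro k
    rw [prod_Icc_one_eq_prod_range, prod_Icc_one_eq_prod_range, Finset.prod_range_succ', mul_comm]
    congr 1
    refine Finset.prod_congr rfl fun i _ => ?_
    congr 1
    push_cast
    ring
  rw [hs.tsum_eq_zero_add]
  simp only [e, tsum_mul_left]
  simp [mul_add]

/-- Existence of the strictly stationary ergodic solution of the GARCH(1,1) model:
if `(u_t)` is strictly stationary and ergodic (represented through the ergodic
measure-preserving shift `T`) and `E log(α₀u₀² + β₀) < 0` (well defined, possibly `-∞`),
then the series `h_t = ω₀(1 + ∑_{k≥1} ∏_{i=1}^k (α₀u_{t-i}² + β₀))` converges a.s.,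
`ε_t = √h_t u_t` is strictly stationary and ergodic (it satisfies the same shift
representation), and the GARCH(1,1) equations hold a.s. -/
theorem stmt8 {Ω : Type*} [MeasureSpace Ω] [IsProbabilityMeasure (ℙ : Measure Ω)]
    (T : Ω → Ω) (hT : MeasurePreserving T ℙ ℙ) (hTerg : Ergodic T ℙ)
    (u : ℤ → Ω → ℝ) (hu : ∀ t, Measurable (u t))
    (hshift : ∀ t ω, u (t + 1) ω = u t (T ω))
    (ω₀ α₀ β₀ : ℝ) (hω₀ : 0 < ω₀) (hα₀ : 0 < α₀) (hβ₀ : 0 < β₀)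
    -- E log(α₀ u₀² + β₀) < 0, the expectation being well defined but possibly -∞ :
    (hpos : ∫⁻ ω, ENNReal.ofReal (Real.log (α₀ * (u 0 ω) ^ 2 + β₀)) ∂ℙ < ⊤)
    (hneg : Integrable (fun ω => Real.log (α₀ * (u 0 ω) ^ 2 + β₀)) ℙ →
      ∫ ω, Real.log (α₀ * (u 0 ω) ^ 2 + β₀) ∂ℙ < 0) :
    ∃ h ε : ℤ → Ω → ℝ,
      -- definition of h_t as ω₀ (1 + ∑_{k=1}^∞ ∏_{i=1}^k (α₀ u_{t-i}² + β₀)) :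
      (∀ t ω, h t ω = ω₀ * (1 + ∑' k : ℕ,
        ∏ i ∈ Finset.Icc 1 (k + 1), (α₀ * (u (t - (i : ℤ)) ω) ^ 2 + β₀))) ∧
      -- definition of ε_t = √h_t · u_t :
      (∀ t ω, ε t ω = Real.sqrt (h t ω) * u t ω) ∧
      -- almost sure convergence of the series to a finite limit :
      (∀ t : ℤ, ∀ᵐ ω ∂ℙ, Summable (fun k : ℕ =>
        ∏ i ∈ Finset.Icc 1 (k + 1), (α₀ * (u (t - (i : ℤ)) ω) ^ 2 + β₀))) ∧
      -- (ε_t) is strictly stationary and ergodic: same shift representation as (u_t) :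
      (∀ t ω, ε (t + 1) ω = ε t (T ω)) ∧
      -- the GARCH(1,1) equations ε_t = σ_t u_t, σ_t² = ω₀ + α₀ ε_{t-1}² + β₀ σ_{t-1}²
      -- hold a.s. with σ_t² := h_t :
      (∀ t : ℤ, ∀ᵐ ω ∂ℙ,
        ε t ω = Real.sqrt (h t ω) * u t ω ∧
        h t ω = ω₀ + α₀ * (ε (t - 1) ω) ^ 2 + β₀ * h (t - 1) ω) := by
  have hapos : ∀ t ω, 0 < α₀ * (u t ω) ^ 2 + β₀ := fun t ω => by positivity
  have ham : ∀ t, Measurable fun ω => α₀ * (u t ω) ^ 2 + β₀ := fun t =>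
    (((hu t).pow_const 2).const_mul α₀).add_const β₀
  have hint : Integrable (fun ω => Real.log (α₀ * (u 0 ω) ^ 2 + β₀)) ℙ :=
    integrable_of_lintegral_ofReal_lt_top_of_le (ham 0).log hpos (c := Real.log β₀) fun ω =>
      Real.log_le_log hβ₀ (le_add_of_nonneg_left (by positivity))
  have hsum := ae_summable_prod_of_integral_log_neg hTerg (a := fun t ω => α₀ * (u t ω) ^ 2 + β₀)
    ham (fun t ω => by simp only [hshift]) hapos hint (hneg hint)
  refine ⟨fun t ω => ω₀ * (1 + ∑' k : ℕ,
      ∏ i ∈ Finset.Icc 1 (k + 1), (α₀ * (u (t - (i : ℤ)) ω) ^ 2 + β₀)),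
    fun t ω => Real.sqrt (ω₀ * (1 + ∑' k : ℕ,
      ∏ i ∈ Finset.Icc 1 (k + 1), (α₀ * (u (t - (i : ℤ)) ω) ^ 2 + β₀))) * u t ω,
    fun t ω => rfl, fun t ω => rfl, hsum, fun t ω => ?_, fun t => ?_⟩
  · have e : ∀ i : ℕ, u (t + 1 - (i : ℤ)) ω = u (t - (i : ℤ)) (T ω) := fun i => by
      rw [← hshift, add_sub_right_comm]
    simp only [e, hshift]
  · filter_upwards [hsum t] with ω hω
    refine ⟨rfl, ?_⟩
    have hrec := one_add_tsum_prod_Icc (b := fun s => α₀ * (u s ω) ^ 2 + β₀) hω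
    have hnn : 0 ≤ ω₀ * (1 + ∑' k : ℕ,
        ∏ i ∈ Finset.Icc 1 (k + 1), (α₀ * (u (t - 1 - (i : ℤ)) ω) ^ 2 + β₀)) :=
      mul_nonneg hω₀.le (add_nonneg zero_le_one (tsum_nonneg fun k =>
        Finset.prod_nonneg fun i _ => (hapos _ _).le))
    rw [mul_pow, Real.sq_sqrt hnn, hrec]
    ring
end

section
/- Let (ε_t)_{t∈ℤ} be identically distributed real random variables with E|ε_1|^{s₀} < ∞ for some s₀ > 0, and let ω > 0, α > 0, β ∈ (0,1). Define σ_t² := Σ_{i=0}^∞ β^i (ω + α ε_{t−1−i}²) (which is almost surely finite) and the derivative ratio D_t := [Σ_{i=1}^∞ i β^{i−1} (ω + α ε_{t−i}²)] / σ_t². Then for every s ∈ (0,1), almost surely D_t ≤ (1−β)^{−2} + (α^s/(β ω^s)) Σ_{i=1}^∞ i (β^s)^i |ε_{t−i}|^{2s}, and for every r ≥ 1 one has E[D_t^r] < ∞. -/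
open MeasureTheory ProbabilityTheory Filter

open scoped ENNReal

theorem lintegral_rpow_sum_le {Ω ι : Type*} [MeasurableSpace Ω] {μ : Measure Ω} {r : ℝ}
    (hr : 1 ≤ r) {f : ι → Ω → ℝ≥0∞} (hf : ∀ i, Measurable (f i)) (S : Finset ι) :
    (∫⁻ x, (∑ i ∈ S, f i x) ^ r ∂μ) ^ (1 / r) ≤ ∑ i ∈ S, (∫⁻ x, f i x ^ r ∂μ) ^ (1 / r) := by
  have hr0 : 0 < r := by linarith
  classical
  induction S using Finset.induction_on with
  | empty => simp [hr0]
  | insert a S ha ih =>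
    simp only [Finset.sum_insert ha]
    exact (ENNReal.lintegral_Lp_add_le (hf a).aemeasurable
      (S.measurable_fun_sum fun i _ => hf i).aemeasurable hr).trans (by gcongr)

/-- Minkowski's inequality for countable sums of `ℝ≥0∞`-valued functions. -/
theorem lintegral_rpow_tsum_le {Ω : Type*} [MeasurableSpace Ω] {μ : Measure Ω} {r : ℝ}
    (hr : 1 ≤ r) {f : ℕ → Ω → ℝ≥0∞} (hf : ∀ i, Measurable (f i)) :
    ∫⁻ x, (∑' i, f i x) ^ r ∂μ ≤ (∑' i, (∫⁻ x, f i x ^ r ∂μ) ^ (1 / r)) ^ r := by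
  have hr0 : 0 < r := by linarith
  have h1 : ∀ x, Tendsto (fun n => (∑ i ∈ Finset.range n, f i x) ^ r) atTop
      (nhds ((∑' i, f i x) ^ r)) := fun x =>
    (ENNReal.continuous_rpow_const.tendsto _).comp (ENNReal.tendsto_nat_tsum fun i => f i x)
  have h2 := lintegral_tendsto_of_tendsto_of_monotone (μ := μ)
    (f := fun n x => (∑ i ∈ Finset.range n, f i x) ^ r)
    (fun n => ((Finset.measurable_fun_sum _ fun i _ => hf i).pow_const r).aemeasurable)
    (Eventually.of_forall fun x m n hmn => by
      dsimp only
      gcongr) (Eventually.of_forall h1)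
  refine le_of_tendsto' h2 fun n => ?_
  have h3 := (lintegral_rpow_sum_le (μ := μ) hr hf (Finset.range n)).trans (ENNReal.sum_le_tsum _)
  calc _ = ((∫⁻ x, (∑ i ∈ Finset.range n, f i x) ^ r ∂μ) ^ (1 / r)) ^ r := by
        rw [← ENNReal.rpow_mul, one_div_mul_cancel hr0.ne', ENNReal.rpow_one]
    _ ≤ _ := by gcongr

theorem Summable.of_rpow {y : ℕ → ℝ} (hy : ∀ i, 0 ≤ y i) {s : ℝ} (hs : s ∈ Set.Ioo (0 : ℝ) 1)
    (h : Summable fun i => y i ^ s) : Summable y := by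
  refine Summable.of_norm_bounded_eventually_nat h ?_
  filter_upwards [h.tendsto_atTop_zero.eventually (gt_mem_nhds one_pos)] with i hi
  rw [Real.norm_of_nonneg (hy i)]
  have h1 : y i ≤ 1 := by
    by_contra! hc
    exact absurd hi (not_lt.2 (Real.one_le_rpow hc.le hs.1.le))
  exact Real.self_le_rpow_of_le_one (hy i) h1 hs.2.le

theorem hasSum_succ_mul_geometric {β : ℝ} (hβ : β ∈ Set.Ioo (0 : ℝ) 1) :
    HasSum (fun j : ℕ => ((j : ℝ) + 1) * β ^ j) (1 / (1 - β) ^ 2) := by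
  have := hasSum_choose_mul_geometric_of_norm_lt_one 1 (r := β)
    (by rw [Real.norm_of_nonneg hβ.1.le]; exact hβ.2)
  simpa using this

/-- The deterministic bound: if the derivative series diverges, its junk value makes the left-hand
side vanish. -/
theorem volatility_ratio_le (e : ℕ → ℝ) {ω₀ α β : ℝ} (hω₀ : 0 < ω₀) (hα : 0 < α)
    (hβ : β ∈ Set.Ioo (0 : ℝ) 1) {s : ℝ} (hs : s ∈ Set.Ioo (0 : ℝ) 1) :
    ENNReal.ofReal ((∑' j : ℕ, ((j : ℝ) + 1) * β ^ j * (ω₀ + α * e j ^ 2)) /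
        (∑' i : ℕ, β ^ i * (ω₀ + α * e i ^ 2)))
      ≤ ENNReal.ofReal (1 / (1 - β) ^ 2) + ENNReal.ofReal (α ^ s / (β * ω₀ ^ s)) *
        ∑' j : ℕ, ENNReal.ofReal (((j : ℝ) + 1) * (β ^ s) ^ (j + 1) * |e j| ^ (2 * s)) := by
  obtain ⟨hβ0, hβ1⟩ := hβ
  obtain ⟨hs0, hs1⟩ := hs
  by_cases hS : Summable fun j : ℕ => ((j : ℝ) + 1) * β ^ j * (ω₀ + α * e j ^ 2)
  swap
  · simp [tsum_eq_zero_of_not_summable hS]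
  have hnn : ∀ i : ℕ, 0 ≤ β ^ i * (ω₀ + α * e i ^ 2) := fun i => by positivity
  have hS0 : Summable fun i : ℕ => β ^ i * (ω₀ + α * e i ^ 2) := by
    refine Summable.of_nonneg_of_le hnn (fun i => ?_) hS
    rw [mul_assoc]
    exact le_mul_of_one_le_left (hnn i) (by simp)
  set V := ∑' i : ℕ, β ^ i * (ω₀ + α * e i ^ 2)
  have hVi : ∀ i : ℕ, β ^ i * (ω₀ + α * e i ^ 2) ≤ V := fun i =>
    hS0.le_tsum i fun j _ => hnn j
  have hVω : ω₀ ≤ V := by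
    have := hVi 0
    simp only [pow_zero, one_mul] at this
    nlinarith [mul_nonneg hα.le (sq_nonneg (e 0))]
  have hV0 : 0 < V := hω₀.trans_le hVω
  have hterm : ∀ j : ℕ, ((j : ℝ) + 1) * β ^ j * (ω₀ + α * e j ^ 2) / V ≤
      ((j : ℝ) + 1) * β ^ j + α ^ s / (β * ω₀ ^ s) *
        (((j : ℝ) + 1) * (β ^ s) ^ (j + 1) * |e j| ^ (2 * s)) := fun j => by
    set u := β ^ j * (α * e j ^ 2) with hu
    have hu0 : 0 ≤ u := by positivity
    have huV : u ≤ V := by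
      have : 0 ≤ β ^ j * ω₀ := by positivity
      nlinarith [hVi j]
    have h1 : u / V ≤ (u / ω₀) ^ s :=
      (Real.self_le_rpow_of_le_one (by positivity) ((div_le_one hV0).2 huV) hs1.le).trans
        (Real.rpow_le_rpow (by positivity) (by gcongr) hs0.le)
    have hus : (u / ω₀) ^ s = α ^ s / ω₀ ^ s * ((β ^ s) ^ j * |e j| ^ (2 * s)) := by
      rw [Real.div_rpow hu0 hω₀.le, hu, Real.mul_rpow (by positivity) (by positivity),
        Real.mul_rpow hα.le (by positivity), Real.rpow_mul (abs_nonneg _), Real.rpow_two, sq_abs,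
        Real.rpow_pow_comm hβ0.le]
      ring
    have hβs : 1 ≤ β ^ s / β :=
      (one_le_div hβ0).2 (Real.self_le_rpow_of_le_one hβ0.le hβ1.le hs1.le)
    have h2 : (u / ω₀) ^ s ≤ α ^ s / (β * ω₀ ^ s) * ((β ^ s) ^ (j + 1) * |e j| ^ (2 * s)) := by
      refine (le_mul_of_one_le_left (by positivity) hβs).trans_eq ?_
      rw [hus, pow_succ]
      field_simp
    have h3 : β ^ j * ω₀ / V ≤ β ^ j := by
      rw [div_le_iff₀ hV0]
      gcongr
    calc _ = ((j : ℝ) + 1) * (β ^ j * ω₀ / V + u / V) := by rw [hu]; ring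
      _ ≤ ((j : ℝ) + 1) *
          (β ^ j + α ^ s / (β * ω₀ ^ s) * ((β ^ s) ^ (j + 1) * |e j| ^ (2 * s))) := by
        gcongr
        exact h1.trans h2
      _ = _ := by ring
  have hg := hasSum_succ_mul_geometric ⟨hβ0, hβ1⟩
  rw [← tsum_div_const, ENNReal.ofReal_tsum_of_nonneg (fun j => by positivity) (hS.div_const V),
    ← hg.tsum_eq, ENNReal.ofReal_tsum_of_nonneg (fun j => by positivity) hg.summable,
    ← ENNReal.tsum_mul_left, ← ENNReal.tsum_add]
  refine ENNReal.tsum_le_tsum fun j => ?_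
  rw [← ENNReal.ofReal_mul (by positivity), ← ENNReal.ofReal_add (by positivity) (by positivity)]
  exact ENNReal.ofReal_le_ofReal (hterm j)

/-- Finiteness of the `r`-th moment of the weighted series of powers. -/
theorem lintegral_rpow_tsum_weighted_lt_top {Ω : Type*} [MeasurableSpace Ω] {μ : Measure Ω}
    [IsProbabilityMeasure μ] {X : ℕ → Ω → ℝ} {Y : Ω → ℝ} (hX : ∀ j, Measurable (X j))
    (hid : ∀ j, IdentDistrib (X j) Y μ μ) {s₀ : ℝ}
    (hmom : Integrable (fun x => |Y x| ^ s₀) μ) {β : ℝ} (hβ : β ∈ Set.Ioo (0 : ℝ) 1)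
    {r s : ℝ} (hr : 1 ≤ r) (hs : 0 < s) (hrs : 2 * s * r ≤ s₀) :
    ∫⁻ x, (∑' j : ℕ, ENNReal.ofReal
      (((j : ℝ) + 1) * (β ^ s) ^ (j + 1) * |X j x| ^ (2 * s))) ^ r ∂μ < ∞ := by
  obtain ⟨hβ0, hβ1⟩ := hβ
  have hr0 : 0 < r := by linarith
  have hp : 0 < 2 * s * r := by positivity
  set M := ∫⁻ x, ENNReal.ofReal (|Y x| ^ (2 * s * r)) ∂μ with hM
  have hMtop : M < ∞ := by
    refine lt_of_le_of_lt (lintegral_mono (g := fun x => ENNReal.ofReal (1 + |Y x| ^ s₀))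
      fun x => ENNReal.ofReal_le_ofReal ?_) ((integrable_const 1).add hmom).lintegral_lt_top
    rcases le_total |Y x| 1 with h | h
    · have := Real.rpow_le_one (abs_nonneg (Y x)) h hp.le
      have : 0 ≤ |Y x| ^ s₀ := by positivity
      linarith
    · have := Real.rpow_le_rpow_of_exponent_le h hrs
      linarith
  have hβs : β ^ s ∈ Set.Ioo (0 : ℝ) 1 := ⟨by positivity, Real.rpow_lt_one hβ0.le hβ1 hs⟩
  have hnorm : ∀ j : ℕ, (∫⁻ x, ENNReal.ofReal
      (((j : ℝ) + 1) * (β ^ s) ^ (j + 1) * |X j x| ^ (2 * s)) ^ r ∂μ) ^ (1 / r) =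
      ENNReal.ofReal (((j : ℝ) + 1) * (β ^ s) ^ j) * (ENNReal.ofReal (β ^ s) * M ^ (1 / r)) :=
    fun j => by
    have hid' := ((hid j).comp (u := fun y : ℝ => ENNReal.ofReal (|y| ^ (2 * s * r)))
      (by fun_prop)).lintegral_eq
    simp only [Function.comp_def] at hid'
    have h : ∀ x, ENNReal.ofReal (((j : ℝ) + 1) * (β ^ s) ^ (j + 1) * |X j x| ^ (2 * s)) ^ r =
        ENNReal.ofReal (((j : ℝ) + 1) * (β ^ s) ^ (j + 1)) ^ r *
          ENNReal.ofReal (|X j x| ^ (2 * s * r)) := fun x => by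
      rw [ENNReal.ofReal_mul (by positivity), ENNReal.mul_rpow_of_nonneg _ _ hr0.le,
        Real.rpow_mul (abs_nonneg (X j x)) (2 * s) r,
        ← ENNReal.ofReal_rpow_of_nonneg (p := r) (by positivity) hr0.le]
    simp_rw [h]
    have hX' := hX j
    rw [lintegral_const_mul _ (by fun_prop), hid', ← hM,
      ENNReal.mul_rpow_of_nonneg _ _ (by positivity), ← ENNReal.rpow_mul,
      mul_one_div_cancel hr0.ne', ENNReal.rpow_one, pow_succ, ← mul_assoc,
      ENNReal.ofReal_mul (by positivity), mul_assoc]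
  refine lt_of_le_of_lt (lintegral_rpow_tsum_le hr fun j => ?_) ?_
  · have hX' := hX j
    fun_prop
  · simp_rw [hnorm]
    rw [ENNReal.tsum_mul_right, ← ENNReal.ofReal_tsum_of_nonneg (fun j => by positivity)
      (hasSum_succ_mul_geometric hβs).summable]
    refine ENNReal.rpow_lt_top_of_nonneg hr0.le (ENNReal.mul_ne_top ENNReal.ofReal_ne_top
      (ENNReal.mul_ne_top ENNReal.ofReal_ne_top ?_))
    exact ENNReal.rpow_ne_top_of_nonneg (by positivity) hMtop.ne

/-- Moment bounds on the normalized β-derivative of the stationary GARCH(1,1) volatility: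
with `σ_t² = ∑_{i≥0} βⁱ(ω + α ε_{t-1-i}²)` and
`D_t = (∑_{i≥1} i β^{i-1}(ω + α ε_{t-i}²))/σ_t²`, for every `s ∈ (0,1)` one has a.s.
`D_t ≤ (1-β)⁻² + (α^s/(βω^s)) ∑_{i≥1} i (β^s)ⁱ |ε_{t-i}|^{2s}` (stated in `ℝ≥0∞` to
accommodate a possibly infinite right-hand side), and `E[D_t^r] < ∞` for every `r ≥ 1`. -/
theorem stmt9 {Ω : Type*} [MeasureSpace Ω] [IsProbabilityMeasure (ℙ : Measure Ω)]
    (ε : ℤ → Ω → ℝ) (hmeas : ∀ t, Measurable (ε t))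
    (hid : ∀ t : ℤ, IdentDistrib (ε t) (ε 1) ℙ ℙ)
    (s₀ : ℝ) (hs₀ : 0 < s₀) (hmom : Integrable (fun ω => |ε 1 ω| ^ s₀) ℙ)
    (ω₀ α β : ℝ) (hω₀ : 0 < ω₀) (hα : 0 < α) (hβ : β ∈ Set.Ioo (0 : ℝ) 1) (t : ℤ) :
    -- σ_t² is almost surely finite (the defining series converges a.s.):
    (∀ᵐ ω ∂ℙ, Summable (fun i : ℕ => β ^ i * (ω₀ + α * (ε (t - 1 - (i : ℤ)) ω) ^ 2))) ∧
    -- the almost-sure bound, for every s ∈ (0,1):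
    (∀ s : ℝ, s ∈ Set.Ioo (0 : ℝ) 1 → ∀ᵐ ω ∂ℙ,
      ENNReal.ofReal
          ((∑' j : ℕ, ((j : ℝ) + 1) * β ^ j * (ω₀ + α * (ε (t - 1 - (j : ℤ)) ω) ^ 2)) /
            (∑' i : ℕ, β ^ i * (ω₀ + α * (ε (t - 1 - (i : ℤ)) ω) ^ 2)))
        ≤ ENNReal.ofReal (1 / (1 - β) ^ 2) +
          ENNReal.ofReal (α ^ s / (β * ω₀ ^ s)) *
            ∑' j : ℕ, ENNReal.ofReal
              (((j : ℝ) + 1) * (β ^ s) ^ (j + 1) * |ε (t - 1 - (j : ℤ)) ω| ^ (2 * s))) ∧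
    -- the moments of every order r ≥ 1 are finite:
    (∀ r : ℝ, 1 ≤ r → Integrable (fun ω =>
        ((∑' j : ℕ, ((j : ℝ) + 1) * β ^ j * (ω₀ + α * (ε (t - 1 - (j : ℤ)) ω) ^ 2)) /
          (∑' i : ℕ, β ^ i * (ω₀ + α * (ε (t - 1 - (i : ℤ)) ω) ^ 2))) ^ r) ℙ) := by
  have hX : ∀ j : ℕ, Measurable (ε (t - 1 - (j : ℤ))) := fun j => hmeas _
  have hbound : ∀ s : ℝ, s ∈ Set.Ioo (0 : ℝ) 1 → ∀ ω, _ := fun s hs ω =>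
    volatility_ratio_le (fun j : ℕ => ε (t - 1 - (j : ℤ)) ω) hω₀ hα hβ hs
  refine ⟨?_, fun s hs => Eventually.of_forall (hbound s hs), fun r hr => ?_⟩
  · obtain ⟨s, hs0, hs⟩ : ∃ s : ℝ, 0 < s ∧ s < min 1 (s₀ / 2) := exists_between (by positivity)
    have hs1 : s < 1 := hs.trans_le (min_le_left _ _)
    have hs2 : s < s₀ / 2 := hs.trans_le (min_le_right _ _)
    have hfin := lintegral_rpow_tsum_weighted_lt_top hX (fun j => hid _) hmom hβ le_rfl hs0
      (by linarith)
    simp only [ENNReal.rpow_one] at hfin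
    have hmT : Measurable fun ω => ∑' j : ℕ, ENNReal.ofReal
        (((j : ℝ) + 1) * (β ^ s) ^ (j + 1) * |ε (t - 1 - (j : ℤ)) ω| ^ (2 * s)) := by
      refine Measurable.tsum fun j => ?_
      have hX' := hX j
      fun_prop
    obtain ⟨hβ0, hβ1⟩ := hβ
    filter_upwards [ae_lt_top hmT hfin.ne] with ω hω
    have hsum := ENNReal.summable_toReal hω.ne
    have hsq : Summable fun i : ℕ => β ^ i * ε (t - 1 - (i : ℤ)) ω ^ 2 := by
      refine Summable.of_rpow (fun i => by positivity) ⟨hs0, hs1⟩ ?_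
      refine Summable.of_nonneg_of_le (fun i => by positivity) (fun i => ?_)
        (hsum.mul_left (β ^ s)⁻¹)
      rw [ENNReal.toReal_ofReal (by positivity), Real.mul_rpow (by positivity) (by positivity),
        Real.rpow_mul (abs_nonneg _), Real.rpow_two, sq_abs]
      have hβs : β ^ s ≠ 0 := by positivity
      calc _ ≤ ((i : ℝ) + 1) * ((β ^ i) ^ s * (ε (t - 1 - (i : ℤ)) ω ^ 2) ^ s) :=
            le_mul_of_one_le_left (by positivity) (by simp)
        _ = _ := by
          rw [← Real.rpow_pow_comm hβ0.le, inv_mul_eq_div, eq_div_iff hβs]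
          ring
    refine (((summable_geometric_of_lt_one hβ0.le hβ1).mul_left ω₀).add
      (hsq.mul_left α)).congr fun i => ?_
    ring
  · have hr0 : 0 < r := by linarith
    obtain ⟨s, hs0, hs⟩ : ∃ s : ℝ, 0 < s ∧ s < min 1 (s₀ / (2 * r)) :=
      exists_between (by positivity)
    have hs1 : s < 1 := hs.trans_le (min_le_left _ _)
    have hs2 : 2 * s * r ≤ s₀ := by
      have := (lt_div_iff₀ (by positivity)).1 (hs.trans_le (min_le_right _ _))
      linarith
    have hfin := lintegral_rpow_tsum_weighted_lt_top hX (fun j => hid _) hmom hβ hr hs0 hs2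
    have hb := hbound s ⟨hs0, hs1⟩
    have hβ0 := hβ.1
    have hD0 : ∀ ω, 0 ≤ (∑' j : ℕ, ((j : ℝ) + 1) * β ^ j *
        (ω₀ + α * (ε (t - 1 - (j : ℤ)) ω) ^ 2)) /
          (∑' i : ℕ, β ^ i * (ω₀ + α * (ε (t - 1 - (i : ℤ)) ω) ^ 2)) := fun ω =>
      div_nonneg (tsum_nonneg fun j => by positivity) (tsum_nonneg fun j => by positivity)
    refine ⟨Measurable.aestronglyMeasurable ?_, ?_⟩
    · refine ((Measurable.tsum fun j => ?_).div (Measurable.tsum fun j => ?_)).pow_const r <;>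
      · have hX' := hX j
        fun_prop
    · rw [hasFiniteIntegral_iff_ofReal (Eventually.of_forall fun ω => Real.rpow_nonneg (hD0 ω) r)]
      calc _ ≤ ∫⁻ ω, 2 ^ (r - 1) * (ENNReal.ofReal (1 / (1 - β) ^ 2) ^ r +
              ENNReal.ofReal (α ^ s / (β * ω₀ ^ s)) ^ r * (∑' j : ℕ, ENNReal.ofReal
              (((j : ℝ) + 1) * (β ^ s) ^ (j + 1) * |ε (t - 1 - (j : ℤ)) ω| ^ (2 * s))) ^ r) ∂ℙ := by
            refine lintegral_mono fun ω => ?_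
            rw [← ENNReal.ofReal_rpow_of_nonneg (hD0 ω) hr0.le,
              ← ENNReal.mul_rpow_of_nonneg _ _ hr0.le]
            exact (ENNReal.rpow_le_rpow (hb ω) hr0.le).trans
              (ENNReal.rpow_add_le_mul_rpow_add_rpow _ _ hr)
        _ < ∞ := by
            rw [lintegral_const_mul' _ _ (by simp), lintegral_add_left measurable_const,
              lintegral_const_mul' _ _
                (ENNReal.rpow_ne_top_of_nonneg hr0.le ENNReal.ofReal_ne_top), lintegral_const]
            refine ENNReal.mul_lt_top (ENNReal.rpow_lt_top_of_nonneg (by linarith) (by simp))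
              (ENNReal.add_lt_top.2 ⟨?_, ?_⟩)
            · simpa using ENNReal.rpow_lt_top_of_nonneg hr0.le ENNReal.ofReal_ne_top
            · exact ENNReal.mul_lt_top
                (ENNReal.rpow_lt_top_of_nonneg hr0.le ENNReal.ofReal_ne_top) hfin
end

section
/- Let (u_t)_{t∈ℤ} be real random variables adapted to a filtration with F_t = σ(u_s, s ≤ t), satisfying E(u_t² | F_{t−1}) = 1 almost surely and P(u_0² = 1) < 1. Let θ₀ = (ω₀, α₀, β₀) ∈ (0,∞) × (0,∞) × (0,1) and let (ε_t)_{t∈ℤ} be a strictly stationary solution of the GARCH(1,1) equations ε_t = σ_t(θ₀) u_t, σ_t²(θ₀) = ω₀ + α₀ ε_{t−1}² + β₀ σ_{t−1}²(θ₀), with σ_t(θ₀) > 0 F_{t−1}-measurable, and assume E|ε_1|^{s₀} < ∞ for some s₀ > 0. For θ = (ω, α, β) ∈ (0,∞) × (0,∞) × (0,1) define σ_t²(θ) := Σ_{i=0}^∞ β^i (ω + α ε_{t−1−i}²). If θ₁, θ₂ are two such parameter values with σ_t²(θ₁) = σ_t²(θ₂) almost surely for all t ∈ ℤ, then θ₁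 = θ₂. -/
open MeasureTheory ProbabilityTheory Filter

/-- An observable of a sub-σ-algebra whose conditional expectation is `1` equals `1`. -/
lemma ae_eq_one_of_condExp_eq_one {Ω : Type*} {m m0 : MeasurableSpace Ω} {μ : Measure Ω}
    [IsProbabilityMeasure μ] {f : Ω → ℝ} (hm : m ≤ m0) (hc : μ[f | m] =ᵐ[μ] 1)
    (hf : AEStronglyMeasurable[m] f μ) : f =ᵐ[μ] 1 := by
  by_cases hi : Integrable f μ
  · exact (condExp_of_aestronglyMeasurable' hm hf hi).symm.trans hc
  · rw [condExp_of_not_integrable hi] at hc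
    obtain ⟨x, hx⟩ := hc.exists
    simp at hx

/-- A sequence bounded in `L^s` for some `s > 0` has almost surely summable
geometrically weighted squares. -/
lemma ae_summable_geometric_mul_sq {Ω : Type*} [MeasurableSpace Ω] {μ : Measure Ω}
    {X : ℕ → Ω → ℝ} (hX : ∀ i, Measurable (X i)) {s : ℝ} (hs : 0 < s) {C : ENNReal}
    (hC : C ≠ ⊤) (hXC : ∀ i, ∫⁻ ω, ENNReal.ofReal (|X i ω| ^ s) ∂μ ≤ C)
    {β : ℝ} (hβ : β ∈ Set.Ioo (0 : ℝ) 1) :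
    ∀ᵐ ω ∂μ, Summable fun i => β ^ i * X i ω ^ 2 := by
  obtain ⟨hβ0, hβ1⟩ := hβ
  set q := √β with hq
  have hq0 : 0 < q := Real.sqrt_pos.2 hβ0
  have hq1 : q < 1 := by rw [hq, Real.sqrt_lt' one_pos]; simpa using hβ1
  have hqq : β = q * q := (Real.mul_self_sqrt hβ0.le).symm
  set r : ENNReal := ENNReal.ofReal (q ^ (s / 2)) with hr
  have hr1 : r < 1 := by
    rw [hr, ENNReal.ofReal_lt_one]
    exact Real.rpow_lt_one hq0.le hq1 (by positivity)
  have hterm : ∀ i ω, ENNReal.ofReal ((q ^ i * X i ω ^ 2) ^ (s / 2)) =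
      r ^ i * ENNReal.ofReal (|X i ω| ^ s) := by
    intro i ω
    rw [hr, ← ENNReal.ofReal_pow (by positivity), ← ENNReal.ofReal_mul (by positivity),
      Real.mul_rpow (by positivity) (by positivity), ← sq_abs, ← Real.rpow_natCast,
      ← Real.rpow_natCast, ← Real.rpow_natCast, ← Real.rpow_mul hq0.le, ← Real.rpow_mul hq0.le,
      ← Real.rpow_mul (abs_nonneg _)]
    congr 3 <;> push_cast <;> ring
  have hmeas : ∀ i, Measurable fun ω => ENNReal.ofReal ((q ^ i * X i ω ^ 2) ^ (s / 2)) := by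
    intro i
    have := hX i
    fun_prop
  have hfin : ∫⁻ ω, ∑' i, ENNReal.ofReal ((q ^ i * X i ω ^ 2) ^ (s / 2)) ∂μ ≠ ⊤ := by
    rw [lintegral_tsum fun i => (hmeas i).aemeasurable]
    have hle : ∑' i, ∫⁻ ω, ENNReal.ofReal ((q ^ i * X i ω ^ 2) ^ (s / 2)) ∂μ ≤
        ∑' i, r ^ i * C := by
      refine ENNReal.tsum_le_tsum fun i => ?_
      simp_rw [hterm]
      rw [lintegral_const_mul' _ _ (ENNReal.pow_ne_top hr1.ne_top)]
      gcongr
      exact hXC i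
    refine ne_top_of_le_ne_top ?_ hle
    rw [ENNReal.tsum_mul_right, ENNReal.tsum_geometric]
    refine ENNReal.mul_ne_top (ENNReal.inv_ne_top.2 ?_) hC
    exact (tsub_pos_of_lt hr1).ne'
  filter_upwards [ae_lt_top (Measurable.tsum hmeas) hfin] with ω hω
  have hlim := ENNReal.tendsto_atTop_zero_of_tsum_ne_top hω.ne
  have hev : ∀ᶠ i in atTop, ENNReal.ofReal ((q ^ i * X i ω ^ 2) ^ (s / 2)) < 1 :=
    hlim.eventually_lt_const one_pos
  refine Summable.of_norm_bounded_eventually_nat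
    (summable_geometric_of_lt_one hq0.le hq1) ?_
  filter_upwards [hev] with i hi
  rw [ENNReal.ofReal_lt_one] at hi
  have hle : q ^ i * X i ω ^ 2 ≤ 1 := by
    by_contra! hgt
    exact (Real.one_lt_rpow hgt (by positivity : 0 < s / 2)).not_gt hi
  rw [Real.norm_of_nonneg (by positivity), hqq, mul_pow, mul_assoc]
  exact mul_le_of_le_one_right (by positivity) hle

/-- A series of nonnegative measurable functions has a measurable sum. -/
lemma measurable_tsum_of_nonneg {Ω : Type*} [MeasurableSpace Ω] {f : ℕ → Ω → ℝ}
    (hf : ∀ i, Measurable (f i)) (h0 : ∀ i ω, 0 ≤ f i ω) :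
    Measurable fun ω => ∑' i, f i ω := by
  have h : (fun ω => ∑' i, f i ω) = fun ω => (∑' i, ENNReal.ofReal (f i ω)).toReal := by
    ext ω
    rw [ENNReal.tsum_toReal_eq fun i => ENNReal.ofReal_ne_top]
    exact tsum_congr fun i => (ENNReal.toReal_ofReal (h0 i ω)).symm
  rw [h]
  exact (Measurable.tsum fun i => (hf i).ennreal_ofReal).ennreal_toReal

/-- The volatility series satisfies the GARCH recursion wherever it converges. -/
lemma garch_series_succ {x : ℤ → ℝ} {a b β : ℝ} (hβ : β ∈ Set.Ioo (0 : ℝ) 1) (t : ℤ)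
    (hx : Summable fun i : ℕ => β ^ i * x (t - i) ^ 2) :
    ∑' i : ℕ, β ^ i * (a + b * x (t + 1 - 1 - (i : ℤ)) ^ 2) =
      a + b * x t ^ 2 + β * ∑' i : ℕ, β ^ i * (a + b * x (t - 1 - (i : ℤ)) ^ 2) := by
  have hs : Summable fun i : ℕ => β ^ i * (a + b * x (t + 1 - 1 - (i : ℤ)) ^ 2) := by
    refine (((summable_geometric_of_lt_one hβ.1.le hβ.2).mul_left a).add
      (hx.mul_left b)).congr fun i => ?_
    rw [add_sub_cancel_right]
    ring
  rw [hs.tsum_eq_zero_add, ← tsum_mul_left]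
  congr 1
  · simp
  · refine tsum_congr fun i => ?_
    rw [show t + 1 - 1 - ((i + 1 : ℕ) : ℤ) = t - 1 - i by push_cast; ring]
    ring

/-- Identifiability of the GARCH(1,1) parameter (A4 part of Lemma 2 of the paper):
if the innovations satisfy `E(u_t²|F_{t-1}) = 1` with nondegenerate `u₀²`, and `(ε_t)`
is a strictly stationary solution of the GARCH(1,1) equations with a small-order moment,
then equality a.s. of the volatilities `σ_t²(θ₁) = σ_t²(θ₂)` (given by the stationary
representation `σ_t²(θ) = ∑_{i≥0} βⁱ(ω + α ε_{t-1-i}²)`) forces `θ₁ = θ₂`. -/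
theorem stmt10 {Ω : Type*} [m0 : MeasureSpace Ω] [IsProbabilityMeasure (ℙ : Measure Ω)]
    (u ε σp : ℤ → Ω → ℝ)
    (hu : ∀ t, Measurable (u t)) (hε : ∀ t, Measurable (ε t))
    -- E(u_t² | F_{t-1}) = 1 where F_t = σ(u_k, k ≤ t):
    (hcondvar : ∀ t : ℤ, ℙ[(fun ω => (u t ω) ^ 2) |
        ⨆ (k : ℤ) (_ : k ≤ t - 1), MeasurableSpace.comap (u k) inferInstance] =ᵐ[ℙ] 1)
    -- u₀² is nondegenerate:
    (hnondeg : ℙ {ω | (u 0 ω) ^ 2 = 1} < 1)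
    -- true parameter:
    (ω₀ α₀ β₀ : ℝ) (hω₀ : 0 < ω₀) (hα₀ : 0 < α₀) (hβ₀ : β₀ ∈ Set.Ioo (0 : ℝ) 1)
    -- (ε_t) strictly stationary solution with σ_t(θ₀) > 0 and F_{t-1}-measurable:
    (hσpos : ∀ t : ℤ, ∀ᵐ ω ∂ℙ, 0 < σp t ω)
    (hσmeas : ∀ t : ℤ, Measurable[⨆ (k : ℤ) (_ : k ≤ t - 1),
        MeasurableSpace.comap (u k) inferInstance] (σp t))
    (hsol : ∀ t : ℤ, ∀ᵐ ω ∂ℙ,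
      ε t ω = σp t ω * u t ω ∧
      (σp t ω) ^ 2 = ω₀ + α₀ * (ε (t - 1) ω) ^ 2 + β₀ * (σp (t - 1) ω) ^ 2)
    (hstat : ∀ (n : ℕ) (t : ℤ), IdentDistrib
        (fun ω => fun i : Fin n => ε (t + i) ω)
        (fun ω => fun i : Fin n => ε (i : ℤ) ω) ℙ ℙ)
    (s₀ : ℝ) (hs₀ : 0 < s₀) (hmom : Integrable (fun ω => |ε 1 ω| ^ s₀) ℙ)
    -- two parameter values giving the same volatility process:
    (ω₁ α₁ β₁ ω₂ α₂ β₂ : ℝ)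
    (hθ₁ : 0 < ω₁ ∧ 0 < α₁ ∧ β₁ ∈ Set.Ioo (0 : ℝ) 1)
    (hθ₂ : 0 < ω₂ ∧ 0 < α₂ ∧ β₂ ∈ Set.Ioo (0 : ℝ) 1)
    (heq : ∀ t : ℤ,
      (fun ω => ∑' i : ℕ, β₁ ^ i * (ω₁ + α₁ * (ε (t - 1 - (i : ℤ)) ω) ^ 2)) =ᵐ[ℙ]
      (fun ω => ∑' i : ℕ, β₂ ^ i * (ω₂ + α₂ * (ε (t - 1 - (i : ℤ)) ω) ^ 2))) :
    (ω₁, α₁, β₁) = (ω₂, α₂, β₂) := by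
  have hid : ∀ t, IdentDistrib (ε t) (ε 0) ℙ ℙ := fun t => by
    simpa [Function.comp_def] using (hstat 1 t).comp (measurable_pi_apply 0)
  have hsum : ∀ {β : ℝ}, β ∈ Set.Ioo (0 : ℝ) 1 → ∀ t : ℤ,
      ∀ᵐ ω ∂ℙ, Summable fun i : ℕ => β ^ i * ε (t - i) ω ^ 2 := by
    intro β hβ t
    refine ae_summable_geometric_mul_sq (X := fun i => ε (t - i)) (fun i => hε _) hs₀
      (C := ∫⁻ ω, ENNReal.ofReal (|ε 1 ω| ^ s₀)) ?_ (fun i => ?_) hβ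
    · exact hmom.lintegral_lt_top.ne
    · have hg : Measurable fun x : ℝ => ENNReal.ofReal (|x| ^ s₀) := by fun_prop
      exact (((hid (t - i)).trans (hid 1).symm).comp hg).lintegral_eq.le
  have hrec : ∀ {a b β : ℝ}, β ∈ Set.Ioo (0 : ℝ) 1 → ∀ t : ℤ, ∀ᵐ ω ∂ℙ,
      ∑' i : ℕ, β ^ i * (a + b * ε (t + 1 - 1 - (i : ℤ)) ω ^ 2) =
        a + b * ε t ω ^ 2 + β * ∑' i : ℕ, β ^ i * (a + b * ε (t - 1 - (i : ℤ)) ω ^ 2) := by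
    intro a b β hβ t
    filter_upwards [hsum hβ t] with ω hω
    exact garch_series_succ (x := fun k => ε k ω) hβ t hω
  obtain ⟨hω₁, hα₁, hβ₁⟩ := hθ₁
  obtain ⟨hω₂, hα₂, hβ₂⟩ := hθ₂
  set H : ℤ → Ω → ℝ := fun t ω =>
    ∑' i : ℕ, β₁ ^ i * (ω₁ + α₁ * ε (t - 1 - (i : ℤ)) ω ^ 2)
  have hstep : ∀ t, ∀ᵐ ω ∂ℙ, H (t + 1) ω = ω₁ + α₁ * ε t ω ^ 2 + β₁ * H t ω := fun t =>
    hrec hβ₁ t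
  have hlin : ∀ t, ∀ᵐ ω ∂ℙ,
      (α₁ - α₂) * ε t ω ^ 2 = (ω₂ - ω₁) + (β₂ - β₁) * H t ω := by
    intro t
    filter_upwards [hstep t, hrec (a := ω₂) (b := α₂) hβ₂ t, heq t, heq (t + 1)]
      with ω h1 h2 h3 h4
    change H t ω = _ at h3
    change H (t + 1) ω = _ at h4
    rw [← h3, ← h4] at h2
    linarith
  set m : MeasurableSpace Ω := ⨆ (k : ℤ) (_ : k ≤ (0 : ℤ) - 1),
    MeasurableSpace.comap (u k) inferInstance
  have hm : m ≤ m0.toMeasurableSpace := iSup₂_le fun k _ => (hu k).comap_le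
  have hnot : ∀ g : Ω → ℝ, AEStronglyMeasurable[m] g ℙ →
      ¬ (fun ω => ε 0 ω ^ 2) =ᵐ[ℙ] g := by
    intro g hg h
    have hσ : AEStronglyMeasurable[m] (fun ω => (σp 0 ω ^ 2)⁻¹) ℙ :=
      ((hσmeas 0).pow_const 2).inv.stronglyMeasurable.aestronglyMeasurable
    have hu0 : (fun ω => u 0 ω ^ 2) =ᵐ[ℙ] fun ω => g ω * (σp 0 ω ^ 2)⁻¹ := by
      filter_upwards [h, hσpos 0, hsol 0] with ω h1 h2 h3
      rw [← h1, h3.1]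
      field_simp
    have h1 := ae_eq_one_of_condExp_eq_one hm (hcondvar 0) ((hg.mul hσ).congr hu0.symm)
    exact hnondeg.ne ((measure_congr (eventuallyEq_univ.2 h1)).trans measure_univ)
  have hHm : AEStronglyMeasurable[m] (H 0) ℙ := by
    have hmeas : ∀ i : ℕ, Measurable[m] fun ω =>
        β₁ ^ i * (ω₁ + α₁ * (σp (0 - 1 - (i : ℤ)) ω * u (0 - 1 - (i : ℤ)) ω) ^ 2) := by
      intro i
      have h1 : Measurable[m] (σp (0 - 1 - (i : ℤ))) :=
        (hσmeas _).mono (biSup_mono fun k hk => by omega) le_rfl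
      have h2 : Measurable[m] (u (0 - 1 - (i : ℤ))) :=
        Measurable.mono (comap_measurable _) (le_iSup₂_of_le (0 - 1 - (i : ℤ)) (by omega) le_rfl)
          le_rfl
      exact (((h1.mul h2).pow_const 2).const_mul α₁ |>.const_add ω₁).const_mul _
    have htsum := @measurable_tsum_of_nonneg Ω m _ hmeas
      fun i ω => mul_nonneg (pow_nonneg hβ₁.1.le i) (by positivity)
    refine htsum.stronglyMeasurable.aestronglyMeasurable.congr ?_
    filter_upwards [ae_all_iff.2 hsol] with ω hω
    exact tsum_congr fun i => by rw [(hω _).1]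
  have hα : α₁ = α₂ := by
    by_contra hne
    have hne' : α₁ - α₂ ≠ 0 := sub_ne_zero.2 hne
    refine hnot (fun ω => (α₁ - α₂)⁻¹ * ((ω₂ - ω₁) + (β₂ - β₁) * H 0 ω))
      ((aestronglyMeasurable_const.add (hHm.const_mul _)).const_mul _) ?_
    filter_upwards [hlin 0] with ω h
    rw [← h, inv_mul_cancel_left₀ hne']
  have hβ : β₁ = β₂ := by
    by_contra hne
    have hne' : β₂ - β₁ ≠ 0 := sub_ne_zero.2 (Ne.symm hne)
    have hconst : ∀ t, ∀ᵐ ω ∂ℙ, H t ω = (ω₁ - ω₂) / (β₂ - β₁) := by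
      intro t
      filter_upwards [hlin t] with ω h
      rw [hα, sub_self, zero_mul] at h
      rw [eq_div_iff hne']
      linarith
    refine hnot (fun _ => ((1 - β₁) * ((ω₁ - ω₂) / (β₂ - β₁)) - ω₁) / α₁)
      aestronglyMeasurable_const ?_
    filter_upwards [hconst 0, hconst (0 + 1), hstep 0] with ω h1 h2 h3
    rw [h1, h2] at h3
    rw [eq_div_iff hα₁.ne']
    linarith
  have hω : ω₁ = ω₂ := by
    obtain ⟨ω, h⟩ := (hlin 0).exists
    rw [hα, hβ] at h
    linarith
  rw [hα, hβ, hω]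
end

section
/- Let (u_t)_{t∈ℤ} be a strictly stationary and ergodic sequence of real random variables adapted to the filtration F_t = σ(u_s, s ≤ t), such that the conditional distribution of u_t given F_{t−1} admits a density f_{t−1} (P(u_t ∈ B | F_{t−1}) = ∫_B f_{t−1}(x)dx a.s. for Borel B). Fix ξ ∈ ℝ and δ > 0, and assume E[sup_{x ∈ [ξ−δ, ξ+δ]} f_{t−1}(x)] < ∞ and that sup_{x ∈ [ξ−δ', ξ+δ']} |f_{t−1}(x) − f_{t−1}(ξ)| ≤ K_{t−1}·δ' for all sufficiently small δ' > 0, where (K_t) is a stationary ergodic adapted sequence with E K_t < ∞. Then for every z > 0, n^{−1/2} Σ_{t=1}^n 𝟙_{ξ ≤ u_t < ξ + z/√n} → z · E[f_0(ξ)] in probability as n → ∞. -/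
open MeasureTheory ProbabilityTheory Filter
open scoped ENNReal Topology

section Ergodic

variable {Ω : Type*} [MeasurableSpace Ω] {μ : Measure Ω} {T : Ω → Ω}

theorem aestronglyMeasurable_average {F : Ω → ℝ} (hT : MeasurePreserving T μ μ)
    (hF : AEStronglyMeasurable F μ) (n : ℕ) :
    AEStronglyMeasurable (fun ω => (n : ℝ)⁻¹ * ∑ k ∈ Finset.range n, F (T^[k] ω)) μ :=
  (Finset.aestronglyMeasurable_fun_sum _ fun k _ =>
    hF.comp_measurePreserving (hT.iterate k)).const_mul _

/-- Von Neumann's mean ergodic theorem in `L²` for an ergodic map. -/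
theorem Ergodic.exists_tendsto_eLpNorm_two_average (hT : Ergodic T μ) [IsFiniteMeasure μ]
    {g : Ω → ℝ} (hg : MemLp g 2 μ) :
    ∃ c : ℝ, Tendsto (fun n : ℕ => eLpNorm
      (fun ω => (n : ℝ)⁻¹ * ∑ k ∈ Finset.range n, g (T^[k] ω) - c) 2 μ) atTop (𝓝 0) := by
  have hmp := hT.toMeasurePreserving
  let U : Lp ℝ 2 μ →L[ℝ] Lp ℝ 2 μ :=
    (Lp.compMeasurePreservingₗᵢ ℝ T hmp).toContinuousLinearMap
  have hU : ‖U‖ ≤ 1 := LinearIsometry.norm_toContinuousLinearMap_le _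
  have hUapp : ∀ x, U x = Lp.compMeasurePreserving T hmp x := fun x => rfl
  have hlim := U.tendsto_birkhoffAverage_orthogonalProjection hU (hg.toLp g)
  set P := ((U.eqLocus (1 : Lp ℝ 2 μ →L[ℝ] Lp ℝ 2 μ)).orthogonalProjectionOnto (hg.toLp g))
  have hP : Lp.compMeasurePreserving T hmp (P : Lp ℝ 2 μ) = P := P.2
  obtain ⟨c, hc⟩ := hT.ae_eq_const_of_ae_eq_comp_ae (Lp.aestronglyMeasurable (P : Lp ℝ 2 μ))
    ((Lp.coeFn_compMeasurePreserving (P : Lp ℝ 2 μ) hmp).symm.trans (by rw [hP]))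
  refine ⟨c, ?_⟩
  rw [Lp.tendsto_Lp_iff_tendsto_eLpNorm'] at hlim
  refine hlim.congr fun n => eLpNorm_congr_ae ?_
  have hiter : ∀ k : ℕ, (U^[k] (hg.toLp g) : Ω → ℝ) =ᵐ[μ] fun ω => g (T^[k] ω) := by
    intro k
    have h1 : U^[k] (hg.toLp g) = Lp.compMeasurePreserving T^[k] (hmp.iterate k) (hg.toLp g) := by
      rw [← Lp.compMeasurePreserving_iterate hmp k]
      rfl
    rw [h1, Lp.toLp_compMeasurePreserving]
    exact MemLp.coeFn_toLp _
  have hav : ((birkhoffAverage ℝ U id n (hg.toLp g) : Lp ℝ 2 μ) : Ω → ℝ) =ᵐ[μ]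
      fun ω => (n : ℝ)⁻¹ * ∑ k ∈ Finset.range n, g (T^[k] ω) := by
    simp only [birkhoffAverage, birkhoffSum, id]
    filter_upwards [Lp.coeFn_smul ((n : ℝ)⁻¹) (∑ k ∈ Finset.range n, U^[k] (hg.toLp g)),
      Lp.coeFn_fun_finsetSum (Finset.range n) (fun k => U^[k] (hg.toLp g)),
      ae_all_iff.2 hiter] with ω h1 h2 h3
    rw [h1, Pi.smul_apply, h2, smul_eq_mul]
    simp only [h3]
  filter_upwards [hav, hc] with ω h1 h2
  rw [Pi.sub_apply, h1, h2]
  rfl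

theorem integral_average [IsProbabilityMeasure μ] (hT : MeasurePreserving T μ μ) {F : Ω → ℝ}
    (hF : Integrable F μ) {n : ℕ} (hn : n ≠ 0) :
    ∫ ω, (n : ℝ)⁻¹ * ∑ k ∈ Finset.range n, F (T^[k] ω) ∂μ = ∫ ω, F ω ∂μ := by
  have h (k : ℕ) : ∫ ω, F (T^[k] ω) ∂μ = ∫ ω, F ω ∂μ := by
    have hk := hT.iterate k
    conv_rhs => rw [← hk.map_eq]
    rw [integral_map hk.measurable.aemeasurable (by rw [hk.map_eq]; exact hF.1)]
  rw [integral_const_mul, integral_finsetSum (f := fun k ω => F (T^[k] ω)) _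
    fun k _ => (hT.iterate k).integrable_comp_of_integrable hF]
  simp only [h, Finset.sum_const, Finset.card_range, nsmul_eq_mul]
  field_simp

theorem enorm_integral_le_eLpNorm_one (F : Ω → ℝ) : ‖∫ ω, F ω ∂μ‖ₑ ≤ eLpNorm F 1 μ := by
  rw [eLpNorm_one_eq_lintegral_enorm]
  exact enorm_integral_le_lintegral_enorm F

/-- The mean ergodic theorem in `L¹` for an ergodic map. -/
theorem Ergodic.tendsto_eLpNorm_one_average [IsProbabilityMeasure μ] (hT : Ergodic T μ)
    {F : Ω → ℝ} (hF : Integrable F μ) :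
    Tendsto (fun n : ℕ => eLpNorm
      (fun ω => (n : ℝ)⁻¹ * ∑ k ∈ Finset.range n, F (T^[k] ω) - ∫ ω', F ω' ∂μ) 1 μ)
      atTop (𝓝 0) := by
  have hmp := hT.toMeasurePreserving
  have hL2 : ∀ g : Ω → ℝ, MemLp g 2 μ → Tendsto (fun n : ℕ => eLpNorm
      (fun ω => (n : ℝ)⁻¹ * ∑ k ∈ Finset.range n, g (T^[k] ω) - ∫ ω', g ω' ∂μ) 1 μ)
      atTop (𝓝 0) := by
    intro g hg
    obtain ⟨c, hc⟩ := hT.exists_tendsto_eLpNorm_two_average hg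
    have hgi : Integrable g μ := hg.integrable (by norm_num)
    have hc1 : Tendsto (fun n : ℕ => eLpNorm
        (fun ω => (n : ℝ)⁻¹ * ∑ k ∈ Finset.range n, g (T^[k] ω) - c) 1 μ) atTop (𝓝 0) :=
      tendsto_of_tendsto_of_tendsto_of_le_of_le tendsto_const_nhds hc (fun _ => zero_le)
        fun n => eLpNorm_le_eLpNorm_of_exponent_le (by norm_num)
          ((aestronglyMeasurable_average hmp hg.1 n).sub aestronglyMeasurable_const)
    have hle : ‖∫ ω, g ω ∂μ - c‖ₑ ≤ 0 := by
      refine ge_of_tendsto hc1 ((eventually_ne_atTop 0).mono fun n hn => ?_)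
      refine le_trans (le_of_eq ?_) (enorm_integral_le_eLpNorm_one _)
      rw [integral_sub _ (integrable_const _), integral_average hmp hgi hn]
      · simp
      · exact (integrable_finsetSum _ fun k _ =>
          (hmp.iterate k).integrable_comp_of_integrable hgi).const_mul _
    have : ∫ ω, g ω ∂μ = c := by simpa [sub_eq_zero] using hle
    rwa [this]
  rw [ENNReal.tendsto_nhds_zero]
  intro ε hε
  have hε3 : ε / 3 ≠ 0 := (ENNReal.div_pos hε.ne' (by norm_num)).ne'
  obtain ⟨g, hg, hgi, hg2⟩ : ∃ g : Ω → ℝ,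
      eLpNorm (F - g) 1 μ < ε / 3 ∧ Integrable g μ ∧ MemLp g 2 μ := by
    obtain ⟨g, hg, hg1⟩ := (memLp_one_iff_integrable.2 hF).exists_simpleFunc_eLpNorm_sub_lt
      (by norm_num) hε3
    exact ⟨g, hg, memLp_one_iff_integrable.1 hg1, g.memLp_of_isFiniteMeasure 2 μ⟩
  filter_upwards [(ENNReal.tendsto_nhds_zero.1 (hL2 g hg2)) _ (pos_iff_ne_zero.2 hε3)] with n hn
  have hm : AEStronglyMeasurable (F - g) μ := hF.1.sub hgi.1
  have h1 : eLpNorm (fun ω => (n : ℝ)⁻¹ * ∑ k ∈ Finset.range n, (F - g) (T^[k] ω)) 1 μ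
      ≤ ε / 3 := by
    calc _ = ‖(n : ℝ)⁻¹‖ₑ *
          eLpNorm (∑ k ∈ Finset.range n, (F - g) ∘ T^[k]) 1 μ := by
          rw [← eLpNorm_const_smul]
          congr 1
          ext ω
          simp
      _ ≤ ‖(n : ℝ)⁻¹‖ₑ * ∑ k ∈ Finset.range n, eLpNorm ((F - g) ∘ T^[k]) 1 μ := by
          gcongr
          exact eLpNorm_sum_le (fun k _ => hm.comp_measurePreserving (hmp.iterate k)) le_rfl
      _ = ‖(n : ℝ)⁻¹‖ₑ * (n * eLpNorm (F - g) 1 μ) := by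
          simp [eLpNorm_comp_measurePreserving hm (hmp.iterate _)]
      _ ≤ eLpNorm (F - g) 1 μ := by
          rw [← mul_assoc]
          refine mul_le_of_le_one_left zero_le ?_
          rcases eq_or_ne n 0 with rfl | h0
          · simp
          · rw [enorm_inv (by positivity)]
            simp [Real.enorm_natCast]
      _ ≤ ε / 3 := hg.le
  have h3 : eLpNorm (fun _ : Ω => ∫ ω, g ω ∂μ - ∫ ω, F ω ∂μ) 1 μ ≤ ε / 3 := by
    rw [eLpNorm_const _ one_ne_zero (IsProbabilityMeasure.ne_zero μ)]
    simp only [measure_univ, ENNReal.one_rpow, mul_one]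
    rw [← integral_sub hgi hF, ← enorm_neg, ← integral_neg]
    refine (enorm_integral_le_eLpNorm_one _).trans (le_trans (le_of_eq ?_) hg.le)
    congr 1
    ext ω
    simp
  have hmg := (aestronglyMeasurable_average hmp hgi.1 n).sub
    (aestronglyMeasurable_const (b := ∫ ω, g ω ∂μ))
  calc _ = eLpNorm ((fun ω => (n : ℝ)⁻¹ * ∑ k ∈ Finset.range n, (F - g) (T^[k] ω)) +
        (fun ω => (n : ℝ)⁻¹ * ∑ k ∈ Finset.range n, g (T^[k] ω) - ∫ ω', g ω' ∂μ) +
        (fun _ : Ω => ∫ ω, g ω ∂μ - ∫ ω, F ω ∂μ)) 1 μ := by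
        congr 1
        ext ω
        simp only [Pi.add_apply, Pi.sub_apply, Finset.sum_sub_distrib]
        ring
    _ ≤ ε / 3 + ε / 3 + ε / 3 := by
        refine (eLpNorm_add_le ((aestronglyMeasurable_average hmp hm n).add hmg)
          aestronglyMeasurable_const le_rfl).trans (add_le_add ?_ h3)
        exact (eLpNorm_add_le (aestronglyMeasurable_average hmp hm n) hmg le_rfl).trans
          (add_le_add h1 hn)
    _ = ε := ENNReal.add_thirds ε

end Ergodic

section MartingaleDifference

variable {Ω : Type*} {m m0 : MeasurableSpace Ω} {μ : Measure Ω}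

theorem integral_mul_sub_condExp_eq_zero [IsFiniteMeasure μ] (hm : m ≤ m0) {A B : Ω → ℝ}
    (hA : AEStronglyMeasurable[m] A μ) (hA2 : MemLp A 2 μ) (hB2 : MemLp B 2 μ) :
    ∫ ω, A ω * (B ω - (μ[B | m]) ω) ∂μ = 0 := by
  have hB : Integrable B μ := hB2.integrable (by norm_num)
  have hC2 : MemLp (B - μ[B | m]) 2 μ := hB2.sub (hB2.condExp one_le_two)
  have hAC : Integrable (A * (B - μ[B | m])) μ := hA2.integrable_mul hC2
  have hC : μ[B - μ[B | m] | m] =ᵐ[μ] 0 := by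
    refine (condExp_sub hB integrable_condExp m).trans ?_
    rw [condExp_of_stronglyMeasurable hm stronglyMeasurable_condExp integrable_condExp, sub_self]
  calc ∫ ω, A ω * (B ω - (μ[B | m]) ω) ∂μ = ∫ ω, (μ[A * (B - μ[B | m]) | m]) ω ∂μ :=
        (integral_condExp hm).symm
    _ = ∫ _, (0 : ℝ) ∂μ := by
        refine integral_congr_ae ?_
        filter_upwards [condExp_mul_of_aestronglyMeasurable_left hA hAC
          (hC2.integrable (by norm_num)), hC] with ω h1 h2
        rw [h1, Pi.mul_apply, h2]
        simp
    _ = 0 := by simp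

/-- The `L²` norm of a sum of pairwise orthogonal functions. -/
theorem eLpNorm_two_sum_le_of_orthogonal {D : ℕ → Ω → ℝ} {a : ℝ} (n : ℕ)
    (hD : ∀ k, MemLp (D k) 2 μ) (horth : ∀ i j, i < j → ∫ ω, D i ω * D j ω ∂μ = 0)
    (ha : ∀ k, ∫ ω, D k ω ^ 2 ∂μ ≤ a) :
    eLpNorm (fun ω => ∑ k ∈ Finset.range n, D k ω) 2 μ ≤ ENNReal.ofReal (√(n * a)) := by
  have hsum : MemLp (fun ω => ∑ k ∈ Finset.range n, D k ω) 2 μ :=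
    memLp_finsetSum _ fun k _ => hD k
  rw [hsum.eLpNorm_eq_integral_rpow_norm (by norm_num) (by norm_num)]
  refine ENNReal.ofReal_le_ofReal ?_
  have horth' : ∀ i j, i ≠ j → ∫ ω, D i ω * D j ω ∂μ = 0 := by
    intro i j hij
    rcases lt_or_gt_of_ne hij with h | h
    · exact horth i j h
    · simpa only [mul_comm] using horth j i h
  have hint : ∀ i j, Integrable (fun ω => D i ω * D j ω) μ := fun i j =>
    (hD i).integrable_mul (hD j)
  have hsq : ∫ ω, (∑ k ∈ Finset.range n, D k ω) ^ 2 ∂μ ≤ n * a := by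
    simp only [sq, Finset.sum_mul_sum]
    rw [integral_finsetSum _ fun i _ => integrable_finsetSum _ fun j _ => hint i j]
    calc _ = ∑ i ∈ Finset.range n, ∫ ω, D i ω ^ 2 ∂μ := by
          refine Finset.sum_congr rfl fun i hi => ?_
          rw [integral_finsetSum _ fun j _ => hint i j,
            Finset.sum_eq_single_of_mem i hi fun j _ hj => horth' i j hj.symm]
          simp only [sq]
      _ ≤ ∑ i ∈ Finset.range n, a := Finset.sum_le_sum fun i _ => ha i
      _ = n * a := by simp
  rw [Real.sqrt_eq_rpow]
  simp only [ENNReal.toReal_ofNat, Real.rpow_two, Real.norm_eq_abs, sq_abs]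
  rw [one_div]
  exact Real.rpow_le_rpow (integral_nonneg fun ω => sq_nonneg _) hsq (by norm_num)

theorem integral_sq_sub_condExp_le [IsFiniteMeasure μ] {X : Ω → ℝ}
    (hX : AEStronglyMeasurable X μ) (h0 : ∀ ω, 0 ≤ X ω) (h1 : ∀ ω, X ω ≤ 1) :
    ∫ ω, (X ω - (μ[X | m]) ω) ^ 2 ∂μ ≤ 4 * ∫ ω, X ω ∂μ := by
  have hXb : ∀ ω, |X ω| ≤ 1 := fun ω => by rw [abs_of_nonneg (h0 ω)]; exact h1 ω
  have hX2 : MemLp X 2 μ := MemLp.of_bound hX 1 (ae_of_all _ hXb)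
  have hXi : Integrable X μ := hX2.integrable (by norm_num)
  have hpb : ∀ᵐ ω ∂μ, |(μ[X | m]) ω| ≤ 1 :=
    ae_bdd_abs_condExp_of_ae_bdd_abs (ae_of_all μ hXb)
  calc ∫ ω, (X ω - (μ[X | m]) ω) ^ 2 ∂μ ≤ ∫ ω, 2 * (|X ω| + |(μ[X | m]) ω|) ∂μ := by
        refine integral_mono_ae (hX2.sub (hX2.condExp one_le_two)).integrable_sq
          ((hXi.abs.add integrable_condExp.abs).const_mul 2) ?_
        filter_upwards [hpb] with ω hp
        have hle : |X ω - (μ[X | m]) ω| ≤ |X ω| + |(μ[X | m]) ω| := abs_sub _ _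
        have hx := hXb ω
        rw [← sq_abs]
        nlinarith [abs_nonneg (X ω - (μ[X | m]) ω)]
    _ = 2 * (∫ ω, |X ω| ∂μ + ∫ ω, |(μ[X | m]) ω| ∂μ) := by
        rw [integral_const_mul, integral_add hXi.abs integrable_condExp.abs]
    _ ≤ 2 * (∫ ω, |X ω| ∂μ + ∫ ω, |X ω| ∂μ) := by
        have := integral_abs_condExp_le (m := m) (μ := μ) X
        linarith
    _ = 4 * ∫ ω, X ω ∂μ := by
        simp only [abs_of_nonneg (h0 _)]
        ring

/-- A sum of `n` centered `[0, 1]`-valued adapted variables has `L²` norm at most `√(4 n a)`. -/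
theorem eLpNorm_two_sum_sub_condExp_le [IsFiniteMeasure μ] {G : ℕ → MeasurableSpace Ω}
    (hG : ∀ k, G k ≤ m0) (hGmono : Monotone G) {X : ℕ → Ω → ℝ}
    (hX : ∀ i j, i < j → StronglyMeasurable[G j] (X i))
    (h0 : ∀ k ω, 0 ≤ X k ω) (h1 : ∀ k ω, X k ω ≤ 1) {a : ℝ} (ha : ∀ k, ∫ ω, X k ω ∂μ ≤ a)
    (n : ℕ) :
    eLpNorm (fun ω => ∑ k ∈ Finset.range n, (X k ω - (μ[X k | G k]) ω)) 2 μ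
      ≤ ENNReal.ofReal (√(n * (4 * a))) := by
  have hXm : ∀ k, AEStronglyMeasurable (X k) μ := fun k =>
    ((hX k (k + 1) k.lt_succ_self).mono (hG _)).aestronglyMeasurable
  have hX2 : ∀ k, MemLp (X k) 2 μ := fun k => MemLp.of_bound (hXm k) 1 (ae_of_all _ fun ω => by
    rw [Real.norm_eq_abs, abs_of_nonneg (h0 k ω)]; exact h1 k ω)
  refine eLpNorm_two_sum_le_of_orthogonal (D := fun k ω => X k ω - (μ[X k | G k]) ω) n
    (fun k => (hX2 k).sub ((hX2 k).condExp one_le_two)) (fun i j hij => ?_) fun k => ?_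
  · refine integral_mul_sub_condExp_eq_zero (hG j) ?_ ((hX2 i).sub ((hX2 i).condExp one_le_two)) (hX2 j)
    exact ((hX i j hij).sub
      (stronglyMeasurable_condExp.mono (hGmono hij.le))).aestronglyMeasurable
  · exact (integral_sq_sub_condExp_le (hXm k) (h0 k) (h1 k)).trans (by linarith [ha k])

end MartingaleDifference

section ConditionalDensity

variable {Ω : Type*} {m m0 : MeasurableSpace Ω} {μ : Measure Ω} [IsProbabilityMeasure μ]
  {v : Ω → ℝ} {φ : Ω → ℝ → ℝ} {κ : Ω → ℝ} {ξ δ₀ : ℝ}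

theorem ae_abs_condExp_Ico_sub_le (hm : m ≤ m0)
    (hd : ∀ B : Set ℝ, MeasurableSet B →
      μ[fun ω => B.indicator (fun _ => (1 : ℝ)) (v ω) | m] =ᵐ[μ] fun ω => ∫ x in B, φ ω x)
    (hL : ∀ h ∈ Set.Ioc (0 : ℝ) δ₀, ∀ᵐ ω ∂μ,
      ∀ x ∈ Set.Icc (ξ - h) (ξ + h), |φ ω x - φ ω ξ| ≤ κ ω * h)
    {h : ℝ} (hh : h ∈ Set.Ioc (0 : ℝ) δ₀) :
    ∀ᵐ ω ∂μ, |(μ[fun ω => (Set.Ico ξ (ξ + h)).indicator (fun _ => (1 : ℝ)) (v ω) | m]) ω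
      - h * φ ω ξ| ≤ h ^ 2 * κ ω := by
  have huniv := hd Set.univ MeasurableSet.univ
  simp only [Set.indicator_univ, condExp_const hm, Measure.restrict_univ] at huniv
  filter_upwards [huniv, hL h hh, hd (Set.Ico ξ (ξ + h)) measurableSet_Ico] with ω h1 h2 h3
  have hint : Integrable (φ ω) := by
    by_contra hcon
    rw [integral_undef hcon] at h1
    exact one_ne_zero h1
  have hvol : volume.real (Set.Ico ξ (ξ + h)) = h := by simp [hh.1.le]
  have hconst : h * φ ω ξ = ∫ _ in Set.Ico ξ (ξ + h), φ ω ξ := by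
    rw [setIntegral_const, hvol, smul_eq_mul]
  rw [h3, hconst, ← integral_sub hint.integrableOn (by simp)]
  have hb := norm_setIntegral_le_of_norm_le_const (μ := volume) (s := Set.Ico ξ (ξ + h))
    (f := fun x => φ ω x - φ ω ξ) (C := κ ω * h) (by simp) fun x hx =>
      h2 x ⟨by linarith [hx.1, hh.1], hx.2.le⟩
  rw [hvol, Real.norm_eq_abs] at hb
  linarith

theorem integrable_condDensity (hm : m ≤ m0) (hδ₀ : 0 < δ₀)
    (hd : ∀ B : Set ℝ, MeasurableSet B →
      μ[fun ω => B.indicator (fun _ => (1 : ℝ)) (v ω) | m] =ᵐ[μ] fun ω => ∫ x in B, φ ω x)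
    (hL : ∀ h ∈ Set.Ioc (0 : ℝ) δ₀, ∀ᵐ ω ∂μ,
      ∀ x ∈ Set.Icc (ξ - h) (ξ + h), |φ ω x - φ ω ξ| ≤ κ ω * h)
    (hκ : Integrable κ μ) : Integrable (fun ω => φ ω ξ) μ := by
  set p : ℝ → Ω → ℝ :=
    fun h => μ[fun ω => (Set.Ico ξ (ξ + h)).indicator (fun _ => (1 : ℝ)) (v ω) | m] with hp
  have hpi : ∀ h, Integrable (p h) μ := fun h => integrable_condExp
  have hbound : ∀ h ∈ Set.Ioc (0 : ℝ) δ₀,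
      ∀ᵐ ω ∂μ, |h⁻¹ * p h ω - φ ω ξ| ≤ h * κ ω := by
    intro h hh
    filter_upwards [ae_abs_condExp_Ico_sub_le hm hd hL hh] with ω hω
    have hpos := hh.1
    have : h⁻¹ * p h ω - φ ω ξ = h⁻¹ * (p h ω - h * φ ω ξ) := by field_simp
    rw [this, abs_mul, abs_of_pos (inv_pos.2 hpos), inv_mul_le_iff₀ hpos]
    linarith
  set w : ℕ → ℝ := fun n => δ₀ / (n + 1) with hw
  have hwmem : ∀ n, w n ∈ Set.Ioc (0 : ℝ) δ₀ := fun n =>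
    ⟨by positivity, div_le_self hδ₀.le (by linarith [n.cast_nonneg (α := ℝ)])⟩
  have hw0 : Tendsto w atTop (𝓝 0) := by
    simpa [hw, div_eq_mul_inv] using
      (tendsto_one_div_add_atTop_nhds_zero_nat (𝕜 := ℝ)).const_mul δ₀
  have hmeas : AEStronglyMeasurable (fun ω => φ ω ξ) μ := by
    refine aestronglyMeasurable_of_tendsto_ae atTop
      (f := fun n ω => (w n)⁻¹ * p (w n) ω) (fun n => (hpi _).1.const_mul _) ?_
    filter_upwards [ae_all_iff.2 fun n => hbound (w n) (hwmem n)] with ω hω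
    rw [tendsto_iff_norm_sub_tendsto_zero]
    exact squeeze_zero (fun _ => norm_nonneg _) hω (by simpa using hw0.mul_const (κ ω))
  refine Integrable.mono' (((hpi δ₀).abs.const_mul δ₀⁻¹).add (hκ.const_mul δ₀)) hmeas ?_
  filter_upwards [hbound δ₀ ⟨hδ₀, le_rfl⟩] with ω hω
  have h1 := abs_sub_abs_le_abs_sub (φ ω ξ) (δ₀⁻¹ * p δ₀ ω)
  rw [abs_sub_comm] at h1
  rw [abs_mul, abs_of_pos (inv_pos.2 hδ₀)] at h1
  simp only [Real.norm_eq_abs, Pi.add_apply]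
  linarith

theorem integral_Ico_indicator_le (hm : m ≤ m0)
    (hd : ∀ B : Set ℝ, MeasurableSet B →
      μ[fun ω => B.indicator (fun _ => (1 : ℝ)) (v ω) | m] =ᵐ[μ] fun ω => ∫ x in B, φ ω x)
    (hL : ∀ h ∈ Set.Ioc (0 : ℝ) δ₀, ∀ᵐ ω ∂μ,
      ∀ x ∈ Set.Icc (ξ - h) (ξ + h), |φ ω x - φ ω ξ| ≤ κ ω * h)
    (hκ : Integrable κ μ) {h : ℝ} (hh : h ∈ Set.Ioc (0 : ℝ) δ₀) :
    ∫ ω, (Set.Ico ξ (ξ + h)).indicator (fun _ => (1 : ℝ)) (v ω) ∂μ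
      ≤ h * ∫ ω, φ ω ξ ∂μ + h ^ 2 * ∫ ω, κ ω ∂μ := by
  have hφ := integrable_condDensity hm (hh.1.trans_le hh.2) hd hL hκ
  rw [← integral_condExp hm, ← integral_const_mul, ← integral_const_mul,
    ← integral_add (hφ.const_mul _) (hκ.const_mul _)]
  refine integral_mono_ae integrable_condExp ((hφ.const_mul _).add (hκ.const_mul _)) ?_
  filter_upwards [ae_abs_condExp_Ico_sub_le hm hd hL hh] with ω hω
  linarith [(abs_le.1 hω).2]

end ConditionalDensity

theorem eLpNorm_const_mul_eq {Ω : Type*} [MeasurableSpace Ω] {μ : Measure Ω} (a : ℝ)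
    (g : Ω → ℝ) (p : ℝ≥0∞) : eLpNorm (fun ω => a * g ω) p μ = ‖a‖ₑ * eLpNorm g p μ :=
  eLpNorm_const_smul a g p μ

/-- The `σ`-algebra generated by `u s` for `s ≤ t`. -/
def sigmaUpTo {Ω : Type*} (u : ℤ → Ω → ℝ) (t : ℤ) : MeasurableSpace Ω :=
  ⨆ (s : ℤ) (_ : s ≤ t), MeasurableSpace.comap (u s) inferInstance

theorem sigmaUpTo_le {Ω : Type*} [m0 : MeasurableSpace Ω] {u : ℤ → Ω → ℝ}
    (hu : ∀ t, Measurable (u t)) (t : ℤ) : sigmaUpTo u t ≤ m0 :=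
  iSup₂_le fun s _ => (hu s).comap_le

theorem sigmaUpTo_mono {Ω : Type*} (u : ℤ → Ω → ℝ) : Monotone (sigmaUpTo u) :=
  fun _ _ hab => biSup_mono fun _ hs => hs.trans hab

theorem measurable_sigmaUpTo {Ω : Type*} (u : ℤ → Ω → ℝ) {s t : ℤ} (hst : s ≤ t) :
    Measurable[sigmaUpTo u t] (u s) :=
  (comap_measurable (u s)).mono (le_iSup₂_of_le (f := fun (s : ℤ) (_ : s ≤ t) =>
    MeasurableSpace.comap (u s) inferInstance) s hst le_rfl) le_rfl

theorem integrable_Ico_indicator {Ω : Type*} [MeasurableSpace Ω] {μ : Measure Ω}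
    [IsFiniteMeasure μ] {v : Ω → ℝ} (hv : Measurable v) (a b : ℝ) :
    Integrable (fun ω => (Set.Ico a b).indicator (fun _ => (1 : ℝ)) (v ω)) μ := by
  have hm : Measurable fun ω => (Set.Ico a b).indicator (fun _ => (1 : ℝ)) (v ω) :=
    (measurable_const.indicator measurableSet_Ico).comp hv
  refine Integrable.of_bound hm.aestronglyMeasurable 1 (ae_of_all _ fun ω => ?_)
  simp only [Set.indicator_apply]
  split_ifs <;> simp

theorem iterate_shift_eq {Ω α : Type*} {T : Ω → Ω} {g : ℤ → Ω → α}
    (hg : ∀ t ω, g (t + 1) ω = g t (T ω)) (t : ℤ) (k : ℕ) (ω : Ω) :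
    g (t + k) ω = g t (T^[k] ω) := by
  induction k generalizing ω with
  | zero => simp
  | succ k ih =>
    rw [Function.iterate_succ_apply, ← ih, ← hg]
    push_cast
    ring_nf

/-- Intermediate step in the proof of the paper's main theorem: for a strictly stationary
ergodic sequence `(u_t)` (shift representation through an ergodic measure-preserving `T`)
whose conditional distribution given `F_{t-1}` admits a density `f_{t-1}`, integrable
locally uniformly around `ξ` and locally Lipschitz at `ξ` with stationary ergodic integrable
constants `K_{t-1}`, one has
`n^{-1/2} ∑_{t=1}^n 𝟙_{ξ ≤ u_t < ξ + z/√n} → z E[f₀(ξ)]` in probability (here `f t`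
denotes the conditional density of `u_t` given `F_{t-1}`, so the paper's `f₀` is `f 1`). -/
theorem stmt15 {Ω : Type*} [m0 : MeasureSpace Ω] [IsProbabilityMeasure (ℙ : Measure Ω)]
    (T : Ω → Ω) (hT : MeasurePreserving T ℙ ℙ) (hTerg : Ergodic T ℙ)
    (u : ℤ → Ω → ℝ) (hu : ∀ t, Measurable (u t))
    (hshift_u : ∀ t ω, u (t + 1) ω = u t (T ω))
    -- conditional density of u_t given F_{t-1} = σ(u_s, s ≤ t-1):
    (f : ℤ → Ω → ℝ → ℝ)
    (hshift_f : ∀ t ω x, f (t + 1) ω x = f t (T ω) x)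
    (hdens : ∀ (t : ℤ) (B : Set ℝ), MeasurableSet B →
      (ℙ[(fun ω => B.indicator (fun _ => (1 : ℝ)) (u t ω)) | ⨆ (s : ℤ) (_ : s ≤ t - 1),
          MeasurableSpace.comap (u s) inferInstance]
        =ᵐ[ℙ] fun ω => ∫ x in B, f t ω x))
    (ξ δ : ℝ) (hδ : 0 < δ)
    -- E[sup_{x ∈ [ξ-δ, ξ+δ]} f_{t-1}(x)] < ∞ :
    (hsup_bdd : ∀ᵐ ω ∂ℙ, BddAbove ((fun x => f 1 ω x) '' Set.Icc (ξ - δ) (ξ + δ)))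
    (hsup_int : Integrable (fun ω => ⨆ x ∈ Set.Icc (ξ - δ) (ξ + δ), f 1 ω x) ℙ)
    -- local Lipschitz behaviour of the conditional density around ξ :
    (K : ℤ → Ω → ℝ) (hKmeas : ∀ t, Measurable (K t))
    (hshift_K : ∀ t ω, K (t + 1) ω = K t (T ω))
    (hKadapt : ∀ t : ℤ, Measurable[⨆ (s : ℤ) (_ : s ≤ t),
        MeasurableSpace.comap (u s) inferInstance] (K t))
    (hKint : Integrable (K 0) ℙ)
    (hLip : ∃ δ₀ : ℝ, 0 < δ₀ ∧ ∀ δ' ∈ Set.Ioc (0 : ℝ) δ₀, ∀ t : ℤ, ∀ᵐ ω ∂ℙ,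
      ∀ x ∈ Set.Icc (ξ - δ') (ξ + δ'), |f t ω x - f t ω ξ| ≤ K (t - 1) ω * δ')
    (z : ℝ) (hz : 0 < z) :
    -- convergence in probability:
    ∀ δp : ℝ, 0 < δp →
      Tendsto (fun n : ℕ => ℙ {ω | δp ≤
          |(Real.sqrt n)⁻¹ * (∑ t ∈ Finset.Icc (1 : ℤ) (n : ℤ),
              (if ξ ≤ u t ω ∧ u t ω < ξ + z / Real.sqrt n then (1 : ℝ) else 0)) -
            z * ∫ ω', f 1 ω' ξ ∂ℙ|})
        atTop (nhds 0) := by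
  replace hdens : ∀ (t : ℤ) (B : Set ℝ), MeasurableSet B →
      (ℙ[(fun ω => B.indicator (fun _ => (1 : ℝ)) (u t ω)) | sigmaUpTo u (t - 1)]
        =ᵐ[ℙ] fun ω => ∫ x in B, f t ω x) := hdens
  obtain ⟨δ₀, hδ₀, hL⟩ := hLip
  set c := ∫ ω', f 1 ω' ξ ∂ℙ
  set φ : Ω → ℝ := fun ω => f 1 ω ξ with hφ
  set X : ℝ → ℕ → Ω → ℝ := fun h k ω =>
    (Set.Ico ξ (ξ + h)).indicator (fun _ => (1 : ℝ)) (u (1 + k) ω) with hX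
  have hXmeas : ∀ (h : ℝ) (i : ℕ) (t : ℤ), (1 + i : ℤ) ≤ t → StronglyMeasurable[sigmaUpTo u t] (X h i) :=
    fun h i t hit => ((measurable_const.indicator measurableSet_Ico).comp
      (measurable_sigmaUpTo u hit)).stronglyMeasurable
  have hXi : ∀ (h : ℝ) (k : ℕ), Integrable (X h k) ℙ := fun h k =>
    integrable_Ico_indicator (hu _) ξ (ξ + h)
  have hKk : ∀ k : ℕ, Integrable (K k) ℙ := by
    intro k
    have h1 : K k = K 0 ∘ T^[k] := by
      ext ω
      simpa using iterate_shift_eq hshift_K 0 k ω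
    rw [h1]
    exact (hT.iterate k).integrable_comp_of_integrable hKint
  have hLk : ∀ k : ℕ, ∀ h ∈ Set.Ioc (0 : ℝ) δ₀, ∀ᵐ ω ∂ℙ, ∀ x ∈ Set.Icc (ξ - h) (ξ + h),
      |f (1 + k) ω x - f (1 + k) ω ξ| ≤ K k ω * h := by
    intro k h hh
    simpa using hL h hh (1 + k)
  have hφint : Integrable φ ℙ := by
    simpa [hφ] using integrable_condDensity (sigmaUpTo_le hu _) hδ₀ (hdens (1 + (0 : ℕ))) (hLk 0) (hKk 0)
  have hXint : ∀ h ∈ Set.Ioc (0 : ℝ) δ₀, ∀ k,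
      ∫ ω, X h k ω ∂ℙ ≤ h * c + h ^ 2 * ∫ ω, K 0 ω ∂ℙ := by
    intro h hh k
    have h0 := integral_Ico_indicator_le (sigmaUpTo_le hu _) (hdens (1 + (0 : ℕ))) (hLk 0) (hKk 0) hh
    simp only [Nat.cast_zero, add_zero] at h0
    refine le_trans (le_of_eq ?_) h0
    have hk := hT.iterate k
    conv_rhs => rw [← hk.map_eq]
    have hm : Measurable fun ω => (Set.Ico ξ (ξ + h)).indicator (fun _ => (1 : ℝ)) (u 1 ω) :=
      (measurable_const.indicator measurableSet_Ico).comp (hu 1)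
    rw [integral_map hk.measurable.aemeasurable hm.aestronglyMeasurable]
    simp only [hX, iterate_shift_eq hshift_u 1 k]
  set h : ℕ → ℝ := fun n => z / √n with hh
  set D : ℕ → ℕ → Ω → ℝ := fun n k ω => X (h n) k ω - (ℙ[X (h n) k | sigmaUpTo u (1 + k - 1)]) ω with hD
  set R : ℕ → ℕ → Ω → ℝ := fun n k ω =>
    (ℙ[X (h n) k | sigmaUpTo u (1 + k - 1)]) ω - h n * f (1 + k) ω ξ with hR
  set Y : ℕ → Ω → ℝ := fun n ω => (√n)⁻¹ * ∑ t ∈ Finset.Icc (1 : ℤ) (n : ℤ),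
    (if ξ ≤ u t ω ∧ u t ω < ξ + z / √n then (1 : ℝ) else 0) with hY
  have hYX : ∀ n ω, Y n ω = (√n)⁻¹ * ∑ k ∈ Finset.range n, X (h n) k ω := by
    intro n ω
    simp only [hY, hX]
    congr 1
    symm
    refine Finset.sum_bij (fun k _ => (1 + k : ℤ)) ?_ ?_ ?_ ?_
    · intro k hk
      simp only [Finset.mem_range, Finset.mem_Icc] at hk ⊢
      omega
    · intro a _ b _ hab
      omega
    · intro t ht
      simp only [Finset.mem_Icc] at ht
      exact ⟨(t - 1).toNat, by simp only [Finset.mem_range]; omega, by omega⟩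
    · intro k _
      simp [Set.indicator_apply, hh]
  have hsqrt : Tendsto (fun n : ℕ => √(n : ℝ)) atTop atTop :=
    Real.tendsto_sqrt_atTop.comp tendsto_natCast_atTop_atTop
  have hh0 : Tendsto h atTop (nhds 0) := hsqrt.const_div_atTop z
  have hhmem : ∀ᶠ n in atTop, n ≠ 0 ∧ h n ∈ Set.Ioc (0 : ℝ) δ₀ := by
    filter_upwards [eventually_gt_atTop 0, hh0.eventually (eventually_le_nhds hδ₀)] with n hn hle
    exact ⟨hn.ne', by positivity, hle⟩
  have hdecomp : ∀ n ≠ 0, (fun ω => Y n ω - z * c) =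
      (fun ω => (√n)⁻¹ * ∑ k ∈ Finset.range n, D n k ω) +
      (fun ω => (√n)⁻¹ * ∑ k ∈ Finset.range n, R n k ω) +
      (fun ω => z * ((n : ℝ)⁻¹ * ∑ k ∈ Finset.range n, φ (T^[k] ω) - c)) := by
    intro n hn
    ext ω
    simp only [Pi.add_apply, hYX, hD, hR, Finset.sum_sub_distrib, ← Finset.mul_sum, hφ,
      ← iterate_shift_eq (g := fun t ω => f t ω ξ) (fun t ω => hshift_f t ω ξ)]
    have hs : √(n : ℝ) ≠ 0 := by positivity
    have hinv : (n : ℝ)⁻¹ = (√n)⁻¹ * (√n)⁻¹ := by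
      rw [← mul_inv, Real.mul_self_sqrt n.cast_nonneg]
    rw [hinv, hh]
    ring
  have hDm : ∀ n k, Integrable (D n k) ℙ := fun n k => (hXi (h n) k).sub integrable_condExp
  have hfk : ∀ k : ℕ, Integrable (fun ω => f (1 + k) ω ξ) ℙ := fun k =>
    integrable_condDensity (sigmaUpTo_le hu _) hδ₀ (hdens (1 + k)) (hLk k) (hKk k)
  have hRm : ∀ n k, Integrable (R n k) ℙ := fun n k =>
    integrable_condExp.sub ((hfk k).const_mul _)
  have hDsum : ∀ n, n ≠ 0 → h n ∈ Set.Ioc (0 : ℝ) δ₀ →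
      eLpNorm (fun ω => (√n)⁻¹ * ∑ k ∈ Finset.range n, D n k ω) 1 ℙ ≤
      ENNReal.ofReal (√(4 * (h n * c + h n ^ 2 * ∫ ω, K 0 ω ∂ℙ))) := by
    intro n hn hmem
    have hmeas : AEStronglyMeasurable (fun ω => ∑ k ∈ Finset.range n, D n k ω) ℙ :=
      (integrable_finsetSum _ fun k _ => hDm n k).1
    have hb := eLpNorm_two_sum_sub_condExp_le (μ := ℙ) (G := fun k : ℕ => sigmaUpTo u (1 + k - 1))
      (X := X (h n)) (fun k => sigmaUpTo_le hu _) (fun a b hab => sigmaUpTo_mono u (by simpa using hab))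
      (fun i j hij => hXmeas (h n) i (1 + j - 1) (by omega))
      (fun k ω => Set.indicator_nonneg (fun _ _ => zero_le_one) _)
      (fun k ω => Set.indicator_le_self' (f := fun _ => (1 : ℝ)) (fun _ _ => zero_le_one) _)
      (hXint (h n) hmem) n
    have hs : (0 : ℝ) < √n := by positivity
    calc _ ≤ eLpNorm (fun ω => (√n)⁻¹ * ∑ k ∈ Finset.range n, D n k ω) 2 ℙ :=
          eLpNorm_le_eLpNorm_of_exponent_le (by norm_num) (hmeas.const_mul _)
      _ = ‖(√(n : ℝ))⁻¹‖ₑ * eLpNorm (fun ω => ∑ k ∈ Finset.range n, D n k ω) 2 ℙ :=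
          eLpNorm_const_mul_eq _ _ _
      _ ≤ ‖(√(n : ℝ))⁻¹‖ₑ *
          ENNReal.ofReal (√(n * (4 * (h n * c + h n ^ 2 * ∫ ω, K 0 ω ∂ℙ)))) :=
          mul_le_mul_right hb _
      _ = _ := by
          rw [Real.enorm_of_nonneg (by positivity), ← ENNReal.ofReal_mul (by positivity),
            Real.sqrt_mul n.cast_nonneg, inv_mul_cancel_left₀ hs.ne']
  have hRsum : ∀ n, n ≠ 0 → h n ∈ Set.Ioc (0 : ℝ) δ₀ →
      eLpNorm (fun ω => (√n)⁻¹ * ∑ k ∈ Finset.range n, R n k ω) 1 ℙ ≤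
      ENNReal.ofReal (z * h n) * eLpNorm (K 0) 1 ℙ := by
    intro n hn hmem
    have hs : (0 : ℝ) < √n := by positivity
    have hone : ∀ k, eLpNorm (R n k) 1 ℙ ≤ ENNReal.ofReal (h n ^ 2) * eLpNorm (K 0) 1 ℙ := by
      intro k
      have hKe : eLpNorm (K k) 1 ℙ = eLpNorm (K 0) 1 ℙ := by
        rw [← eLpNorm_comp_measurePreserving hKint.1 (hT.iterate k)]
        congr 1
        ext ω
        simpa using iterate_shift_eq hshift_K 0 k ω
      calc eLpNorm (R n k) 1 ℙ ≤ eLpNorm (fun ω => h n ^ 2 * K k ω) 1 ℙ := by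
            refine eLpNorm_mono_ae ?_
            filter_upwards [ae_abs_condExp_Ico_sub_le (sigmaUpTo_le hu _) (hdens (1 + k)) (hLk k) hmem]
              with ω hω
            exact hω.trans (le_abs_self _)
        _ = _ := by
            rw [eLpNorm_const_mul_eq, Real.enorm_of_nonneg (by positivity), hKe]
    calc _ = ‖(√(n : ℝ))⁻¹‖ₑ * eLpNorm (∑ k ∈ Finset.range n, R n k) 1 ℙ := by
          rw [← eLpNorm_const_mul_eq]
          simp only [Finset.sum_apply]
      _ ≤ ‖(√(n : ℝ))⁻¹‖ₑ * ∑ k ∈ Finset.range n, eLpNorm (R n k) 1 ℙ := by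
          gcongr
          exact eLpNorm_sum_le (fun k _ => (hRm n k).1) le_rfl
      _ ≤ ‖(√(n : ℝ))⁻¹‖ₑ *
          ∑ k ∈ Finset.range n, ENNReal.ofReal (h n ^ 2) * eLpNorm (K 0) 1 ℙ := by
          gcongr
          exact hone _
      _ = _ := by
          rw [Finset.sum_const, Finset.card_range, nsmul_eq_mul,
            Real.enorm_of_nonneg (by positivity), ← ENNReal.ofReal_natCast, ← mul_assoc,
            ← mul_assoc, ← ENNReal.ofReal_mul (by positivity),
            ← ENNReal.ofReal_mul (by positivity)]
          congr 2
          have hz' : h n * √n = z := div_mul_cancel₀ z hs.ne'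
          calc (√(n : ℝ))⁻¹ * n * h n ^ 2 = (√(n : ℝ))⁻¹ * (√n * √n) * h n ^ 2 := by
                rw [Real.mul_self_sqrt n.cast_nonneg]
            _ = h n * √n * h n := by field_simp
            _ = z * h n := by rw [hz']
  have hav := hTerg.tendsto_eLpNorm_one_average hφint
  have hlim : Tendsto (fun n => eLpNorm (Y n - fun _ => z * c) 1 ℙ) atTop (nhds 0) := by
    have hub : Tendsto (fun n : ℕ =>
        ENNReal.ofReal (√(4 * (h n * c + h n ^ 2 * ∫ ω, K 0 ω ∂ℙ))) +
        ENNReal.ofReal (z * h n) * eLpNorm (K 0) 1 ℙ +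
        ‖z‖ₑ * eLpNorm (fun ω => (n : ℝ)⁻¹ * ∑ k ∈ Finset.range n, φ (T^[k] ω)
          - ∫ ω', φ ω' ∂ℙ) 1 ℙ) atTop (nhds 0) := by
      have e1 : Tendsto (fun n : ℕ =>
          ENNReal.ofReal (√(4 * (h n * c + h n ^ 2 * ∫ ω, K 0 ω ∂ℙ)))) atTop (nhds 0) := by
        have : Continuous fun x : ℝ =>
          ENNReal.ofReal (√(4 * (x * c + x ^ 2 * ∫ ω, K 0 ω ∂ℙ))) :=
            ENNReal.continuous_ofReal.comp (by fun_prop)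
        simpa [Function.comp_def] using (this.tendsto 0).comp hh0
      have e2 : Tendsto (fun n : ℕ => ENNReal.ofReal (z * h n) * eLpNorm (K 0) 1 ℙ)
          atTop (nhds 0) := by
        have := ENNReal.Tendsto.mul_const (b := eLpNorm (K 0) 1 ℙ)
          (ENNReal.tendsto_ofReal (hh0.const_mul z))
          (Or.inr (memLp_one_iff_integrable.2 hKint).eLpNorm_ne_top)
        simpa using this
      have e3 := ENNReal.Tendsto.const_mul (a := ‖z‖ₑ) hav (Or.inr enorm_ne_top)
      simpa using (e1.add e2).add e3
    refine tendsto_of_tendsto_of_tendsto_of_le_of_le' tendsto_const_nhds hub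
      (Eventually.of_forall fun _ => zero_le) ?_
    filter_upwards [hhmem] with n hn
    have m1 : AEStronglyMeasurable (fun ω => (√n)⁻¹ * ∑ k ∈ Finset.range n, D n k ω) ℙ :=
      (integrable_finsetSum _ fun k _ => hDm n k).1.const_mul _
    have m2 : AEStronglyMeasurable (fun ω => (√n)⁻¹ * ∑ k ∈ Finset.range n, R n k ω) ℙ :=
      (integrable_finsetSum _ fun k _ => hRm n k).1.const_mul _
    have m3 : AEStronglyMeasurable
        (fun ω => z * ((n : ℝ)⁻¹ * ∑ k ∈ Finset.range n, φ (T^[k] ω) - c)) ℙ :=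
      ((aestronglyMeasurable_average hT hφint.1 n).sub aestronglyMeasurable_const).const_mul _
    change eLpNorm (fun ω => Y n ω - z * c) 1 ℙ ≤ _
    rw [hdecomp n hn.1]
    have a1 := eLpNorm_add_le m1 m2 le_rfl
    have a2 := eLpNorm_add_le (m1.add m2) m3 le_rfl
    rw [eLpNorm_const_mul_eq z] at a2
    exact a2.trans (add_le_add_left
      (a1.trans (add_le_add (hDsum n hn.1 hn.2) (hRsum n hn.1 hn.2))) _)
  have hYm : ∀ n, AEStronglyMeasurable (Y n) ℙ := by
    intro n
    have : Y n = fun ω => (√n)⁻¹ * ∑ k ∈ Finset.range n, X (h n) k ω := funext (hYX n)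
    rw [this]
    exact (Finset.aestronglyMeasurable_fun_sum _ fun k _ =>
      (hXi (h n) k).1).const_mul _
  have hmain : TendstoInMeasure ℙ Y atTop fun _ => z * c :=
    tendstoInMeasure_of_tendsto_eLpNorm one_ne_zero hYm aestronglyMeasurable_const hlim
  rw [tendstoInMeasure_iff_norm] at hmain
  simpa only [Real.norm_eq_abs] using hmain
end

section
/- Let (u_t, D_t)_{t∈ℤ} be a strictly stationary and ergodic sequence, where u_t is real-valued, D_t is ℝ^d-valued and F_{t−1}-measurable for the filtration F_t = σ((u_s, D_{s+1}), s ≤ t), and the conditional distribution of u_t given F_{t−1} admits a density f_{t−1} (P(u_t ∈ B | F_{t−1}) = ∫_B f_{t−1}(x)dx a.s. for Borel B). Fix ξ ∈ ℝ and δ > 0, and assume E‖D_t‖⁸ < ∞, E[sup_{x ∈ [ξ−δ, ξ+δ]} f_{t−1}⁴(x)] < ∞, and sup_{x ∈ [ξ−δ', ξ+δ']} |f_{t−1}(x) − f_{t−1}(ξ)| ≤ K_{t−1}·δ' for all sufficiently small δ' > 0 with (K_t) stationary ergodic adapted and E K_t⁴ < ∞. Then for every z > 0, n^{−1/2} Σ_{t=1}^n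 u_t · 𝟙_{ξ ≤ u_t < ξ + z/√n} · D_t → z · ξ · E[f_0(ξ) D_1] in probability as n → ∞. -/
open MeasureTheory ProbabilityTheory Filter

theorem Ergodic.tendsto_integral_abs_average_sub {Ω : Type*} {m0 : MeasurableSpace Ω}
    {μ : Measure Ω} [IsProbabilityMeasure μ] {T : Ω → Ω} (hT : Ergodic T μ) {g : Ω → ℝ}
    (hg : MemLp g 2 μ) :
    Tendsto (fun n : ℕ => ∫ ω, |(n : ℝ)⁻¹ * (∑ k ∈ Finset.range n, g (T^[k] ω)) - ∫ ω', g ω' ∂μ| ∂μ)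
      atTop (nhds 0) := by
  have hmp := hT.toMeasurePreserving
  let L := Lp.compMeasurePreservingₗᵢ ℝ (E := ℝ) (p := 2) T hmp
  let V : Lp ℝ 2 μ →L[ℝ] Lp ℝ 2 μ := L.toContinuousLinearMap
  have hV : ‖V‖ ≤ 1 := L.norm_toContinuousLinearMap_le
  let x := hg.toLp g
  set P := ((V.eqLocus (1 : Lp ℝ 2 μ →L[ℝ] Lp ℝ 2 μ)).orthogonalProjectionOnto x) with hP
  have key := V.tendsto_birkhoffAverage_orthogonalProjection hV x
  have hVx : ∀ y : Lp ℝ 2 μ, V y = Lp.compMeasurePreserving T hmp y := fun y => rfl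
  obtain ⟨c, hc⟩ : ∃ c, (P : Lp ℝ 2 μ) =ᵐ[μ] Function.const Ω c := by
    apply hT.ae_eq_const_of_ae_eq_comp_ae (Lp.aestronglyMeasurable _)
    have h1 : V P = P := P.2
    have h2 := Lp.coeFn_compMeasurePreserving (P : Lp ℝ 2 μ) hmp
    rw [← hVx, h1] at h2
    exact h2.symm
  have hone : MemLp (fun _ : Ω => (1 : ℝ)) 2 μ := memLp_const _
  have hcg : c = ∫ ω, g ω ∂μ := by
    have hmem : hone.toLp _ ∈ V.eqLocus (1 : Lp ℝ 2 μ →L[ℝ] Lp ℝ 2 μ) := by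
      change V (hone.toLp _) = hone.toLp _
      rw [hVx, Lp.toLp_compMeasurePreserving]
      rfl
    have horth := (V.eqLocus (1 : Lp ℝ 2 μ →L[ℝ] Lp ℝ 2 μ)).sub_starProjection_mem_orthogonal x
    have h0 := (Submodule.mem_orthogonal _ _).1 horth _ hmem
    change inner ℝ _ (x - (P : Lp ℝ 2 μ)) = 0 at h0
    rw [L2.inner_def] at h0
    have h3 : ∫ ω, (g ω - c) ∂μ = 0 := by
      rw [← h0]
      apply integral_congr_ae
      filter_upwards [hone.coeFn_toLp, Lp.coeFn_sub x (P : Lp ℝ 2 μ), hc, hg.coeFn_toLp] with ω h1 h2 h3 h4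
      simp only [h1, h2, Pi.sub_apply, h3, x, h4, Function.const]
      simp
    rw [integral_sub (hg.integrable one_le_two) (integrable_const _)] at h3
    simp at h3
    linarith
  have hiter : ∀ k : ℕ, (V^[k] x : Lp ℝ 2 μ) =ᵐ[μ] fun ω => g (T^[k] ω) := by
    intro k
    have : V^[k] x = Lp.compMeasurePreserving (T^[k]) (hmp.iterate k) x := by
      rw [← Lp.compMeasurePreserving_iterate]; rfl
    rw [this]
    refine (Lp.coeFn_compMeasurePreserving x (hmp.iterate k)).trans ?_
    exact (hmp.iterate k).quasiMeasurePreserving.ae_eq_comp hg.coeFn_toLp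
  have hsum : ∀ n : ℕ, (birkhoffAverage ℝ V _root_.id n x : Lp ℝ 2 μ) =ᵐ[μ]
      fun ω => (n : ℝ)⁻¹ * (∑ k ∈ Finset.range n, g (T^[k] ω)) := by
    intro n
    simp only [birkhoffAverage, birkhoffSum]
    have h2 : (↑(∑ k ∈ Finset.range n, V^[k] x : Lp ℝ 2 μ) : Ω → ℝ) =ᵐ[μ]
        fun ω => ∑ k ∈ Finset.range n, g (T^[k] ω) := by
      filter_upwards [Lp.coeFn_fun_finsetSum (Finset.range n) fun k => V^[k] x,
        ae_all_iff.2 hiter] with ω h1 h2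
      rw [h1]
      exact Finset.sum_congr rfl fun k _ => h2 k
    refine (Lp.coeFn_smul _ _).trans ?_
    filter_upwards [h2] with ω h
    rw [Pi.smul_apply, smul_eq_mul]
    congr 1
  rw [tendsto_iff_norm_sub_tendsto_zero] at key
  refine squeeze_zero (fun n => integral_nonneg fun ω => abs_nonneg _) (fun n => ?_) key
  set Z := birkhoffAverage ℝ V _root_.id n x - (P : Lp ℝ 2 μ) with hZ
  have hZe : (Z : Lp ℝ 2 μ) =ᵐ[μ] fun ω => (n : ℝ)⁻¹ * (∑ k ∈ Finset.range n, g (T^[k] ω)) - ∫ ω', g ω' ∂μ := by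
    filter_upwards [Lp.coeFn_sub (birkhoffAverage ℝ V _root_.id n x) (P : Lp ℝ 2 μ), hc, hsum n] with ω h1 h2 h3
    rw [hZ, h1, Pi.sub_apply, h2, h3, ← hcg]; rfl
  have hZ1 : ∫ ω, |Z ω| ∂μ ≤ ‖Z‖ := by
    rw [Lp.norm_def]
    have hm : AEStronglyMeasurable Z μ := Lp.aestronglyMeasurable _
    have := integral_norm_eq_lintegral_enorm hm
    simp only [Real.norm_eq_abs] at this
    rw [this, ← eLpNorm_one_eq_lintegral_enorm]
    exact ENNReal.toReal_mono (Lp.eLpNorm_ne_top _) (eLpNorm_le_eLpNorm_of_exponent_le one_le_two hm)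
  refine le_trans (le_of_eq (integral_congr_ae ?_)) hZ1
  filter_upwards [hZe] with ω h
  rw [h]

theorem integral_abs_sum_le_of_condExp_eq_zero {Ω : Type*} {m0 : MeasurableSpace Ω}
    {μ : Measure Ω} [IsProbabilityMeasure μ] {m : ℕ → MeasurableSpace Ω} (hm : ∀ k, m k ≤ m0)
    {X : ℕ → Ω → ℝ} (hX : ∀ k, MemLp (X k) 2 μ)
    (hadapt : ∀ j k, j < k → AEStronglyMeasurable[m k] (X j) μ)
    (hzero : ∀ k, μ[X k | m k] =ᵐ[μ] 0) {C : ℝ} (hC : ∀ k, ∫ ω, X k ω ^ 2 ∂μ ≤ C) (n : ℕ) :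
    ∫ ω, |∑ k ∈ Finset.range n, X k ω| ∂μ ≤ √(n * C) := by
  have hXmul : ∀ j k, Integrable (fun ω => X j ω * X k ω) μ := fun j k => (hX j).integrable_mul (hX k)
  have horth : ∀ j k, j < k → ∫ ω, X j ω * X k ω ∂μ = 0 := by
    intro j k hjk
    rw [← integral_condExp (hm k)]
    have h1 := condExp_mul_of_aestronglyMeasurable_left (μ := μ) (hadapt j k hjk) (hXmul j k)
      ((hX k).integrable one_le_two)
    rw [← integral_zero Ω ℝ (μ := μ)]
    apply integral_congr_ae
    filter_upwards [h1, hzero k] with ω h1 h2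
    refine h1.trans ?_
    simp [h2]
  have hS : MemLp (fun ω => ∑ k ∈ Finset.range n, X k ω) 2 μ := memLp_finsetSum _ fun k _ => hX k
  have hsq : ∫ ω, (∑ k ∈ Finset.range n, X k ω) ^ 2 ∂μ ≤ n * C := by
    clear hS
    induction n with
    | zero => simp
    | succ n ih =>
      have hSn : MemLp (fun ω => ∑ k ∈ Finset.range n, X k ω) 2 μ := memLp_finsetSum _ fun k _ => hX k
      have hcross : ∫ ω, ∑ k ∈ Finset.range n, X k ω * X n ω ∂μ = 0 := by
        rw [integral_finsetSum _ fun k _ => hXmul k n]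
        exact Finset.sum_eq_zero fun k hk => horth k n (Finset.mem_range.1 hk)
      have hci : Integrable (fun ω => ∑ k ∈ Finset.range n, X k ω * X n ω) μ :=
        integrable_finsetSum _ fun k _ => hXmul k n
      have : ∀ ω, (∑ k ∈ Finset.range (n + 1), X k ω) ^ 2 = (∑ k ∈ Finset.range n, X k ω) ^ 2
          + 2 * (∑ k ∈ Finset.range n, X k ω * X n ω) + X n ω ^ 2 := by
        intro ω
        rw [Finset.sum_range_succ, ← Finset.sum_mul]; ring
      simp only [this]
      have h1 : Integrable (fun ω => (∑ k ∈ Finset.range n, X k ω) ^ 2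
          + 2 * (∑ k ∈ Finset.range n, X k ω * X n ω)) μ :=
        hSn.integrable_sq.add (hci.const_mul 2)
      rw [integral_add h1 (hX n).integrable_sq,
        integral_add hSn.integrable_sq (hci.const_mul 2), integral_const_mul, hcross]
      have := hC n
      push_cast
      linarith
  apply Real.le_sqrt_of_sq_le
  have hv := variance_nonneg (fun ω => |∑ k ∈ Finset.range n, X k ω|) μ
  rw [variance_eq_sub (show MemLp (fun ω => |∑ k ∈ Finset.range n, X k ω|) 2 μ from hS.abs)] at hv
  simp only [Pi.pow_apply, sq_abs] at hv
  linarith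

theorem condExp_sub_condExp_mul {Ω : Type*} {m m0 : MeasurableSpace Ω}
    {μ : Measure Ω} [IsProbabilityMeasure μ] (hm : m ≤ m0)
    {J Y : Ω → ℝ} (hJ : Measurable J) (hJ0 : ∀ ω, 0 ≤ J ω) (hJ1 : ∀ ω, J ω ≤ 1)
    (hY : StronglyMeasurable[m] Y) (hY2 : MemLp Y 2 μ) :
    MemLp (fun ω => (J ω - (μ[J | m]) ω) * Y ω) 2 μ ∧
    μ[fun ω => (J ω - (μ[J | m]) ω) * Y ω | m] =ᵐ[μ] 0 ∧
    ∫ ω, ((J ω - (μ[J | m]) ω) * Y ω) ^ 2 ∂μ ≤ 2 * ∫ ω, J ω * Y ω ^ 2 ∂μ := by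
  have hJi : Integrable J μ := Integrable.of_bound hJ.aestronglyMeasurable 1
    (Eventually.of_forall fun ω => by rw [Real.norm_eq_abs, abs_le]; constructor <;> linarith [hJ0 ω, hJ1 ω])
  have hp0 : 0 ≤ᵐ[μ] μ[J | m] := condExp_nonneg (Eventually.of_forall hJ0)
  have hp1 : μ[J | m] ≤ᵐ[μ] fun _ => 1 := by
    have := condExp_mono (m := m) hJi (integrable_const (1 : ℝ)) (Eventually.of_forall hJ1)
    rwa [condExp_const hm] at this
  have hpm : AEStronglyMeasurable (μ[J | m]) μ := integrable_condExp.aestronglyMeasurable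
  have hYi : Integrable Y μ := hY2.integrable one_le_two
  have hbd : ∀ᵐ ω ∂μ, |J ω - (μ[J | m]) ω| ≤ 1 := by
    filter_upwards [hp0, hp1] with ω h0 h1
    simp only [Pi.zero_apply] at h0
    rw [abs_le]; constructor <;> linarith [hJ0 ω, hJ1 ω]
  have hXm : AEStronglyMeasurable (fun ω => (J ω - (μ[J | m]) ω) * Y ω) μ :=
    (hJ.aestronglyMeasurable.sub hpm).mul hY2.1
  have hX2 : MemLp (fun ω => (J ω - (μ[J | m]) ω) * Y ω) 2 μ := by
    refine hY2.mono hXm ?_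
    filter_upwards [hbd] with ω h
    rw [norm_mul]
    exact mul_le_of_le_one_left (norm_nonneg _) h
  refine ⟨hX2, ?_, ?_⟩
  · have h1 := condExp_mul_of_stronglyMeasurable_right (μ := μ) (f := J - μ[J | m]) hY
      (hX2.integrable one_le_two) (hJi.sub integrable_condExp)
    have h2 := condExp_sub hJi (integrable_condExp (f := J) (m := m) (μ := μ)) m
    have h3 := condExp_of_stronglyMeasurable hm (stronglyMeasurable_condExp (f := J) (m := m) (μ := μ)) integrable_condExp
    filter_upwards [h1, h2] with ω h1 h2
    refine h1.trans ?_
    rw [Pi.mul_apply, h2, h3]; simp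
  · have hY2i : Integrable (fun ω => Y ω ^ 2) μ := hY2.integrable_sq
    have hJY : Integrable (J * fun ω => Y ω ^ 2) μ := by
      refine hY2i.mono (hJ.aestronglyMeasurable.mul hY2i.1) (Eventually.of_forall fun ω => ?_)
      rw [Pi.mul_apply, norm_mul]
      exact mul_le_of_le_one_left (norm_nonneg _) (by rw [Real.norm_eq_abs, abs_le]; constructor <;> linarith [hJ0 ω, hJ1 ω])
    have h1 := condExp_mul_of_stronglyMeasurable_right (μ := μ) (f := J) (hY.pow 2) hJY hJi
    have hpY : Integrable (fun ω => (μ[J | m]) ω * Y ω ^ 2) μ :=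
      (integrable_condExp (f := J * fun ω => Y ω ^ 2) (m := m) (μ := μ)).congr h1
    have h2 : ∫ ω, (μ[J | m]) ω * Y ω ^ 2 ∂μ = ∫ ω, J ω * Y ω ^ 2 ∂μ := by
      rw [← integral_condExp hm (f := fun ω => J ω * Y ω ^ 2)]
      exact (integral_congr_ae h1).symm
    calc ∫ ω, ((J ω - (μ[J | m]) ω) * Y ω) ^ 2 ∂μ
        ≤ ∫ ω, (J ω * Y ω ^ 2 + (μ[J | m]) ω * Y ω ^ 2) ∂μ := by
          refine integral_mono_ae hX2.integrable_sq (hJY.add hpY) ?_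
          filter_upwards [hp0, hp1] with ω h0 h1
          simp only [Pi.zero_apply] at h0
          have : (J ω - (μ[J | m]) ω) ^ 2 ≤ J ω + (μ[J | m]) ω := by
            nlinarith [hJ0 ω, hJ1 ω, mul_nonneg (hJ0 ω) h0]
          rw [mul_pow, ← add_mul]
          exact mul_le_mul_of_nonneg_right this (sq_nonneg _)
      _ = 2 * ∫ ω, J ω * Y ω ^ 2 ∂μ := by
          rw [integral_add (show Integrable (fun ω => J ω * Y ω ^ 2) μ from hJY) hpY, h2, two_mul]

theorem abs_setIntegral_Ico_sub_le {g : ℝ → ℝ} (hg : Integrable g) {a h c : ℝ} (hh : 0 ≤ h)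
    (hc : ∀ x ∈ Set.Icc a (a + h), |g x - g a| ≤ c) :
    |(∫ x in Set.Ico a (a + h), g x) - h * g a| ≤ h * c := by
  have h1 : (∫ x in Set.Ico a (a + h), g x) - h * g a = ∫ x in Set.Ico a (a + h), (g x - g a) := by
    rw [integral_sub hg.integrableOn (integrableOn_const (by simp))]
    simp [hh]
  rw [h1]
  have := norm_setIntegral_le_of_norm_le_const (μ := volume) (s := Set.Ico a (a + h))
    (f := fun x => g x - g a) (C := c) (by simp) (fun x hx => hc x ⟨hx.1, hx.2.le⟩)
  simpa [hh, mul_comm, Measure.real] using this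

theorem MeasureTheory.MeasurePreserving.integral_comp_ae {α β : Type*} {mα : MeasurableSpace α}
    {mβ : MeasurableSpace β} {μ : Measure α} {ν : Measure β} {S : α → β}
    (hS : MeasurePreserving S μ ν) {g : β → ℝ} (hg : AEStronglyMeasurable g ν) :
    ∫ a, g (S a) ∂μ = ∫ b, g b ∂ν := by
  rw [← hS.map_eq] at hg ⊢
  exact (integral_map hS.measurable.aemeasurable hg).symm

theorem tendsto_integral_indicator_Ico_mul {Ω : Type*} {m0 : MeasurableSpace Ω} {μ : Measure Ω}
    {U F : Ω → ℝ} (hU : Measurable U) {ξ : ℝ} (hξ : ∀ᵐ ω ∂μ, U ω ≠ ξ) (hF : Integrable F μ)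
    {h : ℕ → ℝ} (hh : Tendsto h atTop (nhds 0)) :
    Tendsto (fun n => ∫ ω, (Set.Ico ξ (ξ + h n)).indicator (fun _ => (1 : ℝ)) (U ω) * F ω ∂μ)
      atTop (nhds 0) := by
  rw [← integral_zero Ω ℝ (μ := μ)]
  refine tendsto_integral_of_dominated_convergence (fun ω => |F ω|) (fun n => ?_) hF.abs
    (fun n => ?_) ?_
  · exact ((measurable_const.indicator measurableSet_Ico).comp hU).aestronglyMeasurable.mul hF.1
  · refine Eventually.of_forall fun ω => ?_
    rw [norm_mul, Real.norm_eq_abs (F ω)]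
    refine mul_le_of_le_one_left (abs_nonneg _) ?_
    by_cases hx : U ω ∈ Set.Ico ξ (ξ + h n) <;> simp [hx]
  · filter_upwards [hξ] with ω hω
    refine tendsto_const_nhds.congr' ?_
    rcases lt_or_gt_of_ne hω with hlt | hgt
    · refine Eventually.of_forall fun n => ?_
      dsimp only
      rw [Set.indicator_of_notMem (fun hx => absurd hx.1 (not_le.2 hlt)), zero_mul]
    · filter_upwards [hh.eventually_lt_const (sub_pos.2 hgt)] with n hn
      rw [Set.indicator_of_notMem (fun hx => absurd hx.2 (by linarith)), zero_mul]

section ConditionalDensity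

variable {Ω : Type*} {m m0 : MeasurableSpace Ω} {μ : Measure Ω} [IsProbabilityMeasure μ]
  {U : Ω → ℝ} {g : Ω → ℝ → ℝ} {κ : Ω → ℝ} {ξ : ℝ}

theorem ae_integrable_of_condExp_indicator_eq (hm : m ≤ m0)
    (hdens : ∀ B : Set ℝ, MeasurableSet B →
      μ[fun ω => B.indicator (fun _ => (1 : ℝ)) (U ω) | m] =ᵐ[μ] fun ω => ∫ x in B, g ω x) :
    ∀ᵐ ω ∂μ, Integrable (g ω) := by
  have h := hdens Set.univ MeasurableSet.univ
  simp only [Set.indicator_univ, condExp_const hm, Measure.restrict_univ] at h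
  filter_upwards [h] with ω hω
  by_contra hn
  rw [integral_undef hn] at hω
  exact one_ne_zero hω

theorem ae_ne_of_condExp_indicator_eq (hm : m ≤ m0) (hU : Measurable U)
    (hdens : ∀ B : Set ℝ, MeasurableSet B →
      μ[fun ω => B.indicator (fun _ => (1 : ℝ)) (U ω) | m] =ᵐ[μ] fun ω => ∫ x in B, g ω x) :
    ∀ᵐ ω ∂μ, U ω ≠ ξ := by
  have h := integral_congr_ae (hdens {ξ} (measurableSet_singleton ξ))
  rw [integral_condExp hm] at h
  have h1 : ∀ ω, ∫ x in {ξ}, g ω x = 0 := fun ω => by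
    rw [Measure.restrict_eq_zero.2 (by simp), integral_zero_measure]
  simp only [h1, integral_zero] at h
  have h2 : (fun ω => ({ξ} : Set ℝ).indicator (fun _ => (1 : ℝ)) (U ω))
      = (U ⁻¹' {ξ}).indicator fun _ => (1 : ℝ) := rfl
  rw [h2, integral_indicator_const _ (hU (measurableSet_singleton ξ)), smul_eq_mul, mul_one,
    measureReal_eq_zero_iff] at h
  exact measure_eq_zero_iff_ae_notMem.1 h

theorem ae_abs_condExp_indicator_Ico_sub_le (hm : m ≤ m0)
    (hdens : ∀ B : Set ℝ, MeasurableSet B →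
      μ[fun ω => B.indicator (fun _ => (1 : ℝ)) (U ω) | m] =ᵐ[μ] fun ω => ∫ x in B, g ω x)
    {h : ℝ} (hh : 0 ≤ h)
    (hLip : ∀ᵐ ω ∂μ, ∀ x ∈ Set.Icc (ξ - h) (ξ + h), |g ω x - g ω ξ| ≤ κ ω * h) :
    ∀ᵐ ω ∂μ, |(μ[fun ω => (Set.Ico ξ (ξ + h)).indicator (fun _ => (1 : ℝ)) (U ω) | m]) ω
      - h * g ω ξ| ≤ h * (κ ω * h) := by
  filter_upwards [ae_integrable_of_condExp_indicator_eq hm hdens, hdens _ measurableSet_Ico, hLip]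
    with ω h1 h2 h3
  rw [h2]
  exact abs_setIntegral_Ico_sub_le h1 hh fun x hx => h3 x ⟨by linarith [hx.1], hx.2⟩

theorem aestronglyMeasurable_density_apply (hm : m ≤ m0)
    (hdens : ∀ B : Set ℝ, MeasurableSet B →
      μ[fun ω => B.indicator (fun _ => (1 : ℝ)) (U ω) | m] =ᵐ[μ] fun ω => ∫ x in B, g ω x)
    {δ : ℝ} (hδ : 0 < δ) (hLip : ∀ h ∈ Set.Ioc 0 δ,
      ∀ᵐ ω ∂μ, ∀ x ∈ Set.Icc (ξ - h) (ξ + h), |g ω x - g ω ξ| ≤ κ ω * h) :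
    AEStronglyMeasurable (fun ω => g ω ξ) μ := by
  let h : ℕ → ℝ := fun n => δ / (n + 1)
  have hh : ∀ n, h n ∈ Set.Ioc 0 δ := fun n =>
    ⟨by positivity, div_le_self hδ.le (by linarith [n.cast_nonneg (α := ℝ)])⟩
  have hlim : Tendsto h atTop (nhds 0) := by
    have := (tendsto_one_div_add_atTop_nhds_zero_nat (𝕜 := ℝ)).const_mul δ
    simpa [h, div_eq_mul_inv] using this
  refine aestronglyMeasurable_of_tendsto_ae atTop (f := fun n ω => (h n)⁻¹ *
    (μ[fun ω => (Set.Ico ξ (ξ + h n)).indicator (fun _ => (1 : ℝ)) (U ω) | m]) ω)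
    (fun n => integrable_condExp.aestronglyMeasurable.const_mul _) ?_
  filter_upwards [ae_all_iff.2 fun n => ae_abs_condExp_indicator_Ico_sub_le hm hdens
    (hh n).1.le (hLip _ (hh n))] with ω hω
  rw [tendsto_iff_norm_sub_tendsto_zero]
  refine squeeze_zero (fun n => norm_nonneg _) (fun n => ?_)
    (by simpa using hlim.const_mul (κ ω))
  have hpos := (hh n).1
  rw [← mul_le_mul_iff_right₀ hpos, Real.norm_eq_abs, ← abs_of_pos hpos, ← abs_mul,
    abs_of_pos hpos, mul_sub, mul_inv_cancel_left₀ hpos.ne']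
  exact hω n

end ConditionalDensity

theorem tendsto_measure_le_abs_of_integral_abs {Ω : Type*} {m0 : MeasurableSpace Ω} {μ : Measure Ω}
    [IsFiniteMeasure μ] {X : ℕ → Ω → ℝ} (hX : ∀ n, Integrable (X n) μ)
    (h : Tendsto (fun n => ∫ ω, |X n ω| ∂μ) atTop (nhds 0)) {ε : ℝ} (hε : 0 < ε) :
    Tendsto (fun n => μ {ω | ε ≤ |X n ω|}) atTop (nhds 0) := by
  have h1 : Tendsto (fun n => ENNReal.ofReal (ε⁻¹ * ∫ ω, |X n ω| ∂μ)) atTop (nhds 0) := by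
    simpa using ENNReal.tendsto_ofReal (h.const_mul ε⁻¹)
  refine tendsto_of_tendsto_of_tendsto_of_le_of_le tendsto_const_nhds h1 (fun _ => zero_le) fun n => ?_
  have h2 := mul_meas_ge_le_integral_of_nonneg (μ := μ) (f := fun ω => |X n ω|)
    (Eventually.of_forall fun ω => abs_nonneg _) (hX n).abs ε
  rw [← ofReal_measureReal]
  apply ENNReal.ofReal_le_ofReal
  rw [inv_mul_eq_div, le_div_iff₀ hε, mul_comm]
  exact h2

theorem integral_abs_sum_le {Ω : Type*} {m0 : MeasurableSpace Ω} {μ : Measure Ω}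
    {X : ℕ → Ω → ℝ} (hX : ∀ k, Integrable (X k) μ) {C : ℝ} (hC : ∀ k, ∫ ω, |X k ω| ∂μ ≤ C) (n : ℕ) :
    ∫ ω, |∑ k ∈ Finset.range n, X k ω| ∂μ ≤ n * C := by
  calc ∫ ω, |∑ k ∈ Finset.range n, X k ω| ∂μ
      ≤ ∫ ω, ∑ k ∈ Finset.range n, |X k ω| ∂μ :=
        integral_mono (integrable_finsetSum _ fun k _ => hX k).abs
          (integrable_finsetSum _ fun k _ => (hX k).abs) fun ω => Finset.abs_sum_le_sum_abs _ _
    _ = ∑ k ∈ Finset.range n, ∫ ω, |X k ω| ∂μ := integral_finsetSum _ fun k _ => (hX k).abs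
    _ ≤ n * C := by
        refine (Finset.sum_le_sum fun k _ => hC k).trans ?_
        simp

theorem integral_abs_add_mul_le {Ω : Type*} {m0 : MeasurableSpace Ω} {μ : Measure Ω}
    {A B : Ω → ℝ} (hA : Integrable A μ) (hB : Integrable B μ) (c : ℝ) :
    ∫ ω, |A ω + c * B ω| ∂μ ≤ ∫ ω, |A ω| ∂μ + |c| * ∫ ω, |B ω| ∂μ := by
  rw [← integral_const_mul, ← integral_add hA.abs (hB.abs.const_mul _)]
  refine integral_mono (hA.add (hB.const_mul c)).abs (hA.abs.add (hB.abs.const_mul _)) fun ω => ?_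
  simp only [← abs_mul]
  exact abs_add_le _ _

theorem tendsto_measure_weighted_indicator_sum {Ω : Type*} {m0 : MeasurableSpace Ω}
    {μ : Measure Ω} [IsProbabilityMeasure μ] {T : Ω → Ω} (hT : Ergodic T μ)
    {m : ℕ → MeasurableSpace Ω} (hm : ∀ k, m k ≤ m0) (hmono : Monotone m)
    {U Y κ : ℕ → Ω → ℝ} {g : ℕ → Ω → ℝ → ℝ}
    (hUT : ∀ k ω, U k ω = U 0 (T^[k] ω)) (hYT : ∀ k ω, Y k ω = Y 0 (T^[k] ω))
    (hκT : ∀ k ω, κ k ω = κ 0 (T^[k] ω)) (hgT : ∀ k ω x, g k ω x = g 0 (T^[k] ω) x)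
    (hU : ∀ j k, j < k → Measurable[m k] (U j)) (hY : ∀ k, Measurable[m k] (Y k))
    {ξ δ z : ℝ} (hδ : 0 < δ) (hz : 0 < z)
    (hdens : ∀ k, ∀ B : Set ℝ, MeasurableSet B →
      μ[fun ω => B.indicator (fun _ => (1 : ℝ)) (U k ω) | m k] =ᵐ[μ] fun ω => ∫ x in B, g k ω x)
    (hLip : ∀ h ∈ Set.Ioc 0 δ, ∀ k, ∀ᵐ ω ∂μ, ∀ x ∈ Set.Icc (ξ - h) (ξ + h),
      |g k ω x - g k ω ξ| ≤ κ k ω * h)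
    (hY2 : MemLp (Y 0) 2 μ) (hκY : Integrable (fun ω => κ 0 ω * |Y 0 ω|) μ)
    (hgY : MemLp (fun ω => g 0 ω ξ * Y 0 ω) 2 μ) {ε : ℝ} (hε : 0 < ε) :
    Tendsto (fun n : ℕ => μ {ω | ε ≤ |(√n)⁻¹ * (∑ k ∈ Finset.range n,
        U k ω * (Set.Ico ξ (ξ + z / √n)).indicator (fun _ => (1 : ℝ)) (U k ω) * Y k ω)
          - z * ξ * ∫ ω', g 0 ω' ξ * Y 0 ω' ∂μ|}) atTop (nhds 0) := by
  have hmp : ∀ k : ℕ, MeasurePreserving T^[k] μ μ := fun k => hT.toMeasurePreserving.iterate k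
  have hUm : ∀ k, Measurable (U k) := fun k => (hU k (k + 1) k.lt_succ_self).mono (hm _) le_rfl
  have hYm : ∀ k, Measurable (Y k) := fun k => (hY k).mono (hm _) le_rfl
  have hYk : ∀ k, MemLp (Y k) 2 μ := fun k => by
    have := hY2.comp_measurePreserving (hmp k)
    rwa [show Y 0 ∘ T^[k] = Y k from funext fun ω => (hYT k ω).symm] at this
  have hYi : ∀ k, Integrable (Y k) μ := fun k => (hYk k).integrable one_le_two
  have hgYk : ∀ k, Integrable (fun ω => g k ω ξ * Y k ω) μ := fun k => by
    have := (hmp k).integrable_comp_of_integrable (hgY.integrable one_le_two)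
    refine this.congr (Eventually.of_forall fun ω => ?_)
    simp only [Function.comp, hgT k ω, hYT k ω]
  let h : ℕ → ℝ := fun n => z / √n
  have hh0 : ∀ n, 0 ≤ h n := fun n => by positivity
  have hsqrt : Tendsto (fun n : ℕ => √(n : ℝ)) atTop atTop :=
    Real.tendsto_sqrt_atTop.comp tendsto_natCast_atTop_atTop
  have hh : Tendsto h atTop (nhds 0) := hsqrt.const_div_atTop z
  let J : ℕ → ℕ → Ω → ℝ := fun n k ω =>
    (Set.Ico ξ (ξ + h n)).indicator (fun _ => (1 : ℝ)) (U k ω)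
  have hJ0 : ∀ n k ω, 0 ≤ J n k ω := fun n k ω => Set.indicator_nonneg (fun _ _ => zero_le_one) _
  have hJ1 : ∀ n k ω, J n k ω ≤ 1 := fun n k ω =>
    Set.indicator_le_self' (fun _ _ => zero_le_one) _
  have hJn : ∀ n k ω, ‖J n k ω‖ ≤ 1 := fun n k ω => by
    rw [Real.norm_of_nonneg (hJ0 n k ω)]; exact hJ1 n k ω
  have hJm : ∀ n k, Measurable (J n k) := fun n k =>
    (measurable_const.indicator measurableSet_Ico).comp (hUm k)
  have hJadapt : ∀ n j k, j < k → Measurable[m k] (J n j) := fun n j k hjk =>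
    (measurable_const.indicator measurableSet_Ico).comp (hU j k hjk)
  have hJT : ∀ n k ω, J n k ω = J n 0 (T^[k] ω) := fun n k ω => by simp only [J, hUT k ω]
  let p : ℕ → ℕ → Ω → ℝ := fun n k => μ[J n k | m k]
  have hξ : ∀ᵐ ω ∂μ, U 0 ω ≠ ξ := ae_ne_of_condExp_indicator_eq (hm 0) (hUm 0) (hdens 0)
  have hJYi : ∀ n k, Integrable (fun ω => J n k ω * Y k ω) μ := fun n k =>
    (hYi k).bdd_mul (hJm n k).aestronglyMeasurable (Eventually.of_forall (hJn n k))
  -- the factor `U k` may be replaced by `ξ`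
  have hUJ : ∀ n k ω, |(U k ω - ξ) * J n k ω| ≤ h n * J n k ω := by
    intro n k ω
    by_cases hx : U k ω ∈ Set.Ico ξ (ξ + h n)
    · have h1 : J n k ω = 1 := Set.indicator_of_mem hx _
      rw [h1, mul_one, mul_one, abs_le]
      constructor <;> linarith [hx.1, hx.2, hh0 n]
    · have h1 : J n k ω = 0 := Set.indicator_of_notMem hx _
      simp [h1]
  have hAi : ∀ n k, Integrable (fun ω => (U k ω - ξ) * J n k ω * Y k ω) μ := fun n k =>
    (hYi k).bdd_mul (c := h n) (((hUm k).sub_const ξ).mul (hJm n k)).aestronglyMeasurable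
      (Eventually.of_forall fun ω => (hUJ n k ω).trans (mul_le_of_le_one_right (hh0 n) (hJ1 n k ω)))
  have hA : Tendsto (fun n : ℕ => ∫ ω, |(√n)⁻¹ * ∑ k ∈ Finset.range n,
      (U k ω - ξ) * J n k ω * Y k ω| ∂μ) atTop (nhds 0) := by
    have hlim := (tendsto_integral_indicator_Ico_mul (hUm 0) hξ (hYi 0).abs hh).const_mul z
    rw [mul_zero] at hlim
    refine squeeze_zero' (Eventually.of_forall fun n => integral_nonneg fun ω => abs_nonneg _)
      ?_ hlim
    filter_upwards [eventually_gt_atTop 0] with n hn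
    have hn' : (0 : ℝ) < n := Nat.cast_pos.2 hn
    have hk : ∀ k, ∫ ω, |(U k ω - ξ) * J n k ω * Y k ω| ∂μ ≤ h n * ∫ ω, J n 0 ω * |Y 0 ω| ∂μ := by
      intro k
      have hJYa : Integrable (fun ω => J n k ω * |Y k ω|) μ :=
        (hYi k).abs.bdd_mul (hJm n k).aestronglyMeasurable (Eventually.of_forall (hJn n k))
      have hst : ∫ ω, J n k ω * |Y k ω| ∂μ = ∫ ω, J n 0 ω * |Y 0 ω| ∂μ := by
        rw [← (hmp k).integral_comp_ae (g := fun ω => J n 0 ω * |Y 0 ω|)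
          ((hJm n 0).aestronglyMeasurable.mul (hYi 0).abs.1)]
        simp only [← hJT, ← hYT]
      rw [← hst, ← integral_const_mul]
      refine integral_mono (hAi n k).abs (hJYa.const_mul _) fun ω => ?_
      dsimp only
      rw [abs_mul, ← mul_assoc]
      exact mul_le_mul_of_nonneg_right (hUJ n k ω) (abs_nonneg _)
    have := integral_abs_sum_le (hAi n) hk n
    simp only [abs_mul (√(n : ℝ))⁻¹, abs_of_nonneg (inv_nonneg.2 (Real.sqrt_nonneg (n : ℝ))),
      integral_const_mul]
    refine (mul_le_mul_of_nonneg_left this (by positivity)).trans (le_of_eq ?_)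
    have hs : √(n : ℝ) ≠ 0 := (Real.sqrt_pos.2 hn').ne'
    change (√(n : ℝ))⁻¹ * (n * (z / √n * ∫ ω, J n 0 ω * |Y 0 ω| ∂μ)) = z * ∫ ω, J n 0 ω * |Y 0 ω| ∂μ
    field_simp
    rw [Real.sq_sqrt hn'.le]
  -- the indicators may be replaced by their conditional expectations
  have hmart := fun n k => condExp_sub_condExp_mul (hm k) (hJm n k) (hJ0 n k) (hJ1 n k)
    (hY k).stronglyMeasurable (hYk k)
  have hBi : ∀ n k, Integrable (fun ω => (J n k ω - p n k ω) * Y k ω) μ := fun n k =>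
    (hmart n k).1.integrable one_le_two
  have hB : Tendsto (fun n : ℕ => ∫ ω, |(√n)⁻¹ * ∑ k ∈ Finset.range n,
      (J n k ω - p n k ω) * Y k ω| ∂μ) atTop (nhds 0) := by
    have hlim := ((tendsto_integral_indicator_Ico_mul (hUm 0) hξ (hYk 0).integrable_sq hh).const_mul
      2).sqrt
    rw [mul_zero, Real.sqrt_zero] at hlim
    refine squeeze_zero' (Eventually.of_forall fun n => integral_nonneg fun ω => abs_nonneg _)
      ?_ hlim
    filter_upwards [eventually_gt_atTop 0] with n hn
    have hn' : (0 : ℝ) < n := Nat.cast_pos.2 hn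
    have hst : ∀ k, ∫ ω, J n k ω * Y k ω ^ 2 ∂μ = ∫ ω, J n 0 ω * Y 0 ω ^ 2 ∂μ := by
      intro k
      rw [← (hmp k).integral_comp_ae (g := fun ω => J n 0 ω * Y 0 ω ^ 2)
        ((hJm n 0).aestronglyMeasurable.mul (hYk 0).integrable_sq.1)]
      simp only [← hJT, ← hYT]
    have hadapt : ∀ j k, j < k →
        AEStronglyMeasurable[m k] (fun ω => (J n j ω - p n j ω) * Y j ω) μ := by
      intro j k hjk
      refine StronglyMeasurable.aestronglyMeasurable ?_
      exact ((hJadapt n j k hjk).stronglyMeasurable.sub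
        (stronglyMeasurable_condExp.mono (hmono hjk.le))).mul
        ((hY j).stronglyMeasurable.mono (hmono hjk.le))
    have := integral_abs_sum_le_of_condExp_eq_zero hm (fun k => (hmart n k).1) hadapt
      (fun k => (hmart n k).2.1) (fun k => (hmart n k).2.2.trans_eq (by rw [hst k])) n
    simp only [abs_mul (√(n : ℝ))⁻¹, abs_of_nonneg (inv_nonneg.2 (Real.sqrt_nonneg (n : ℝ))),
      integral_const_mul]
    refine (mul_le_mul_of_nonneg_left this (by positivity)).trans (le_of_eq ?_)
    rw [Real.sqrt_mul hn'.le, inv_mul_cancel_left₀ (Real.sqrt_pos.2 hn').ne']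
  -- the conditional expectations may be linearised
  have hCi : ∀ n k, Integrable (fun ω => (p n k ω - h n * g k ω ξ) * Y k ω) μ := fun n k => by
    refine (((hJYi n k).sub (hBi n k)).sub ((hgYk k).const_mul (h n))).congr
      (Eventually.of_forall fun ω => ?_)
    simp only [Pi.sub_apply]
    ring
  have hC : Tendsto (fun n : ℕ => ∫ ω, |(√n)⁻¹ * ∑ k ∈ Finset.range n,
      (p n k ω - h n * g k ω ξ) * Y k ω| ∂μ) atTop (nhds 0) := by
    have hlim : Tendsto (fun n => z * h n * ∫ ω, κ 0 ω * |Y 0 ω| ∂μ) atTop (nhds 0) := by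
      simpa using (hh.const_mul z).mul_const (∫ ω, κ 0 ω * |Y 0 ω| ∂μ)
    refine squeeze_zero' (Eventually.of_forall fun n => integral_nonneg fun ω => abs_nonneg _)
      ?_ hlim
    filter_upwards [eventually_gt_atTop 0, hh.eventually_lt_const hδ] with n hn hnδ
    have hn' : (0 : ℝ) < n := Nat.cast_pos.2 hn
    have hk : ∀ k, ∫ ω, |(p n k ω - h n * g k ω ξ) * Y k ω| ∂μ
        ≤ h n * h n * ∫ ω, κ 0 ω * |Y 0 ω| ∂μ := by
      intro k
      have hi : Integrable (fun ω => κ k ω * |Y k ω|) μ :=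
        ((hmp k).integrable_comp_of_integrable hκY).congr
          (Eventually.of_forall fun ω => by simp only [Function.comp, ← hκT, ← hYT])
      have hst : ∫ ω, κ k ω * |Y k ω| ∂μ = ∫ ω, κ 0 ω * |Y 0 ω| ∂μ := by
        rw [← (hmp k).integral_comp_ae (g := fun ω => κ 0 ω * |Y 0 ω|) hκY.1]
        simp only [← hκT, ← hYT]
      rw [← hst, ← integral_const_mul]
      refine integral_mono_ae (hCi n k).abs (hi.const_mul _) ?_
      filter_upwards [ae_abs_condExp_indicator_Ico_sub_le (hm k) (hdens k) (hh0 n)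
        (hLip (h n) ⟨div_pos hz (Real.sqrt_pos.2 hn'), hnδ.le⟩ k)] with ω hω
      rw [abs_mul]
      refine (mul_le_mul_of_nonneg_right hω (abs_nonneg _)).trans (le_of_eq ?_)
      ring
    have := integral_abs_sum_le (hCi n) hk n
    simp only [abs_mul (√(n : ℝ))⁻¹, abs_of_nonneg (inv_nonneg.2 (Real.sqrt_nonneg (n : ℝ))),
      integral_const_mul]
    refine (mul_le_mul_of_nonneg_left this (by positivity)).trans (le_of_eq ?_)
    have hs : √(n : ℝ) ≠ 0 := (Real.sqrt_pos.2 hn').ne'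
    change (√(n : ℝ))⁻¹ * (n * (z / √n * h n * ∫ ω, κ 0 ω * |Y 0 ω| ∂μ))
      = z * h n * ∫ ω, κ 0 ω * |Y 0 ω| ∂μ
    field_simp
    rw [Real.sq_sqrt hn'.le]
  -- the mean ergodic theorem
  have hG := hT.tendsto_integral_abs_average_sub hgY
  simp only [← hgT, ← hYT] at hG
  set c := ∫ ω, g 0 ω ξ * Y 0 ω ∂μ
  have hXi : ∀ n : ℕ, Integrable (fun ω => (√n)⁻¹ * (∑ k ∈ Finset.range n,
      U k ω * J n k ω * Y k ω) - z * ξ * c) μ := fun n => by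
    refine ((integrable_finsetSum _ fun k _ => ?_).const_mul _).sub (integrable_const _)
    refine ((hAi n k).add ((hJYi n k).const_mul ξ)).congr (Eventually.of_forall fun ω => ?_)
    simp only [Pi.add_apply]
    ring
  refine tendsto_measure_le_abs_of_integral_abs hXi ?_ hε
  have hlim := ((hA.add (hB.const_mul |ξ|)).add (hC.const_mul |ξ|)).add (hG.const_mul |z * ξ|)
  simp only [mul_zero, add_zero] at hlim
  refine squeeze_zero' (Eventually.of_forall fun n => integral_nonneg fun ω => abs_nonneg _)
    ?_ hlim
  filter_upwards [eventually_gt_atTop 0] with n hn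
  have hn' : (0 : ℝ) < n := Nat.cast_pos.2 hn
  have hdecomp : ∀ ω, (√n)⁻¹ * (∑ k ∈ Finset.range n, U k ω * J n k ω * Y k ω) - z * ξ * c
      = (√n)⁻¹ * (∑ k ∈ Finset.range n, (U k ω - ξ) * J n k ω * Y k ω)
      + ξ * ((√n)⁻¹ * ∑ k ∈ Finset.range n, (J n k ω - p n k ω) * Y k ω)
      + ξ * ((√n)⁻¹ * ∑ k ∈ Finset.range n, (p n k ω - h n * g k ω ξ) * Y k ω)
      + z * ξ * ((n : ℝ)⁻¹ * (∑ k ∈ Finset.range n, g k ω ξ * Y k ω) - c) := by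
    intro ω
    have hinv : z * (n : ℝ)⁻¹ = (√n)⁻¹ * h n := by
      change _ = (√(n : ℝ))⁻¹ * (z / √n)
      rw [div_eq_mul_inv, mul_left_comm, ← mul_inv, Real.mul_self_sqrt hn'.le]
    have h1 : z * ξ * ((n : ℝ)⁻¹ * (∑ k ∈ Finset.range n, g k ω ξ * Y k ω) - c)
        = ξ * ((√n)⁻¹ * ∑ k ∈ Finset.range n, h n * (g k ω ξ * Y k ω)) - z * ξ * c := by
      rw [← Finset.mul_sum]
      linear_combination ξ * (∑ k ∈ Finset.range n, g k ω ξ * Y k ω) * hinv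
    rw [h1]
    simp only [Finset.mul_sum, ← add_sub_assoc, ← Finset.sum_add_distrib]
    congr 1
    exact Finset.sum_congr rfl fun k _ => by ring
  simp only [hdecomp]
  have hAn := (integrable_finsetSum (Finset.range n) fun k _ => hAi n k).const_mul (√n)⁻¹
  have hBn := (integrable_finsetSum (Finset.range n) fun k _ => hBi n k).const_mul (√n)⁻¹
  have hCn := (integrable_finsetSum (Finset.range n) fun k _ => hCi n k).const_mul (√n)⁻¹
  have hGn := ((integrable_finsetSum (Finset.range n) fun k _ => hgYk k).const_mul
    (n : ℝ)⁻¹).sub (integrable_const c)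
  have hABn := hAn.add (hBn.const_mul ξ)
  refine (integral_abs_add_mul_le (hABn.add (hCn.const_mul ξ)) hGn (z * ξ)).trans ?_
  refine add_le_add ((integral_abs_add_mul_le hABn hCn ξ).trans ?_) le_rfl
  exact add_le_add (integral_abs_add_mul_le hAn hBn ξ) le_rfl

/-- Step ii) of the proof of the paper's main theorem: with `(u_t, D_t)` strictly
stationary ergodic (shift representation), `D_t` being `F_{t-1}`-measurable for the
filtration generated by `(u_s, D_{s+1})_{s ≤ t-1}`, `E‖D_t‖⁸ < ∞`, conditional density
`f_{t-1}` of `u_t` with fourth-moment local uniform integrability and local Lipschitz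
control around `ξ`, one has, for every `z > 0`,
`n^{-1/2} ∑_{t=1}^n u_t 𝟙_{ξ ≤ u_t < ξ + z/√n} D_t → z ξ E[f₀(ξ) D₁]` in probability
(componentwise; here `f t` is the conditional density of `u_t` given `F_{t-1}`,
so the paper's `f₀` is `f 1`). -/
theorem stmt16 {Ω : Type*} [m0 : MeasureSpace Ω] [IsProbabilityMeasure (ℙ : Measure Ω)]
    (d : ℕ) (T : Ω → Ω) (hT : MeasurePreserving T ℙ ℙ) (hTerg : Ergodic T ℙ)
    (u : ℤ → Ω → ℝ) (D : ℤ → Ω → Fin d → ℝ)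
    (hu : ∀ t, Measurable (u t)) (hD : ∀ t, Measurable (D t))
    (hshift_u : ∀ t ω, u (t + 1) ω = u t (T ω))
    (hshift_D : ∀ t ω, D (t + 1) ω = D t (T ω))
    -- conditional density of u_t given F_{t-1} = σ((u_s, D_{s+1}), s ≤ t-1):
    (f : ℤ → Ω → ℝ → ℝ)
    (hshift_f : ∀ t ω x, f (t + 1) ω x = f t (T ω) x)
    (hdens : ∀ (t : ℤ) (B : Set ℝ), MeasurableSet B →
      (ℙ[(fun ω => B.indicator (fun _ => (1 : ℝ)) (u t ω)) | ⨆ (s : ℤ) (_ : s ≤ t - 1),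
          MeasurableSpace.comap (fun ω => (u s ω, D (s + 1) ω)) inferInstance]
        =ᵐ[ℙ] fun ω => ∫ x in B, f t ω x))
    (ξ δ : ℝ) (hδ : 0 < δ)
    -- E‖D_t‖⁸ < ∞ :
    (hDmom : Integrable (fun ω => ‖D 0 ω‖ ^ 8) ℙ)
    -- E[sup_{x ∈ [ξ-δ, ξ+δ]} f_{t-1}⁴(x)] < ∞ :
    (hsup_bdd : ∀ᵐ ω ∂ℙ, BddAbove ((fun x => (f 1 ω x) ^ 4) '' Set.Icc (ξ - δ) (ξ + δ)))
    (hsup_int : Integrable (fun ω => ⨆ x ∈ Set.Icc (ξ - δ) (ξ + δ), (f 1 ω x) ^ 4) ℙ)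
    -- local Lipschitz behaviour of the conditional density around ξ :
    (K : ℤ → Ω → ℝ) (hKmeas : ∀ t, Measurable (K t))
    (hshift_K : ∀ t ω, K (t + 1) ω = K t (T ω))
    (hKadapt : ∀ t : ℤ, Measurable[⨆ (s : ℤ) (_ : s ≤ t),
        MeasurableSpace.comap (fun ω => (u s ω, D (s + 1) ω)) inferInstance] (K t))
    (hKint : Integrable (fun ω => (K 0 ω) ^ 4) ℙ)
    (hLip : ∃ δ₀ : ℝ, 0 < δ₀ ∧ ∀ δ' ∈ Set.Ioc (0 : ℝ) δ₀, ∀ t : ℤ, ∀ᵐ ω ∂ℙ,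
      ∀ x ∈ Set.Icc (ξ - δ') (ξ + δ'), |f t ω x - f t ω ξ| ≤ K (t - 1) ω * δ')
    (z : ℝ) (hz : 0 < z) :
    -- componentwise convergence in probability:
    ∀ i : Fin d, ∀ δp : ℝ, 0 < δp →
      Tendsto (fun n : ℕ => ℙ {ω | δp ≤
          |(Real.sqrt n)⁻¹ * (∑ t ∈ Finset.Icc (1 : ℤ) (n : ℤ),
              u t ω * (if ξ ≤ u t ω ∧ u t ω < ξ + z / Real.sqrt n then (1 : ℝ) else 0) *
                D t ω i) -
            z * ξ * ∫ ω', f 1 ω' ξ * D 1 ω' i ∂ℙ|})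
        atTop (nhds 0) := by
  have hmp := hTerg.toMeasurePreserving
  let F : ℕ → MeasurableSpace Ω := fun k => ⨆ (s : ℤ) (_ : s ≤ ((k : ℤ) + 1) - 1),
    MeasurableSpace.comap (fun ω => (u s ω, D (s + 1) ω)) inferInstance
  have hF : ∀ k, F k ≤ m0.toMeasurableSpace := fun k =>
    iSup₂_le fun s _ => ((hu s).prodMk (hD (s + 1))).comap_le
  have hFmono : Monotone F := fun j k hjk =>
    iSup₂_le fun s hs => le_iSup₂_of_le s (by lia) le_rfl
  have hpair : ∀ (s : ℤ) (k : ℕ), s ≤ k → Measurable[F k] fun ω => (u s ω, D (s + 1) ω) :=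
    fun s k hs => (comap_measurable _).mono (le_iSup₂_of_le s (by lia) le_rfl) le_rfl
  have hshift : ∀ (v : ℤ → Ω → ℝ) (_ : ∀ t ω, v (t + 1) ω = v t (T ω)) (k : ℕ) (ω : Ω),
      v ((k : ℤ) + 1) ω = v (((0 : ℕ) : ℤ) + 1) (T^[k] ω) := by
    intro v hv k
    induction k with
    | zero => intro ω; rfl
    | succ k ih =>
      intro ω
      rw [hv, Function.iterate_succ_apply, ← ih]
      push_cast
      rfl
  intro i ε hε
  obtain ⟨δ₀, hδ₀, hLip⟩ := hLip
  have hD8 : Integrable (fun ω => ‖D 1 ω‖ ^ 8) ℙ :=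
    (hmp.integrable_comp_of_integrable hDmom).congr
      (Eventually.of_forall fun ω => by simp only [Function.comp, ← hshift_D, zero_add])
  have hDi : Measurable fun ω => D 1 ω i := (measurable_pi_apply i).comp (hD 1)
  have hDle : ∀ ω, |D 1 ω i| ≤ ‖D 1 ω‖ := fun ω => norm_le_pi_norm (D 1 ω) i
  have hD2 : Integrable (fun ω => D 1 ω i ^ 2) ℙ := by
    refine ((integrable_const (1 : ℝ)).add hD8).mono' (hDi.pow_const 2).aestronglyMeasurable
      (Eventually.of_forall fun ω => ?_)
    have h1 : |D 1 ω i| ^ 2 ≤ ‖D 1 ω‖ ^ 2 := pow_le_pow_left₀ (abs_nonneg _) (hDle ω) 2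
    rw [Real.norm_eq_abs, abs_pow, Pi.add_apply]
    nlinarith [sq_nonneg (‖D 1 ω‖ ^ 2 - 1), sq_nonneg (‖D 1 ω‖ ^ 4 - 1)]
  have hK2 : Integrable (fun ω => K 0 ω ^ 2) ℙ := by
    refine ((integrable_const (1 : ℝ)).add hKint).mono' ((hKmeas 0).pow_const 2).aestronglyMeasurable
      (Eventually.of_forall fun ω => ?_)
    rw [Real.norm_eq_abs, abs_pow, sq_abs, Pi.add_apply]
    nlinarith [sq_nonneg (K 0 ω ^ 2 - 1)]
  have hDmem : MemLp (fun ω => D 1 ω i) 2 ℙ :=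
    (memLp_two_iff_integrable_sq hDi.aestronglyMeasurable).2 hD2
  have hKmem : MemLp (K 0) 2 ℙ :=
    (memLp_two_iff_integrable_sq (hKmeas 0).aestronglyMeasurable).2 hK2
  have hfm : AEStronglyMeasurable (fun ω => f 1 ω ξ) ℙ :=
    aestronglyMeasurable_density_apply (hF 0) (hdens 1) hδ₀ fun h hh => hLip h hh 1
  have hfD : MemLp (fun ω => f 1 ω ξ * D 1 ω i) 2 ℙ := by
    have hm : AEStronglyMeasurable (fun ω => f 1 ω ξ * D 1 ω i) ℙ :=
      hfm.mul hDi.aestronglyMeasurable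
    refine (memLp_two_iff_integrable_sq hm).2 ?_
    refine (hsup_int.add ((integrable_const (1 : ℝ)).add hD8)).mono' (hm.pow 2) ?_
    filter_upwards [hsup_bdd] with ω hω
    have hξ : ξ ∈ Set.Icc (ξ - δ) (ξ + δ) := ⟨by linarith, by linarith⟩
    have hsup : f 1 ω ξ ^ 4 ≤ ⨆ x ∈ Set.Icc (ξ - δ) (ξ + δ), f 1 ω x ^ 4 := by
      obtain ⟨b, hb⟩ := hω
      have hbdd : BddAbove (Set.range fun x => ⨆ _ : x ∈ Set.Icc (ξ - δ) (ξ + δ), f 1 ω x ^ 4) := by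
        refine ⟨max b 0, ?_⟩
        rintro _ ⟨x, rfl⟩
        exact Real.iSup_le (fun hx => (hb ⟨x, hx, rfl⟩).trans (le_max_left _ _)) (le_max_right _ _)
      refine le_trans (le_of_eq ?_) (le_ciSup hbdd ξ)
      rw [ciSup_pos hξ]
    have h4 : (D 1 ω i ^ 2) ^ 2 ≤ ‖D 1 ω‖ ^ 4 := by
      rw [← pow_mul, ← (show Even (2 * 2) by decide).pow_abs]
      exact pow_le_pow_left₀ (abs_nonneg _) (hDle ω) 4
    simp only [Pi.add_apply]
    rw [Real.norm_of_nonneg (sq_nonneg _), mul_pow]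
    nlinarith [sq_nonneg (f 1 ω ξ ^ 2 - D 1 ω i ^ 2), sq_nonneg (‖D 1 ω‖ ^ 4 - 1),
      sq_nonneg (f 1 ω ξ ^ 2 + D 1 ω i ^ 2)]
  have hKD : Integrable (fun ω => K 0 ω * |D 1 ω i|) ℙ := hKmem.integrable_mul hDmem.abs
  have key := tendsto_measure_weighted_indicator_sum hTerg (m := F) hF hFmono
    (U := fun k => u ((k : ℤ) + 1)) (Y := fun k ω => D ((k : ℤ) + 1) ω i)
    (κ := fun k => K ((k : ℤ) + 1 - 1)) (g := fun k => f ((k : ℤ) + 1)) (ξ := ξ)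
    (hshift u hshift_u) (hshift (fun t ω => D t ω i) fun t ω => by rw [hshift_D])
    (hshift (fun t => K (t - 1)) fun t ω => by rw [← hshift_K]; ring_nf)
    (fun k ω x => hshift (fun t ω => f t ω x) (fun t ω => hshift_f t ω x) k ω)
    (fun j k hjk => measurable_fst.comp (hpair _ k (by lia)))
    (fun k => (measurable_pi_apply i).comp (measurable_snd.comp (hpair k k le_rfl)))
    hδ₀ hz (fun k => hdens _) (fun h hh k => hLip h hh _)
    (by simpa using hDmem) (by simpa using hKD)
    (by simpa using hfD) hε
  refine key.congr fun n => ?_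
  have hreindex : ∀ a : ℤ → ℝ, ∑ t ∈ Finset.Icc (1 : ℤ) n, a t
      = ∑ k ∈ Finset.range n, a ((k : ℤ) + 1) := by
    intro a
    refine (Finset.sum_bij (fun (k : ℕ) _ => (k : ℤ) + 1) (fun k hk => ?_) (fun j _ k _ h => ?_)
      (fun t ht => ?_) fun _ _ => rfl).symm
    · rw [Finset.mem_range] at hk
      rw [Finset.mem_Icc]
      lia
    · lia
    · rw [Finset.mem_Icc] at ht
      exact ⟨(t - 1).toNat, by rw [Finset.mem_range]; lia, by lia⟩
  simp only [hreindex, Set.indicator_apply, Set.mem_Ico, Nat.cast_zero, zero_add]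
end
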